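/- Let k be a number field. For every ε > 0 there is a constant depending only on k and ε such that for every squarefree integral ideal r of O_k, the number of S3-cubic extensions K/k (up to isomorphism) with Disc(K) ≤ X that are totally ramified at every prime dividing r is at most O_{k,ε}(X / |r|^{2 − ε}); the implied constant is independent of r. -/

import Mathlib

open scoped Classical NumberField

noncomputable section

variable (k : Type*) [Field k] [NumberField k]

local notation "kbar" => AlgebraicClosure k

/-- The permutation of the embeddings of `K` into `kbar` induced by an automorphism
of `kbar` over `k` (acting by post-composition). -/
def galPerm (K : IntermediateField k kbar) (σ : kbar ≃ₐ[k] kbar) :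
    Equiv.Perm (K →ₐ[k] kbar) where
  toFun f := σ.toAlgHom.comp f
  invFun f := σ.symm.toAlgHom.comp f
  left_inv f := by ext x; simp
  right_inv f := by ext x; simp

/-- The action of the absolute Galois group of `k` on the embeddings of `K`, as a
homomorphism to the permutation group of the embeddings.  Its image is isomorphic to the
Galois group of the Galois closure of `K` over `k`, viewed as a permutation group on the
embeddings of `K`. -/
def galPermHom (K : IntermediateField k kbar) :
    (kbar ≃ₐ[k] kbar) →* Equiv.Perm (K →ₐ[k] kbar) where
  toFun := galPerm k K
  map_one' := by
    refine Equiv.ext fun f => AlgHom.ext fun x => ?_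
    simp [galPerm]
  map_mul' σ τ := by
    refine Equiv.ext fun f => AlgHom.ext fun x => ?_
    simp [galPerm]

/-- `K` is an `S3`-cubic extension of `k`: it has degree `3` over `k` and the Galois group
of its Galois closure over `k` is the full symmetric group on the three embeddings of `K`
into `kbar`, i.e. the absolute Galois group of `k` surjects onto this symmetric group. -/
def IsSThreeCubic (K : IntermediateField k kbar) : Prop :=
  Module.finrank k K = 3 ∧ Function.Surjective (galPermHom k K)

/-- `Disc(K)`: the absolute norm to `ℚ` of the discriminant of `K/ℚ`
(junk value `0` if `K` is infinite-dimensional over `k`). -/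
def absDisc (K : IntermediateField k kbar) : ℕ :=
  haveI : CharZero K := (algebraMap K kbar).charZero
  if h : FiniteDimensional k K then
    haveI := h
    haveI : IsScalarTower ℚ k K := IsScalarTower.of_algebraMap_eq' (Subsingleton.elim _ _)
    haveI : FiniteDimensional ℚ K := Module.Finite.trans k K
    haveI : NumberField K := ⟨⟩
    (NumberField.discr K).natAbs
  else 0

/-- `K` is partially ramified at the prime `p` of `k`: `p 𝒪_K = P₁² P₂`
with `P₁ ≠ P₂` prime. -/
def PartiallyRamified (K : IntermediateField k kbar) (p : Ideal (𝓞 k)) : Prop :=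
  ∃ P₁ P₂ : Ideal (𝓞 K), P₁.IsPrime ∧ P₂.IsPrime ∧ P₁ ≠ P₂ ∧
    Ideal.map (algebraMap (𝓞 k) (𝓞 K)) p = P₁ ^ 2 * P₂

/-- `K` is totally ramified at the prime `p` of `k`: `p 𝒪_K = P³` with `P` prime. -/
def TotallyRamified (K : IntermediateField k kbar) (p : Ideal (𝓞 k)) : Prop :=
  ∃ P : Ideal (𝓞 K), P.IsPrime ∧
    Ideal.map (algebraMap (𝓞 k) (𝓞 K)) p = P ^ 3

/-- Two subfields of `kbar` are identified when they are isomorphic over `k`. -/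
def isoSetoid : Setoid (IntermediateField k kbar) where
  r K L := Nonempty (K ≃ₐ[k] L)
  iseqv := ⟨fun _ => ⟨AlgEquiv.refl⟩, fun ⟨e⟩ => ⟨e.symm⟩, fun ⟨e⟩ ⟨f⟩ => ⟨e.trans f⟩⟩

/-- The number of isomorphism classes of members of a given collection of extensions
of `k` inside `kbar`. -/
def countClasses (S : Set (IntermediateField k kbar)) : ℕ :=
  Nat.card (Quotient (Setoid.comap (Subtype.val : S → _) (isoSetoid k)))

section squeeze
open MeasureTheory Module
variable {E : Type*} [NormedAddCommGroup E] [InnerProductSpace ℝ E] [FiniteDimensional ℝ E]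

/-- The linear map that is the identity on `V` and multiplication by `c⁻¹` on `Vᗮ`. -/
def squeeze (V : Submodule ℝ E) (c : ℝ) : E →ₗ[ℝ] E :=
  c⁻¹ • LinearMap.id + (1 - c⁻¹) • (V.starProjection : E →ₗ[ℝ] E)

lemma squeeze_apply (V : Submodule ℝ E) (c : ℝ) (x : E) :
    squeeze V c x = c⁻¹ • x + (1 - c⁻¹) • V.starProjection x := by
  simp [squeeze]

lemma squeeze_of_mem (V : Submodule ℝ E) (c : ℝ) {x : E} (hx : x ∈ V) : squeeze V c x = x := by
  rw [squeeze_apply, Submodule.starProjection_eq_self_iff.mpr hx, ← add_smul]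
  simp

lemma norm_le_norm_squeeze (V : Submodule ℝ E) {c : ℝ} (hc : 1 ≤ c) (x : E) :
    ‖x‖ ≤ c * ‖squeeze V c x‖ := by
  have hc0 : c ≠ 0 := by positivity
  set y := squeeze V c x with hy
  have hPy : V.starProjection y = V.starProjection x := by
    rw [hy, squeeze_apply, map_add, map_smul, map_smul,
      Submodule.starProjection_eq_self_iff.mpr (Submodule.starProjection_apply_mem V x),
      ← add_smul]
    simp
  have hx : x = y + (c - 1) • Vᗮ.starProjection y := by
    have h1 : Vᗮ.starProjection y = y - V.starProjection y := by
      rw [Submodule.starProjection_orthogonal']; simp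
    rw [h1, hPy, hy, squeeze_apply]
    match_scalars <;> field_simp <;> ring
  calc ‖x‖ ≤ ‖y‖ + (c - 1) * ‖Vᗮ.starProjection y‖ := by
        conv_lhs => rw [hx]
        refine (norm_add_le _ _).trans ?_
        rw [norm_smul, Real.norm_of_nonneg (by linarith)]
    _ ≤ ‖y‖ + (c - 1) * ‖y‖ := by
        have := Submodule.norm_starProjection_apply_le Vᗮ y
        nlinarith
    _ = c * ‖y‖ := by ring

lemma det_squeeze (V : Submodule ℝ E) (c : ℝ) :
    LinearMap.det (squeeze V c) = c⁻¹ ^ Module.finrank ℝ Vᗮ := by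
  have hcompl : IsCompl V Vᗮ := Submodule.isCompl_orthogonal V
  let e := Submodule.prodEquivOfIsCompl V Vᗮ hcompl
  have : squeeze V c = e ∘ₗ (LinearMap.prodMap (LinearMap.id : V →ₗ[ℝ] V)
      (c⁻¹ • (LinearMap.id : Vᗮ →ₗ[ℝ] Vᗮ))) ∘ₗ e.symm := by
    rw [← LinearMap.comp_assoc]
    rw [LinearEquiv.eq_comp_toLinearMap_symm]
    refine LinearMap.ext fun ⟨v, w⟩ => ?_
    simp only [LinearMap.comp_apply, LinearEquiv.coe_coe, LinearMap.prodMap_apply,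
      LinearMap.id_apply, LinearMap.smul_apply, e, Submodule.coe_prodEquivOfIsCompl']
    rw [map_add, squeeze_of_mem V c v.2, squeeze_apply,
      (Submodule.starProjection_apply_eq_zero_iff (K := V)).mpr w.2]
    simp
  rw [this, LinearMap.det_conj, LinearMap.det_prodMap]
  simp


/-- Minkowski's theorem for a lattice whose points outside `V₁ ≤ V₂` are long. -/
lemma mul_volume_ball_le_covolume [MeasurableSpace E] [BorelSpace E]
    (Λ : Submodule ℤ E) [DiscreteTopology Λ] [IsZLattice ℝ Λ] (V₁ V₂ : Submodule ℝ E)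
    (hV : V₁ ≤ V₂) {l m : ℝ} (hl : 1 ≤ l) (hlm : l ≤ m)
    (h₀ : ∀ x ∈ Λ, x ≠ 0 → 1 ≤ ‖x‖) (h₁ : ∀ x ∈ Λ, x ∉ V₁ → l ≤ ‖x‖)
    (h₂ : ∀ x ∈ Λ, x ∉ V₂ → m ≤ ‖x‖) :
    l ^ finrank ℝ V₁ᗮ * (m / l) ^ finrank ℝ V₂ᗮ * volume.real (Metric.ball (0 : E) 1) ≤
      2 ^ finrank ℝ E * ZLattice.covolume Λ := by
  have hl0 : 0 < l := by linarith
  have hml : 1 ≤ m / l := (one_le_div hl0).mpr hlm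
  set f : E →ₗ[ℝ] E := squeeze V₁ l ∘ₗ squeeze V₂ (m / l) with hf
  have hdet : LinearMap.det f = (l ^ finrank ℝ V₁ᗮ * (m / l) ^ finrank ℝ V₂ᗮ)⁻¹ := by
    rw [hf, LinearMap.det_comp, det_squeeze, det_squeeze, inv_pow, inv_pow, mul_inv]
  have hpos : 0 < l ^ finrank ℝ V₁ᗮ * (m / l) ^ finrank ℝ V₂ᗮ := by positivity
  set S : Set E := f ⁻¹' Metric.ball 0 1 with hS
  have hvol : volume S = ENNReal.ofReal (l ^ finrank ℝ V₁ᗮ * (m / l) ^ finrank ℝ V₂ᗮ) *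
      volume (Metric.ball (0 : E) 1) := by
    rw [hS, Measure.addHaar_preimage_linearMap _ (by rw [hdet]; positivity), hdet, inv_inv,
      abs_of_pos hpos]
  have hS0 : ∀ x ∈ Λ, x ≠ 0 → x ∉ S := by
    intro x hx hx0 hxS
    rw [hS, Set.mem_preimage, mem_ball_zero_iff] at hxS
    by_cases hx1 : x ∈ V₁
    · have : f x = x := by
        rw [hf, LinearMap.comp_apply, squeeze_of_mem _ _ (hV hx1), squeeze_of_mem _ _ hx1]
      rw [this] at hxS
      exact absurd (h₀ x hx hx0) (not_le.mpr hxS)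
    by_cases hx2 : x ∈ V₂
    · have h3 := norm_le_norm_squeeze V₁ hl x
      have : f x = squeeze V₁ l x := by
        rw [hf, LinearMap.comp_apply, squeeze_of_mem _ _ hx2]
      rw [← this] at h3
      have := h₁ x hx hx1
      nlinarith
    · have h3 := norm_le_norm_squeeze V₁ hl (squeeze V₂ (m / l) x)
      have h4 := norm_le_norm_squeeze V₂ hml x
      have h5 := h₂ x hx hx2
      have h6 : ‖x‖ ≤ m * ‖f x‖ := by
        calc ‖x‖ ≤ (m / l) * ‖squeeze V₂ (m / l) x‖ := h4
          _ ≤ (m / l) * (l * ‖f x‖) := by gcongr; exact h3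
          _ = m * ‖f x‖ := by field_simp
      nlinarith
  by_contra! hlt
  let b := Module.Free.chooseBasis ℤ Λ
  have hfund := ZLattice.isAddFundamentalDomain b volume
  have hcov := ZLattice.covolume_eq_measure_fundamentalDomain Λ volume hfund
  set D := ZSpan.fundamentalDomain (b.ofZLatticeBasis ℝ) with hD
  have hDtop : volume D ≠ ⊤ := by
    have : Bornology.IsBounded D := ZSpan.fundamentalDomain_isBounded _
    exact this.measure_lt_top.ne
  have hlt' : volume D * 2 ^ finrank ℝ E < volume S := by
    rw [hvol, ← ENNReal.ofReal_toReal hDtop, ← ENNReal.ofReal_toReal (measure_ball_lt_top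
      (μ := volume) (x := (0 : E)) (r := 1)).ne, ← ENNReal.ofReal_mul hpos.le,
      show (2 : ENNReal) = ENNReal.ofReal 2 by simp, ← ENNReal.ofReal_pow (by norm_num),
      ← ENNReal.ofReal_mul ENNReal.toReal_nonneg]
    refine (ENNReal.ofReal_lt_ofReal_iff_of_nonneg (by positivity)).mpr ?_
    rw [hcov] at hlt
    rw [mul_comm]
    exact hlt
  have : Countable Λ.toAddSubgroup := inferInstanceAs (Countable Λ)
  have : DiscreteTopology Λ.toAddSubgroup := inferInstanceAs (DiscreteTopology Λ)
  obtain ⟨x, hx0, hxS⟩ := exists_ne_zero_mem_lattice_of_measure_mul_two_pow_lt_measure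
    (L := Λ.toAddSubgroup) (s := S) hfund (fun x hx => by
      simp only [hS, Set.mem_preimage, map_neg, mem_ball_zero_iff, norm_neg] at hx ⊢; exact hx)
    ((convex_ball (0 : E) 1).linear_preimage f) hlt'
  exact hS0 x.1 x.2 (by simpa using hx0) hxS

end squeeze

section flag
open NumberField Module MeasureTheory

variable (L : Type*) [Field L] [NumberField L]

lemma house_le_norm_toMixed_symm (a : L) :
    house a ≤ ‖(mixedEmbedding.euclidean.toMixed L).symm (mixedEmbedding L a)‖ := by
  set x := (mixedEmbedding.euclidean.toMixed L).symm (mixedEmbedding L a) with hx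
  have hx' : mixedEmbedding.euclidean.toMixed L x = mixedEmbedding L a := by simp [hx]
  rw [house, pi_norm_le_iff_of_nonneg (norm_nonneg _)]
  intro φ
  have h1 : ‖canonicalEmbedding L a φ‖ = InfinitePlace.mk φ a := rfl
  rw [h1]
  by_cases hw : (InfinitePlace.mk φ).IsReal
  · have : ‖x.fst ⟨_, hw⟩‖ = InfinitePlace.mk φ a := by
      have h2 : x.fst ⟨_, hw⟩ = (mixedEmbedding L a).1 ⟨_, hw⟩ := by rw [← hx']; rfl
      rw [h2, mixedEmbedding.mixedEmbedding_apply_isReal, InfinitePlace.norm_embedding_of_isReal]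
    rw [← this]
    exact (PiLp.norm_apply_le _ _).trans (WithLp.norm_fst_le _ x)
  · rw [InfinitePlace.not_isReal_iff_isComplex] at hw
    have : ‖x.snd ⟨_, hw⟩‖ = InfinitePlace.mk φ a := by
      have h2 : x.snd ⟨_, hw⟩ = (mixedEmbedding L a).2 ⟨_, hw⟩ := by rw [← hx']; rfl
      rw [h2, mixedEmbedding.mixedEmbedding_apply_isComplex, InfinitePlace.norm_embedding_eq]
    rw [← this]
    exact (PiLp.norm_apply_le _ _).trans (WithLp.norm_snd_le _ x)

/-- The canonical map from a number field to its Euclidean mixed space. -/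
def toEuclid : L →ₗ[ℚ] mixedEmbedding.euclidean.mixedSpace L where
  toFun a := (mixedEmbedding.euclidean.toMixed L).symm (mixedEmbedding L a)
  map_add' a b := by simp
  map_smul' c a := by
    have : mixedEmbedding L (c • a) = (c : ℝ) • mixedEmbedding L a := by
      rw [Algebra.smul_def, map_mul]
      ext w
      · simp [mixedEmbedding]
      · simp [mixedEmbedding]
    rw [this, map_smul]
    simp [Rat.cast_smul_eq_qsmul]

lemma finrank_span_toEuclid_le (U : Submodule ℚ L) :
    finrank ℝ (Submodule.span ℝ (toEuclid L '' U)) ≤ finrank ℚ U := by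
  let b := Module.finBasis ℚ U
  have : Submodule.span ℝ (toEuclid L '' U) ≤
      Submodule.span ℝ (Set.range fun i => toEuclid L (b i)) := by
    rw [Submodule.span_le]
    rintro _ ⟨x, hx, rfl⟩
    have h := b.sum_repr ⟨x, hx⟩
    have h' : x = ∑ i, b.repr ⟨x, hx⟩ i • (b i : L) := by
      have h₁ := (congrArg U.subtype h).symm
      rw [map_sum] at h₁
      exact h₁
    rw [h', map_sum]
    refine Submodule.sum_mem _ fun i _ => ?_
    rw [map_smul, ← Rat.cast_smul_eq_qsmul ℝ]
    exact Submodule.smul_mem _ _ (Submodule.subset_span ⟨i, rfl⟩)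
  refine (Submodule.finrank_mono this).trans ((finrank_range_le_card _).trans ?_)
  simp

lemma mem_euclidean_integerLattice {x : mixedEmbedding.euclidean.mixedSpace L}
    (hx : x ∈ mixedEmbedding.euclidean.integerLattice L) :
    ∃ a : 𝓞 L, toEuclid L a = x := by
  have : mixedEmbedding.euclidean.toMixed L x ∈ mixedEmbedding.integerLattice L := hx
  obtain ⟨a, ha⟩ := this
  refine ⟨a, ?_⟩
  change (mixedEmbedding.euclidean.toMixed L).symm (mixedEmbedding L a) = x
  rw [ContinuousLinearEquiv.symm_apply_eq, ← ha]
  rfl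

lemma covolume_euclidean_integerLattice_le :
    ZLattice.covolume (mixedEmbedding.euclidean.integerLattice L) ≤ √|(discr L : ℝ)| := by
  have h := ZLattice.covolume_comap (mixedEmbedding.integerLattice L) volume volume
    (e := mixedEmbedding.euclidean.toMixed L)
    (mixedEmbedding.euclidean.volumePreserving_toMixed L)
  have h' : ZLattice.covolume (mixedEmbedding.euclidean.integerLattice L) =
    ZLattice.covolume (mixedEmbedding.integerLattice L) := h
  rw [h', mixedEmbedding.covolume_integerLattice]
  have : ((2 : ℝ)⁻¹) ^ InfinitePlace.nrComplexPlaces L ≤ 1 :=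
    pow_le_one₀ (by norm_num) (by norm_num)
  exact mul_le_of_le_one_left (Real.sqrt_nonneg _) this

/-- The constant of `flag_bound`. -/
def flagConst (N : ℕ) : ℝ :=
  2 ^ N / volume.real (Metric.ball (0 : EuclideanSpace ℝ (Fin N)) 1)

/-- If the integers of `L` outside `U ≤ W` have large house, then `L` has large discriminant. -/
theorem flag_bound (U W : Submodule ℚ L) (hUW : U ≤ W) {u w : ℕ} (hu : finrank ℚ U ≤ u)
    (hw : finrank ℚ W ≤ w) {l m : ℝ} (hl : 1 ≤ l) (hlm : l ≤ m)
    (h₁ : ∀ x : 𝓞 L, (x : L) ∉ U → l ≤ house (x : L))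
    (h₂ : ∀ x : 𝓞 L, (x : L) ∉ W → m ≤ house (x : L)) :
    l ^ (finrank ℚ L - u) * (m / l) ^ (finrank ℚ L - w) ≤
      flagConst (finrank ℚ L) * √|(discr L : ℝ)| := by
  set E := mixedEmbedding.euclidean.mixedSpace L
  set V₁ : Submodule ℝ E := Submodule.span ℝ (toEuclid L '' U)
  set V₂ : Submodule ℝ E := Submodule.span ℝ (toEuclid L '' W)
  have hV : V₁ ≤ V₂ := Submodule.span_mono (Set.image_mono hUW)
  have hnorm : ∀ a : 𝓞 L, house (a : L) ≤ ‖toEuclid L a‖ := fun a =>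
    house_le_norm_toMixed_symm L a
  have key := mul_volume_ball_le_covolume (mixedEmbedding.euclidean.integerLattice L) V₁ V₂ hV
    hl hlm
    (by
      intro x hx hx0
      obtain ⟨a, rfl⟩ := mem_euclidean_integerLattice L hx
      refine le_trans (one_le_house_of_isIntegral a.2 ?_) (hnorm a)
      rintro h
      exact hx0 (by rw [show ((a : L)) = 0 from h, map_zero]))
    (by
      intro x hx hx0
      obtain ⟨a, rfl⟩ := mem_euclidean_integerLattice L hx
      exact (h₁ a fun h => hx0 (Submodule.subset_span ⟨_, h, rfl⟩)).trans (hnorm a))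
    (by
      intro x hx hx0
      obtain ⟨a, rfl⟩ := mem_euclidean_integerLattice L hx
      exact (h₂ a fun h => hx0 (Submodule.subset_span ⟨_, h, rfl⟩)).trans (hnorm a))
  have hE : finrank ℝ E = finrank ℚ L := mixedEmbedding.euclidean.finrank L
  have hball : volume.real (Metric.ball (0 : E) 1) =
      volume.real (Metric.ball (0 : EuclideanSpace ℝ (Fin (finrank ℚ L))) 1) := by
    have hpos : 0 < finrank ℚ L := finrank_pos
    have : Nontrivial (EuclideanSpace ℝ (Fin (finrank ℚ L))) :=
      nontrivial_of_finrank_pos (R := ℝ) (by simpa using hpos)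
    rw [measureReal_def, measureReal_def, InnerProductSpace.volume_ball,
      InnerProductSpace.volume_ball, hE]
    simp
  have hbpos : 0 < volume.real (Metric.ball (0 : EuclideanSpace ℝ (Fin (finrank ℚ L))) 1) :=
    ENNReal.toReal_pos (Metric.measure_ball_pos _ _ one_pos).ne' measure_ball_lt_top.ne
  have e₁ : finrank ℚ L - u ≤ finrank ℝ V₁ᗮ := by
    have h := V₁.finrank_add_finrank_orthogonal
    have h' : finrank ℝ V₁ ≤ finrank ℚ U := finrank_span_toEuclid_le L U
    omega
  have e₂ : finrank ℚ L - w ≤ finrank ℝ V₂ᗮ := by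
    have h := V₂.finrank_add_finrank_orthogonal
    have h' : finrank ℝ V₂ ≤ finrank ℚ W := finrank_span_toEuclid_le L W
    omega
  rw [hball, hE] at key
  have hml : 1 ≤ m / l := (one_le_div (by linarith)).mpr hlm
  rw [flagConst, div_mul_eq_mul_div, le_div_iff₀ hbpos]
  calc _ ≤ l ^ finrank ℝ V₁ᗮ * (m / l) ^ finrank ℝ V₂ᗮ *
        volume.real (Metric.ball (0 : EuclideanSpace ℝ (Fin (finrank ℚ L))) 1) := by gcongr
    _ ≤ _ := key
    _ ≤ _ := by gcongr; exact covolume_euclidean_integerLattice_le L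

lemma flagConst_pos (N : ℕ) : 0 < flagConst N := by
  have : 0 < volume.real (Metric.ball (0 : EuclideanSpace ℝ (Fin N)) 1) :=
    ENNReal.toReal_pos (Metric.measure_ball_pos _ _ one_pos).ne' measure_ball_lt_top.ne
  unfold flagConst
  positivity

end flag

section cramer
open NumberField Module

lemma norm_det_le_of_forall_norm_le {ι : Type*} [Fintype ι] (M : Matrix ι ι ℂ) (h : ι → ℝ)
    (hM : ∀ i j, ‖M i j‖ ≤ h i) : ‖M.det‖ ≤ (Fintype.card ι).factorial * ∏ i, h i := by
  rw [← Matrix.det_transpose, Matrix.det_apply]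
  refine (norm_sum_le _ _).trans ((Finset.sum_le_card_nsmul _ _ (∏ i, h i) ?_).trans_eq ?_)
  · intro σ _
    have : ‖Equiv.Perm.sign σ • ∏ i, M.transpose (σ i) i‖ = ‖∏ i, M.transpose (σ i) i‖ := by
      rcases Int.units_eq_one_or (Equiv.Perm.sign σ) with h | h <;> simp [h]
    rw [this, norm_prod]
    exact Finset.prod_le_prod (fun _ _ => norm_nonneg _) fun i _ => hM _ _
  · rw [Finset.card_univ, Fintype.card_perm, nsmul_eq_mul]

variable (L : Type*) [Field L] [NumberField L]

/-- The determinant of a family of integers, compared with the product of their houses. -/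
lemma abs_det_toMatrix_mul_sqrt_discr_le (w : Free.ChooseBasisIndex ℤ (𝓞 L) → 𝓞 L) :
    |(((RingOfIntegers.basis L).toMatrix w).det : ℝ)| * √|(discr L : ℝ)| ≤
      (finrank ℚ L).factorial * ∏ i, house (w i : L) := by
  set P := (RingOfIntegers.basis L).toMatrix w
  have hcard : Fintype.card (Free.ChooseBasisIndex ℤ (𝓞 L)) = finrank ℚ L := by
    rw [← finrank_eq_card_chooseBasisIndex, RingOfIntegers.rank]
  have e : Free.ChooseBasisIndex ℤ (𝓞 L) ≃ (L →ₐ[ℚ] ℂ) :=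
    Fintype.equivOfCardEq (by rw [hcard, AlgHom.card])
  have h₁ := Algebra.discr_of_matrix_vecMul (A := ℚ) (integralBasis L)
    (P.map (Int.castRingHom ℚ))
  have h₂ : Matrix.vecMul (integralBasis L)
      ((P.map (Int.castRingHom ℚ)).map (algebraMap ℚ L)) = fun i => (w i : L) := by
    ext i
    have := congrArg (algebraMap (𝓞 L) L) ((RingOfIntegers.basis L).sum_repr (w i))
    rw [map_sum] at this
    change _ = algebraMap (𝓞 L) L (w i)
    rw [← this]
    simp only [Matrix.vecMul, dotProduct, Matrix.map_apply, integralBasis_apply]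
    refine Finset.sum_congr rfl fun j _ => ?_
    simp only [P, Basis.toMatrix_apply, zsmul_eq_mul, map_mul, map_intCast]
    simp [mul_comm]
  rw [h₂, ← coe_discr] at h₁
  have h₃ := Algebra.discr_eq_det_embeddingsMatrixReindex_pow_two ℚ ℂ (fun i => (w i : L)) e
  rw [h₁] at h₃
  have h₄ : (P.map (Int.castRingHom ℚ)).det = (P.det : ℚ) := by
    simpa using ((Int.castRingHom ℚ).map_det P).symm
  rw [h₄] at h₃
  have h₅ : (|(P.det : ℝ)| * √|(discr L : ℝ)|) ^ 2 =
      ‖(Algebra.embeddingsMatrixReindex ℚ ℂ (fun i => (w i : L)) e).det‖ ^ 2 := by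
    rw [← norm_pow, ← h₃, mul_pow, Real.sq_sqrt (abs_nonneg _)]
    simp
  have h₆ := norm_det_le_of_forall_norm_le
    (Algebra.embeddingsMatrixReindex ℚ ℂ (fun i => (w i : L)) e) (fun i => house (w i : L))
    (fun i j => norm_embedding_le_house (w i : L) (e j).toRingHom)
  rw [hcard] at h₆
  exact (abs_le_of_sq_le_sq' (h₅.trans_le (pow_le_pow_left₀ (norm_nonneg _) h₆ 2))
    (mul_nonneg (by positivity) (Finset.prod_nonneg fun _ _ => house_nonneg _))).2

/-- Cramer's rule for a family of independent integers. -/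
lemma exists_zsmul_eq_sum (w : Free.ChooseBasisIndex ℤ (𝓞 L) → 𝓞 L)
    (ξ : 𝓞 L) : ∃ z : Free.ChooseBasisIndex ℤ (𝓞 L) → ℤ,
      ((RingOfIntegers.basis L).toMatrix w).det • ξ = ∑ i, z i • w i ∧
      ∀ i, |(z i : ℝ)| * √|(discr L : ℝ)| ≤
        (finrank ℚ L).factorial * ∏ j, house (Function.update w i ξ j : L) := by
  set P := (RingOfIntegers.basis L).toMatrix w with hP
  set v := (RingOfIntegers.basis L).repr ξ with hv
  refine ⟨P.cramer v, ?_, fun i => ?_⟩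
  · apply (RingOfIntegers.basis L).repr.injective
    ext i
    have := congrFun (Matrix.mulVec_cramer P v) i
    simp only [map_smul, map_sum, Finsupp.smul_apply, Finsupp.finsetSum_apply]
    rw [← hv]
    simp only [Pi.smul_apply, Matrix.mulVec, dotProduct] at this
    rw [← this]
    refine Finset.sum_congr rfl fun j _ => ?_
    rw [hP, Basis.toMatrix_apply, smul_eq_mul, mul_comm]
  · rw [Matrix.cramer_apply, ← Basis.toMatrix_update]
    exact abs_det_toMatrix_mul_sqrt_discr_le L _

variable {L}

lemma det_toMatrix_ne_zero {w : Free.ChooseBasisIndex ℤ (𝓞 L) → 𝓞 L}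
    (hw : LinearIndependent ℤ w) : ((RingOfIntegers.basis L).toMatrix w).det ≠ 0 := by
  intro h
  obtain ⟨v, hv, hv'⟩ := Matrix.exists_mulVec_eq_zero_iff.mpr h
  apply hv
  ext i
  refine Fintype.linearIndependent_iff.mp hw v ?_ i
  apply (RingOfIntegers.basis L).repr.injective
  ext i
  have := congrFun hv' i
  simp only [map_smul, map_sum, Finsupp.smul_apply, Finsupp.finsetSum_apply]
  simp only [Matrix.mulVec, dotProduct] at this
  rw [map_zero, Finsupp.zero_apply]
  refine Eq.trans ?_ this
  refine Finset.sum_congr rfl fun j _ => ?_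
  rw [Basis.toMatrix_apply, smul_eq_mul, mul_comm]

lemma house_le_of_forall_norm_le {x : L} {B : ℝ} (hB : 0 ≤ B) (h : ∀ φ : L →+* ℂ, ‖φ x‖ ≤ B) :
    house x ≤ B := by
  rw [house, pi_norm_le_iff_of_nonneg hB]
  exact h

/-- Bound for the houses of the elements of a fixed integral basis. -/
def basisHouse (k : Type*) [Field k] [NumberField k] : ℝ :=
  1 + ∑ i, house (RingOfIntegers.basis k i : k)

lemma one_le_basisHouse (k : Type*) [Field k] [NumberField k] : 1 ≤ basisHouse k :=
  le_add_of_nonneg_right (Finset.sum_nonneg fun _ _ => house_nonneg _)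

lemma house_basis_le (k : Type*) [Field k] [NumberField k] (i) :
    house (RingOfIntegers.basis k i : k) ≤ basisHouse k := by
  have := Finset.single_le_sum (f := fun i => house (RingOfIntegers.basis k i : k))
    (fun _ _ => house_nonneg _) (Finset.mem_univ i)
  unfold basisHouse
  linarith

lemma house_algebraMap_le {k : Type*} [Field k] [NumberField k] [Algebra k L] (x : k) :
    house (algebraMap k L x) ≤ house x :=
  house_le_of_forall_norm_le (house_nonneg _) fun φ =>
    norm_embedding_le_house x (φ.comp (algebraMap k L))

/-- The constant of `exists_coordinates`. -/
def coordConst (k : Type*) [Field k] [NumberField k] (d : ℕ) (C₁ : ℝ) : ℝ :=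
  (finrank ℚ k * d).factorial * basisHouse k ^ (finrank ℚ k * d) * C₁

/-- Coordinates of integers with respect to a family of short independent integers are small
and have bounded denominators. -/
theorem exists_coordinates {k : Type*} [Field k] [NumberField k] [Algebra k L] {d : ℕ}
    (hd : finrank k L = d) {C₁ : ℝ} (γ : Fin d → 𝓞 L)
    (hγ : LinearIndependent k fun j => (γ j : L)) (l : Fin d → ℝ) (hl : ∀ j, 1 ≤ l j)
    (hγl : ∀ j, house (γ j : L) ≤ l j)
    (hprod : ∏ j, l j ^ finrank ℚ k ≤ C₁ * √|(discr L : ℝ)|) (ξ : 𝓞 L) :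
    ∃ x : Fin d → k, (ξ : L) = ∑ j, algebraMap k L (x j) * γ j ∧
      ∀ j, (∃ y : 𝓞 k, (y : k) = (⌊coordConst k d C₁⌋₊.factorial : k) * x j) ∧
        house (x j) ≤ finrank ℚ k * coordConst k d C₁ * basisHouse k * house (ξ : L) / l j := by
  have : IsScalarTower ℚ k L := IsScalarTower.of_algebraMap_eq' (Subsingleton.elim _ _)
  set A := coordConst k d C₁ with hA
  have hDpos : 0 < √|(discr L : ℝ)| := by
    have := discr_ne_zero L
    positivity
  have hcardI : Fintype.card (Free.ChooseBasisIndex ℤ (𝓞 k)) = finrank ℚ k := by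
    rw [← finrank_eq_card_chooseBasisIndex, RingOfIntegers.rank]
  have hN : finrank ℚ L = finrank ℚ k * d := by rw [← hd, finrank_mul_finrank]
  have e : Free.ChooseBasisIndex ℤ (𝓞 L) ≃ Free.ChooseBasisIndex ℤ (𝓞 k) × Fin d :=
    Fintype.equivOfCardEq (by
      rw [Fintype.card_prod, hcardI, Fintype.card_fin, ← finrank_eq_card_chooseBasisIndex,
        RingOfIntegers.rank, hN])
  set ω := RingOfIntegers.basis k
  let w : Free.ChooseBasisIndex ℤ (𝓞 L) → 𝓞 L :=
    fun i => algebraMap (𝓞 k) (𝓞 L) (ω (e i).1) * γ (e i).2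
  have hwL : ∀ i, (w i : L) = algebraMap k L (ω (e i).1 : k) * (γ (e i).2 : L) := fun i => by
    simp only [w, map_mul]
    rfl
  have hwli : LinearIndependent ℤ w := by
    have h₁ := linearIndependent_smul (integralBasis k).linearIndependent hγ
    have h₂ := (h₁.comp e e.injective).restrict_scalars (R := ℤ) (by
      intro a b h
      simpa using h)
    refine LinearIndependent.of_comp (algebraMap (𝓞 L) L).toAddMonoidHom.toIntLinearMap ?_
    have h₃ : (algebraMap (𝓞 L) L).toAddMonoidHom.toIntLinearMap ∘ w =
        (fun p => integralBasis k p.1 • (γ p.2 : L)) ∘ e := by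
      ext i
      simp only [Function.comp_apply, integralBasis_apply, Algebra.smul_def]
      exact hwL i
    rw [h₃]
    exact h₂
  have hB := one_le_basisHouse k
  have hwh : ∀ i, house (w i : L) ≤ basisHouse k * l (e i).2 := fun i => by
    rw [hwL]
    refine (house_mul_le _ _).trans (mul_le_mul ((house_algebraMap_le _).trans
      (house_basis_le k _)) (hγl _) (house_nonneg _) (by linarith))
  have hBl : ∀ j, 1 ≤ basisHouse k * l j := fun j => one_le_mul_of_one_le_of_one_le hB (hl j)
  have hprodle : ∏ i, (basisHouse k * l (e i).2) ≤
      basisHouse k ^ (finrank ℚ k * d) * (C₁ * √|(discr L : ℝ)|) := by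
    rw [e.prod_comp (fun p => basisHouse k * l p.2), Finset.prod_mul_distrib, Finset.prod_const,
      Finset.card_univ, Fintype.card_prod, hcardI, Fintype.card_fin, Fintype.prod_prod_type,
      Finset.prod_comm]
    refine mul_le_mul_of_nonneg_left ?_ (by positivity)
    simpa [Finset.prod_const, hcardI] using hprod
  obtain ⟨z, hz, hzle⟩ := exists_zsmul_eq_sum L w ξ
  set q := ((RingOfIntegers.basis L).toMatrix w).det with hq
  have hq0 : q ≠ 0 := det_toMatrix_ne_zero hwli
  have hqA : |(q : ℝ)| ≤ A := by
    have h₁ := abs_det_toMatrix_mul_sqrt_discr_le L w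
    refine le_of_mul_le_mul_right (h₁.trans ?_) hDpos
    rw [hN, hA, coordConst]
    calc _ ≤ ((finrank ℚ k * d).factorial : ℝ) * ∏ i, (basisHouse k * l (e i).2) := by
          gcongr with i
          · exact fun i _ => house_nonneg _
          · exact hwh i
      _ ≤ ((finrank ℚ k * d).factorial : ℝ) *
          (basisHouse k ^ (finrank ℚ k * d) * (C₁ * √|(discr L : ℝ)|)) := by gcongr
      _ = _ := by ring
  have hzA : ∀ i, |(z i : ℝ)| ≤ A * house (ξ : L) / l (e i).2 := by
    intro i
    have hli : 0 < l (e i).2 := lt_of_lt_of_le one_pos (hl _)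
    rw [le_div_iff₀ hli]
    refine le_of_mul_le_mul_right ?_ hDpos
    have h₁ : ∏ j, house (Function.update w i ξ j : L) ≤
        house (ξ : L) * ∏ j ∈ Finset.univ.erase i, (basisHouse k * l (e j).2) := by
      rw [← Finset.mul_prod_erase _ _ (Finset.mem_univ i), Function.update_self]
      refine mul_le_mul_of_nonneg_left (Finset.prod_le_prod (fun _ _ => house_nonneg _) ?_)
        (house_nonneg _)
      intro j hj
      rw [Function.update_of_ne (Finset.ne_of_mem_erase hj)]
      exact hwh j
    have h₂ : (∏ j ∈ Finset.univ.erase i, (basisHouse k * l (e j).2)) * l (e i).2 ≤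
        basisHouse k ^ (finrank ℚ k * d) * (C₁ * √|(discr L : ℝ)|) := by
      refine le_trans ?_ hprodle
      rw [← Finset.prod_erase_mul _ _ (Finset.mem_univ i)]
      refine mul_le_mul_of_nonneg_left (le_mul_of_one_le_left hli.le hB)
        (Finset.prod_nonneg fun j _ => by linarith [hBl (e j).2])
    have h₃ := hzle i
    rw [hN] at h₃
    calc |(z i : ℝ)| * l (e i).2 * √|(discr L : ℝ)|
        = (|(z i : ℝ)| * √|(discr L : ℝ)|) * l (e i).2 := by ring
      _ ≤ (((finrank ℚ k * d).factorial : ℝ) * (house (ξ : L) *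
          ∏ j ∈ Finset.univ.erase i, (basisHouse k * l (e j).2))) * l (e i).2 := by
        exact mul_le_mul_of_nonneg_right (h₃.trans (by gcongr)) hli.le
      _ = ((finrank ℚ k * d).factorial : ℝ) * house (ξ : L) *
          ((∏ j ∈ Finset.univ.erase i, (basisHouse k * l (e j).2)) * l (e i).2) := by ring
      _ ≤ ((finrank ℚ k * d).factorial : ℝ) * house (ξ : L) *
          (basisHouse k ^ (finrank ℚ k * d) * (C₁ * √|(discr L : ℝ)|)) := by
        have := house_nonneg (ξ : L)
        gcongr
      _ = _ := by rw [hA, coordConst]; ring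
  have hA0 : 0 ≤ A := (abs_nonneg _).trans hqA
  have hqk : (q : k) ≠ 0 := by exact_mod_cast hq0
  refine ⟨fun j => ∑ i, (z (e.symm (i, j)) : k) / q * (ω i : k), ?_, fun j => ⟨?_, ?_⟩⟩
  · have h₁ := congrArg (algebraMap (𝓞 L) L) hz
    rw [map_sum, zsmul_eq_mul, map_mul, map_intCast] at h₁
    have hqL : (q : L) ≠ 0 := by exact_mod_cast hq0
    apply mul_left_cancel₀ hqL
    refine h₁.trans ?_
    rw [← e.symm.sum_comp, Fintype.sum_prod_type, Finset.sum_comm, Finset.mul_sum]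
    refine Finset.sum_congr rfl fun j _ => ?_
    rw [map_sum, Finset.sum_mul, Finset.mul_sum]
    refine Finset.sum_congr rfl fun i _ => ?_
    rw [zsmul_eq_mul, map_mul, map_intCast]
    change _ * (w (e.symm (i, j)) : L) = _
    rw [hwL, map_mul, map_div₀, map_intCast, map_intCast, Equiv.apply_symm_apply]
    field_simp
  · have hdvd : q ∣ (⌊A⌋₊.factorial : ℤ) := by
      rw [← Int.natAbs_dvd, Int.natCast_dvd_natCast]
      refine Nat.dvd_factorial (Int.natAbs_pos.mpr hq0) (Nat.le_floor ?_)
      rw [Nat.cast_natAbs]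
      exact_mod_cast hqA
    obtain ⟨t, ht⟩ := hdvd
    refine ⟨∑ i, t • (z (e.symm (i, j)) • ω i), ?_⟩
    have ht' : ((⌊A⌋₊.factorial : ℕ) : k) = (q : k) * t := by
      exact_mod_cast congrArg (Int.cast (R := k)) ht
    change algebraMap (𝓞 k) k _ = _
    rw [ht', map_sum, Finset.mul_sum]
    refine Finset.sum_congr rfl fun i _ => ?_
    simp only [zsmul_eq_mul, map_mul, map_intCast]
    field_simp
  · have hlj : 0 < l j := lt_of_lt_of_le one_pos (hl _)
    have hh := house_nonneg (ξ : L)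
    refine house_le_of_forall_norm_le (by positivity) fun φ => ?_
    rw [map_sum]
    refine (norm_sum_le _ _).trans ((Finset.sum_le_card_nsmul _ _
      (A * house (ξ : L) / l j * basisHouse k) fun i _ => ?_).trans_eq ?_)
    · rw [map_mul, map_div₀, map_intCast, map_intCast, norm_mul, norm_div, Complex.norm_intCast,
        Complex.norm_intCast]
      have hq1 : (1 : ℝ) ≤ |(q : ℝ)| := by exact_mod_cast Int.one_le_abs hq0
      have h₁ := hzA (e.symm (i, j))
      rw [Equiv.apply_symm_apply] at h₁
      refine mul_le_mul ((div_le_self (abs_nonneg _) hq1).trans h₁)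
        ((norm_embedding_le_house _ φ).trans (house_basis_le k i)) (norm_nonneg _) (by positivity)
    · rw [Finset.card_univ, hcardI, nsmul_eq_mul]
      ring

end cramer

section integers
open NumberField Module

variable (k : Type*) [Field k] [NumberField k]

lemma card_chooseBasisIndex :
    Fintype.card (Free.ChooseBasisIndex ℤ (𝓞 k)) = finrank ℚ k := by
  rw [← finrank_eq_card_chooseBasisIndex, RingOfIntegers.rank]

/-- The coordinates of an integer are bounded by this multiple of its house. -/
def reprConst : ℝ := (finrank ℚ k).factorial * basisHouse k ^ finrank ℚ k

lemma one_le_reprConst : 1 ≤ reprConst k :=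
  one_le_mul_of_one_le_of_one_le (by exact_mod_cast Nat.factorial_pos _)
    (one_le_pow₀ (one_le_basisHouse k))

lemma abs_repr_le (x : 𝓞 k) (i) :
    |((RingOfIntegers.basis k).repr x i : ℝ)| ≤ reprConst k * house (x : k) := by
  obtain ⟨z, hz, hzle⟩ := exists_zsmul_eq_sum k (RingOfIntegers.basis k) x
  have h₁ : z = (RingOfIntegers.basis k).repr x := by
    rw [Basis.toMatrix_self, Matrix.det_one, one_smul] at hz
    rw [hz, Basis.repr_sum_self]
  rw [← h₁]
  have hD : 1 ≤ √|(discr k : ℝ)| := by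
    rw [Real.one_le_sqrt]
    exact_mod_cast Int.one_le_abs (discr_ne_zero k)
  have h₂ : ∏ j, house (Function.update (RingOfIntegers.basis k) i x j : k) ≤
      basisHouse k ^ finrank ℚ k * house (x : k) := by
    rw [← Finset.mul_prod_erase _ _ (Finset.mem_univ i), Function.update_self, mul_comm]
    refine mul_le_mul_of_nonneg_right ?_ (house_nonneg _)
    calc _ ≤ ∏ j ∈ Finset.univ.erase i, basisHouse k := by
          refine Finset.prod_le_prod (fun _ _ => house_nonneg _) fun j hj => ?_
          rw [Function.update_of_ne (Finset.ne_of_mem_erase hj)]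
          exact house_basis_le k j
      _ ≤ _ := by
          rw [Finset.prod_const]
          refine pow_le_pow_right₀ (one_le_basisHouse k) ?_
          rw [← card_chooseBasisIndex]
          exact Finset.card_le_univ _
  calc |(z i : ℝ)| ≤ |(z i : ℝ)| * √|(discr k : ℝ)| := le_mul_of_one_le_right (abs_nonneg _) hD
    _ ≤ _ := hzle i
    _ ≤ (finrank ℚ k).factorial * (basisHouse k ^ finrank ℚ k * house (x : k)) := by gcongr
    _ = _ := by rw [reprConst]; ring

/-- The constant of `card_le_of_house_le`. -/
def countConst : ℝ := (3 * reprConst k) ^ finrank ℚ k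

lemma one_le_countConst : 1 ≤ countConst k :=
  one_le_pow₀ (by linarith [one_le_reprConst k])

/-- The number of integers of bounded house. -/
lemma card_le_of_house_le {B : ℝ} (hB : 1 ≤ B) (T : Finset (𝓞 k))
    (hT : ∀ x ∈ T, house (x : k) ≤ B) :
    (T.card : ℝ) ≤ countConst k * B ^ finrank ℚ k := by
  set A := reprConst k with hA
  have hA1 : 1 ≤ A := one_le_reprConst k
  set M : ℤ := ⌊A * B⌋
  have hM0 : 0 ≤ M := Int.floor_nonneg.mpr (by positivity)
  have hle : T.card ≤ (Fintype.piFinset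
      fun _ : Free.ChooseBasisIndex ℤ (𝓞 k) => Finset.Icc (-M) M).card := by
    refine Finset.card_le_card_of_injOn (fun x => (RingOfIntegers.basis k).repr x) ?_ ?_
    · intro x hx
      rw [Finset.mem_coe, Fintype.mem_piFinset]
      intro i
      have h₁ : |((RingOfIntegers.basis k).repr x i : ℝ)| ≤ A * B :=
        (abs_repr_le k x i).trans (by gcongr; exact hT x hx)
      rw [Finset.mem_Icc, ← abs_le, Int.le_floor]
      exact_mod_cast h₁
    · intro x _ y _ h
      exact (RingOfIntegers.basis k).repr.injective (DFunLike.coe_injective h)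
  rw [Fintype.card_piFinset, Finset.prod_const, Finset.card_univ, card_chooseBasisIndex,
    Int.card_Icc] at hle
  have h₂ : (((M + 1 - -M).toNat : ℕ) : ℝ) ≤ 3 * A * B := by
    have h₃ : (((M + 1 - -M).toNat : ℤ)) = 2 * M + 1 := by
      rw [Int.toNat_of_nonneg (by omega)]; ring
    have h₄ : (((M + 1 - -M).toNat : ℕ) : ℝ) = 2 * M + 1 := by exact_mod_cast h₃
    have h₅ : (M : ℝ) ≤ A * B := Int.floor_le _
    have h₆ : 1 ≤ A * B := one_le_mul_of_one_le_of_one_le hA1 hB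
    linarith
  calc (T.card : ℝ) ≤ (((M + 1 - -M).toNat : ℕ) : ℝ) ^ finrank ℚ k := by exact_mod_cast hle
    _ ≤ (3 * A * B) ^ finrank ℚ k := by gcongr
    _ = _ := by rw [countConst, mul_pow]

/-- There are many integers of bounded house. -/
lemma exists_finset_house_le {B : ℝ} (hB : 0 ≤ B) : ∃ T : Finset (𝓞 k),
    (∀ x ∈ T, house (x : k) ≤ B) ∧ (B / basisHouse k) ^ finrank ℚ k ≤ T.card := by
  set M : ℕ := ⌊B / basisHouse k⌋₊ with hM
  have hb := one_le_basisHouse k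
  let f : (Free.ChooseBasisIndex ℤ (𝓞 k) → ℕ) → 𝓞 k :=
    fun z => ∑ i, (z i : ℤ) • RingOfIntegers.basis k i
  have hf : Function.Injective f := by
    intro x y h
    ext i
    have h₁ := congrArg (fun u => (RingOfIntegers.basis k).repr u i) h
    simp only [f, Basis.repr_sum_self] at h₁
    exact_mod_cast h₁
  refine ⟨(Fintype.piFinset fun _ => Finset.range (M + 1)).image f, ?_, ?_⟩
  · intro x hx
    obtain ⟨z, hz, rfl⟩ := Finset.mem_image.mp hx
    rw [Fintype.mem_piFinset] at hz
    have h₁ : (algebraMap (𝓞 k) k (f z)) =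
        ∑ i, ((z i : ℕ) : k) * (RingOfIntegers.basis k i : k) := by
      simp [f, map_sum]
    change house (algebraMap (𝓞 k) k (f z)) ≤ B
    rw [h₁]
    refine (house_sum_le_sum_house _ _).trans ?_
    calc _ ≤ ∑ i, (M : ℝ) * house (RingOfIntegers.basis k i : k) := by
          gcongr with i
          rw [house_nat_mul]
          have := Finset.mem_range.mp (hz i)
          have h₃ : ((z i : ℕ) : ℝ) ≤ M := by exact_mod_cast Nat.lt_succ_iff.mp this
          exact mul_le_mul_of_nonneg_right h₃ (house_nonneg _)
      _ = M * ∑ i, house (RingOfIntegers.basis k i : k) := by rw [Finset.mul_sum]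
      _ ≤ (B / basisHouse k) * basisHouse k := by
          have h₃ : (M : ℝ) ≤ B / basisHouse k := Nat.floor_le (by positivity)
          refine mul_le_mul h₃ ?_ (Finset.sum_nonneg fun _ _ => house_nonneg _) (by positivity)
          unfold basisHouse
          linarith
      _ = B := by field_simp
  · rw [Finset.card_image_of_injective _ hf, Fintype.card_piFinset, Finset.prod_const,
      Finset.card_univ, card_chooseBasisIndex, Finset.card_range]
    push_cast
    have : B / basisHouse k ≤ M + 1 := (Nat.lt_floor_add_one _).le
    gcongr

variable {k}

/-- A proper subspace misses an integer of minimal house. -/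
lemma exists_min_house (W : Submodule ℚ k) (hW : W ≠ ⊤) :
    ∃ x : 𝓞 k, (x : k) ∉ W ∧ ∀ y : 𝓞 k, (y : k) ∉ W → house (x : k) ≤ house (y : k) := by
  obtain ⟨x₀, hx₀⟩ : ∃ x : 𝓞 k, (x : k) ∉ W := by
    by_contra! h
    refine hW (top_le_iff.mp ?_)
    rw [← (integralBasis k).span_eq, Submodule.span_le]
    rintro _ ⟨i, rfl⟩
    rw [integralBasis_apply]
    exact h _
  have hfin : {y : 𝓞 k | (y : k) ∉ W ∧ house (y : k) ≤ house (x₀ : k)}.Finite := by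
    refine Set.Finite.of_finite_image ((Embeddings.finite_of_norm_le k ℂ (house (x₀ : k))).subset
      ?_) (RingOfIntegers.coe_injective (K := k)).injOn
    rintro _ ⟨y, hy, rfl⟩
    exact ⟨y.2, fun φ => (norm_embedding_le_house _ φ).trans hy.2⟩
  obtain ⟨x, hx, hmin⟩ := Set.exists_min_image _ (fun y : 𝓞 k => house (y : k)) hfin
    ⟨x₀, hx₀, le_rfl⟩
  refine ⟨x, hx.1, fun y hy => ?_⟩
  by_cases h : house (y : k) ≤ house (x₀ : k)
  · exact hmin y ⟨hy, h⟩
  · exact hx.2.trans (not_le.mp h).le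

end integers

section cubic
open NumberField Module

/-- An integer of bounded degree-three type: `y` is a root of the cubic polynomial attached to
the quadruple `q`. -/
def IsCubicRoot {k L : Type*} [Field k] [NumberField k] [Field L] [Algebra k L]
    (q : Fin 4 → 𝓞 k) (y : L) : Prop :=
  y ^ 3 + algebraMap k L (q 1) * y ^ 2 + algebraMap k L (q 0) * algebraMap k L (q 2) * y
    + algebraMap k L (q 0) ^ 2 * algebraMap k L (q 3) = 0

/-- The box containing the quadruples attached to a cubic field. -/
def cubicBox (A x y : ℝ) : Fin 4 → ℝ := ![A * (x ^ 2 / y), A * x, A * y, A * (y ^ 2 / x)]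

variable (k : Type*) [Field k] [NumberField k] {L : Type*} [Field L] [NumberField L] [Algebra k L]

lemma linearIndependent_one_pair {α β : L} (hα : α ∉ Submodule.span k {(1 : L)})
    (hβ : β ∉ Submodule.span k {1, α}) : LinearIndependent k ![1, α, β] := by
  rw [Fintype.linearIndependent_iff]
  intro g hg
  simp only [Fin.sum_univ_three, Matrix.cons_val_zero, Matrix.cons_val_one, Matrix.cons_val] at hg
  have h2 : g 2 = 0 := by
    by_contra h
    apply hβ
    rw [Submodule.mem_span_pair]
    refine ⟨-(g 0 / g 2), -(g 1 / g 2), ?_⟩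
    have : (g 2)⁻¹ • (g 0 • (1 : L) + g 1 • α + g 2 • β) = 0 := by rw [hg, smul_zero]
    rw [smul_add, smul_add, smul_smul, smul_smul, smul_smul, inv_mul_cancel₀ h, one_smul] at this
    rw [neg_smul, neg_smul, div_eq_inv_mul, div_eq_inv_mul]
    linear_combination -this
  rw [h2, zero_smul, add_zero] at hg
  have h1 : g 1 = 0 := by
    by_contra h
    apply hα
    rw [Submodule.mem_span_singleton]
    refine ⟨-(g 0 / g 1), ?_⟩
    have : (g 1)⁻¹ • (g 0 • (1 : L) + g 1 • α) = 0 := by rw [hg, smul_zero]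
    rw [smul_add, smul_smul, smul_smul, inv_mul_cancel₀ h, one_smul] at this
    rw [neg_smul, div_eq_inv_mul]
    linear_combination -this
  rw [h1, zero_smul, add_zero] at hg
  have h0 : g 0 = 0 := by simpa using hg
  intro i
  fin_cases i <;> assumption

/-- The constant of `flag_bound` for cubic extensions of `k`. -/
def cubicConst : ℝ := 2 ^ finrank ℚ k * flagConst (finrank ℚ k * 3)

variable {k}

/-- A basis of a cubic extension with successive minima. -/
lemma exists_cubic_basis (h3 : finrank k L = 3) : ∃ α β : 𝓞 L,
    (α : L) ∉ Submodule.span k {(1 : L)} ∧ (β : L) ∉ Submodule.span k {1, (α : L)} ∧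
    1 ≤ house (α : L) ∧ house (α : L) ≤ house (β : L) ∧
    (house (α : L) * house (β : L)) ^ finrank ℚ k ≤
      flagConst (finrank ℚ k * 3) * √|(discr L : ℝ)| := by
  have : IsScalarTower ℚ k L := IsScalarTower.of_algebraMap_eq' (Subsingleton.elim _ _)
  have hfin : FiniteDimensional k L := FiniteDimensional.of_finrank_pos (by omega)
  have hrank : ∀ (V : Submodule k L), finrank ℚ (V.restrictScalars ℚ) = finrank ℚ k * finrank k V :=
    fun V => (finrank_mul_finrank ℚ k V).symm
  set U := Submodule.span k {(1 : L)} with hU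
  have hUr : finrank k U ≤ 1 := by
    have := finrank_span_le_card (R := k) ({(1 : L)} : Set L)
    simpa using this
  have hUtop : U.restrictScalars ℚ ≠ ⊤ := by
    intro h
    rw [Submodule.restrictScalars_eq_top_iff] at h
    rw [h, finrank_top] at hUr
    omega
  obtain ⟨α, hα, hαmin⟩ := exists_min_house (U.restrictScalars ℚ) hUtop
  set W := Submodule.span k {1, (α : L)} with hW
  have hWr : finrank k W ≤ 2 := by
    have := finrank_span_le_card (R := k) ({1, (α : L)} : Set L)
    refine this.trans ?_
    rw [Set.toFinset_card]
    exact (Fintype.card_eq_nat_card.trans (Nat.card_coe_set_eq _)).trans_le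
      ((Set.ncard_insert_le _ _).trans
      (by rw [Set.ncard_singleton]))
  have hWtop : W.restrictScalars ℚ ≠ ⊤ := by
    intro h
    rw [Submodule.restrictScalars_eq_top_iff] at h
    rw [h, finrank_top] at hWr
    omega
  obtain ⟨β, hβ, hβmin⟩ := exists_min_house (W.restrictScalars ℚ) hWtop
  have hUW : U ≤ W := Submodule.span_mono (by simp)
  have hα1 : 1 ≤ house (α : L) := by
    refine one_le_house_of_isIntegral α.2 fun h => hα ?_
    rw [show (α : L) = 0 from h]
    exact zero_mem _
  have hαβ := hαmin β fun h => hβ (hUW h)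
  refine ⟨α, β, hα, hβ, hα1, hαβ, ?_⟩
  have hN : finrank ℚ L = finrank ℚ k * 3 := by rw [← h3, finrank_mul_finrank]
  have key := flag_bound L (U.restrictScalars ℚ) (W.restrictScalars ℚ) hUW
    (u := finrank ℚ k) (w := finrank ℚ k * 2)
    (by rw [hrank]; exact (Nat.mul_le_mul_left _ hUr).trans_eq (mul_one _))
    (by rw [hrank]; exact Nat.mul_le_mul_left _ hWr) hα1 hαβ hαmin hβmin
  rw [hN, show finrank ℚ k * 3 - finrank ℚ k = 2 * finrank ℚ k by omega,
    show finrank ℚ k * 3 - finrank ℚ k * 2 = finrank ℚ k by omega, pow_mul, ← mul_pow] at key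
  convert key using 2
  field_simp

variable (k) in
/-- The constant bounding the coordinates in `exists_cubic_coordinates`. -/
def cubicCoordConst : ℝ :=
  finrank ℚ k * coordConst k 3 (cubicConst k) * basisHouse k

variable (k) in
/-- The denominator in `exists_cubic_coordinates`. -/
def cubicDenom : ℕ := ⌊coordConst k 3 (cubicConst k)⌋₊.factorial

lemma exists_cubic_coordinates (h3 : finrank k L = 3) {α β : 𝓞 L}
    (hα : (α : L) ∉ Submodule.span k {(1 : L)}) (hβ : (β : L) ∉ Submodule.span k {1, (α : L)})
    {l m : ℝ} (hl : 1 ≤ l) (hm : 1 ≤ m) (hαl : house (α : L) ≤ l) (hβm : house (β : L) ≤ 2 * m)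
    (hlm : (l * m) ^ finrank ℚ k ≤ flagConst (finrank ℚ k * 3) * √|(discr L : ℝ)|) (ξ : 𝓞 L) :
    ∃ x : Fin 3 → k, ∃ y : Fin 3 → 𝓞 k,
      (ξ : L) = algebraMap k L (x 0) + algebraMap k L (x 1) * α + algebraMap k L (x 2) * β ∧
      (∀ j, (y j : k) = cubicDenom k * x j) ∧
      house (x 1) ≤ cubicCoordConst k * house (ξ : L) / l ∧
      house (x 2) ≤ cubicCoordConst k * house (ξ : L) / (2 * m) := by
  obtain ⟨x, hx, h⟩ := exists_coordinates h3 (C₁ := cubicConst k) (![1, α, β] : Fin 3 → 𝓞 L) (by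
      convert linearIndependent_one_pair k hα hβ using 1
      ext i
      fin_cases i <;> simp) ![1, l, 2 * m]
    (by
      intro j
      fin_cases j
      · simp
      · simpa using hl
      · simp only [Fin.reduceFinMk, Matrix.cons_val]
        linarith)
    (by
      intro j
      fin_cases j
      · simpa using (house_intCast (K := L) 1).le
      · simpa using hαl
      · simpa using hβm)
    (by
      rw [Fin.prod_univ_three]
      simp only [Matrix.cons_val_zero, Matrix.cons_val_one, Matrix.cons_val, one_pow, one_mul]
      calc l ^ finrank ℚ k * (2 * m) ^ finrank ℚ k = 2 ^ finrank ℚ k * (l * m) ^ finrank ℚ k := by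
            rw [← mul_pow, ← mul_pow]; ring
        _ ≤ 2 ^ finrank ℚ k * (flagConst (finrank ℚ k * 3) * √|(discr L : ℝ)|) := by gcongr
        _ = _ := by rw [cubicConst]; ring) ξ
  choose h₁ h₂ using h
  choose y hy using h₁
  have h₃ := h₂ 1
  have h₄ := h₂ 2
  simp only [Matrix.cons_val_one, Matrix.cons_val] at h₃ h₄
  refine ⟨x, y, ?_, fun j => by rw [cubicDenom]; exact hy j, by rw [cubicCoordConst]; exact h₃,
    by rw [cubicCoordConst]; exact h₄⟩
  rw [hx, Fin.sum_univ_three]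
  simp only [Matrix.cons_val_zero, Matrix.cons_val_one, Matrix.cons_val, map_one, mul_one]

lemma eq_of_cubic_coordinates {α β : L} (hα : α ∉ Submodule.span k {(1 : L)})
    (hβ : β ∉ Submodule.span k {1, α}) {a₀ a₁ a₂ b₀ b₁ b₂ : k}
    (h : algebraMap k L a₀ + algebraMap k L a₁ * α + algebraMap k L a₂ * β =
      algebraMap k L b₀ + algebraMap k L b₁ * α + algebraMap k L b₂ * β) :
    a₀ = b₀ ∧ a₁ = b₁ ∧ a₂ = b₂ := by
  have hli := linearIndependent_one_pair k hα hβ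
  rw [Fintype.linearIndependent_iff] at hli
  have hli := hli ![a₀ - b₀, a₁ - b₁, a₂ - b₂] (by
    rw [Fin.sum_univ_three]
    simp only [Matrix.cons_val_zero, Matrix.cons_val_one, Matrix.cons_val, Algebra.smul_def,
      map_sub]
    linear_combination h)
  exact ⟨sub_eq_zero.mp (hli 0), sub_eq_zero.mp (hli 1), sub_eq_zero.mp (hli 2)⟩

end cubic

section cubic
open NumberField Module

lemma val_sub {L : Type*} [Field L] (x y : 𝓞 L) : ((x - y : 𝓞 L) : L) = x - y := rfl
lemma val_mul {L : Type*} [Field L] (x y : 𝓞 L) : ((x * y : 𝓞 L) : L) = x * y := rfl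
lemma val_neg {L : Type*} [Field L] (x : 𝓞 L) : ((-x : 𝓞 L) : L) = -x := rfl
lemma val_pow {L : Type*} [Field L] (x : 𝓞 L) (n : ℕ) : ((x ^ n : 𝓞 L) : L) = x ^ n := rfl
lemma val_two {L : Type*} [Field L] : ((2 : 𝓞 L) : L) = 2 := rfl
lemma val_zero {L : Type*} [Field L] : ((0 : 𝓞 L) : L) = 0 := rfl

lemma house_neg {L : Type*} [Field L] [NumberField L] (x : L) : house (-x) = house x := by
  simp [house]

lemma house_sub_le {L : Type*} [Field L] [NumberField L] (x y : L) :
    house (x - y) ≤ house x + house y := by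
  rw [sub_eq_add_neg, ← house_neg y]
  exact house_add_le _ _

lemma adjoin_simple_eq_top_of_prime {k L : Type*} [Field k] [Field L] [Algebra k L]
    (hp : (finrank k L).Prime) {y : L} (hy : y ∉ Submodule.span k {(1 : L)}) :
    IntermediateField.adjoin k {y} = ⊤ := by
  have := IntermediateField.isSimpleOrder_of_finrank_prime k L hp
  refine (eq_bot_or_eq_top _).resolve_left fun h => hy ?_
  have h₁ : y ∈ (⊥ : IntermediateField k L) := h ▸ IntermediateField.mem_adjoin_simple_self k y
  obtain ⟨c, rfl⟩ := IntermediateField.mem_bot.mp h₁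
  exact Submodule.mem_span_singleton.mpr ⟨c, by rw [Algebra.smul_def, mul_one]⟩

variable {k : Type*} [Field k] [NumberField k] {L : Type*} [Field L] [NumberField L] [Algebra k L]

/-- Delone-Faddeev: the multiplication table of `1, α, β` yields a cubic equation. -/
lemma cubic_relation {α β : L} (hα : α ∉ Submodule.span k {(1 : L)})
    (hβ : β ∉ Submodule.span k {1, α}) {u₁ v₁ w₁ u₂ v₂ w₂ u₃ v₃ w₃ : k}
    (h₁ : α ^ 2 = algebraMap k L u₁ + algebraMap k L v₁ * α + algebraMap k L w₁ * β)
    (h₂ : α * β = algebraMap k L u₂ + algebraMap k L v₂ * α + algebraMap k L w₂ * β)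
    (h₃ : β ^ 2 = algebraMap k L u₃ + algebraMap k L v₃ * α + algebraMap k L w₃ * β) :
    w₁ ≠ 0 ∧ (α - algebraMap k L w₂) ^ 3 + algebraMap k L (2 * w₂ - v₁) * (α - algebraMap k L w₂) ^ 2
      + algebraMap k L w₁ * algebraMap k L (w₃ - 2 * v₂) * (α - algebraMap k L w₂)
      + algebraMap k L w₁ ^ 2 * algebraMap k L (-v₃) = 0 := by
  set f := algebraMap k L
  have hp := eq_of_cubic_coordinates hα hβ
    (a₀ := (2 * w₂ - v₁) * (u₂ + v₂ * w₂) - w₁ * (u₃ + v₃ * w₂ + (w₃ - 2 * v₂) * v₂ + v₂ ^ 2)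
      - (u₂ + v₂ * w₂ - w₁ * v₃) * w₂
      + (u₁ + w₂ ^ 2 + (v₁ - 2 * w₂) * w₂ + w₁ * v₂ + w₁ * (w₃ - 2 * v₂)) * v₂)
    (a₁ := u₂ + v₂ * w₂ - w₁ * v₃)
    (a₂ := -(u₁ + w₂ ^ 2 + (v₁ - 2 * w₂) * w₂ + w₁ * v₂ + w₁ * (w₃ - 2 * v₂)))
    (b₀ := 0) (b₁ := 0) (b₂ := 0) (by
      simp only [map_sub, map_mul, map_add, map_neg, map_pow, map_zero, map_ofNat]
      linear_combination (β - f v₂) * h₁ - (α - f w₂ + 2 * f w₂ - f v₁) * h₂ + f w₁ * h₃)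
  obtain ⟨-, hr, hpp⟩ := hp
  have hr' := congrArg f hr
  have hp' := congrArg f hpp
  simp only [map_sub, map_mul, map_add, map_neg, map_pow, map_zero, map_ofNat, f] at hr' hp' ⊢
  refine ⟨?_, ?_⟩
  · rintro rfl
    have hAB : (α - f w₂) * (β - f v₂) = 0 := by
      simp only [map_zero, f] at hr' ⊢
      linear_combination h₂ + hr'
    rcases mul_eq_zero.mp hAB with h | h
    · refine hα (Submodule.mem_span_singleton.mpr ⟨w₂, ?_⟩)
      rw [Algebra.smul_def, mul_one]
      exact (sub_eq_zero.mp h).symm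
    · refine hβ (Submodule.mem_span_pair.mpr ⟨v₂, 0, ?_⟩)
      rw [Algebra.smul_def, mul_one, zero_smul, add_zero]
      exact (sub_eq_zero.mp h).symm
  · linear_combination (α - f w₂) * h₁ + f w₁ * h₂ - (α - f w₂) * hp' + f w₁ * hr'

variable (k) in
/-- The constant for the size of the quadruples in `exists_cubic_data`. -/
def cubicBoxConst : ℝ := cubicDenom k * (16 * cubicCoordConst k)

variable (k) in
lemma cubicCoordConst_nonneg : 0 ≤ cubicCoordConst k := by
  have h₁ := one_le_basisHouse k
  have h₂ := flagConst_pos (finrank ℚ k * 3)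
  rw [cubicCoordConst, coordConst, cubicConst]
  positivity

variable (k) in
lemma cubicDenom_ne_zero : (cubicDenom k : k) ≠ 0 := by
  rw [cubicDenom]
  exact_mod_cast Nat.factorial_ne_zero _

lemma not_mem_span_shift {α β : L} (hβ : β ∉ Submodule.span k {1, α}) (m : k) :
    β + algebraMap k L m * α ∉ Submodule.span k {1, α} := by
  intro h
  apply hβ
  have : algebraMap k L m * α ∈ Submodule.span k {1, α} := by
    rw [← Algebra.smul_def]
    exact Submodule.smul_mem _ _ (Submodule.subset_span (by simp))
  simpa using sub_mem h this

/-- The quadruple attached to the basis `1, α, β` of a cubic extension. -/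
lemma exists_cubic_quadruple (h3 : finrank k L = 3) {α β : 𝓞 L}
    (hα : (α : L) ∉ Submodule.span k {(1 : L)}) (hβ : (β : L) ∉ Submodule.span k {1, (α : L)})
    {x y m : ℝ} (hx : 1 ≤ x) (hy : 1 ≤ y) (hα1 : 1 ≤ house (α : L)) (hμ : y ≤ m) (hμ' : m ≤ 2 * y)
    (hαx : house (α : L) ≤ 2 * x) (hβm : house (β : L) ≤ 2 * m)
    (hlm : (house (α : L) * m) ^ finrank ℚ k ≤
      flagConst (finrank ℚ k * 3) * √|(discr L : ℝ)|) (hαx' : x ≤ house (α : L)) :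
    ∃ q : Fin 4 → 𝓞 k, q 0 ≠ 0 ∧ (∀ i, house (q i : k) ≤ cubicBox (cubicBoxConst k) x y i) ∧
      (∃ z : L, IsCubicRoot q z ∧ IntermediateField.adjoin k {z} = ⊤) ∧
      ∃ u₁ v₁ w₁ u₂ v₂ w₂ : k, w₁ ≠ 0 ∧
        (α : L) ^ 2 = algebraMap k L u₁ + algebraMap k L v₁ * α + algebraMap k L w₁ * β ∧
        (α : L) * β = algebraMap k L u₂ + algebraMap k L v₂ * α + algebraMap k L w₂ * β ∧
        (q 0 : k) = cubicDenom k * w₁ ∧ (q 1 : k) = cubicDenom k * (2 * w₂ - v₁) := by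
  have hN := cubicDenom_ne_zero k
  have hC := cubicCoordConst_nonneg k
  obtain ⟨X, X', hX, hX', hX1, hX2⟩ :=
    exists_cubic_coordinates h3 hα hβ hα1 (hy.trans hμ) le_rfl hβm
    hlm (α ^ 2)
  obtain ⟨Y, Y', hY, hY', hY1, hY2⟩ :=
    exists_cubic_coordinates h3 hα hβ hα1 (hy.trans hμ) le_rfl hβm
    hlm (α * β)
  obtain ⟨Z, Z', hZ, hZ', hZ1, hZ2⟩ :=
    exists_cubic_coordinates h3 hα hβ hα1 (hy.trans hμ) le_rfl hβm
    hlm (β ^ 2)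
  set l := house (α : L) with hl
  set C := cubicCoordConst k with hCdef
  have hm0 : 0 < m := by linarith
  have hh1 : house ((α ^ 2 : 𝓞 L) : L) ≤ l ^ 2 := by
    rw [val_pow]; exact house_pow_le _ _
  have hh2 : house ((α * β : 𝓞 L) : L) ≤ l * (2 * m) := by
    rw [val_mul]
    exact (house_mul_le _ _).trans (mul_le_mul le_rfl hβm (house_nonneg _) (by linarith))
  have hh3 : house ((β ^ 2 : 𝓞 L) : L) ≤ (2 * m) ^ 2 := by
    rw [val_pow]; exact (house_pow_le _ _).trans (pow_le_pow_left₀ (house_nonneg _) hβm 2)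
  have hl0 : 0 < l := by linarith
  have hw1 : house (X 2) ≤ 16 * C * (x ^ 2 / y) := calc
    house (X 2) ≤ C * l ^ 2 / (2 * m) := hX2.trans (by gcongr)
    _ ≤ C * (2 * x) ^ 2 / (2 * y) := by gcongr
    _ = 2 * C * (x ^ 2 / y) := by ring
    _ ≤ 16 * C * (x ^ 2 / y) := by gcongr; norm_num
  have hv1 : house (X 1) ≤ 2 * C * x := calc
    house (X 1) ≤ C * l ^ 2 / l := hX1.trans (by gcongr)
    _ = C * l := by field_simp
    _ ≤ C * (2 * x) := by gcongr
    _ = _ := by ring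
  have hw2 : house (Y 2) ≤ 2 * C * x := calc
    house (Y 2) ≤ C * (l * (2 * m)) / (2 * m) := hY2.trans (by gcongr)
    _ = C * l := by field_simp
    _ ≤ C * (2 * x) := by gcongr
    _ = _ := by ring
  have hv2 : house (Y 1) ≤ 4 * C * y := calc
    house (Y 1) ≤ C * (l * (2 * m)) / l := hY1.trans (by gcongr)
    _ = C * (2 * m) := by field_simp
    _ ≤ C * (2 * (2 * y)) := by gcongr
    _ = _ := by ring
  have hw3 : house (Z 2) ≤ 4 * C * y := calc
    house (Z 2) ≤ C * (2 * m) ^ 2 / (2 * m) := hZ2.trans (by gcongr)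
    _ = C * (2 * m) := by field_simp
    _ ≤ C * (2 * (2 * y)) := by gcongr
    _ = _ := by ring
  have hv3 : house (Z 1) ≤ 16 * C * (y ^ 2 / x) := calc
    house (Z 1) ≤ C * (2 * m) ^ 2 / l := hZ1.trans (by gcongr)
    _ ≤ C * (2 * (2 * y)) ^ 2 / x := by gcongr
    _ = _ := by ring
  rw [val_pow] at hX hZ
  rw [val_mul] at hY
  obtain ⟨hw, hrel⟩ := cubic_relation hα hβ hX hY hZ
  have hq0 : (X' 2 : k) ≠ 0 := by rw [hX']; exact mul_ne_zero hN hw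
  have e1 : ((2 * Y' 2 - X' 1 : 𝓞 k) : k) = cubicDenom k * (2 * Y 2 - X 1) := by
    rw [val_sub, val_mul, val_two, hX', hY']; ring
  have e2 : ((Z' 2 - 2 * Y' 1 : 𝓞 k) : k) = cubicDenom k * (Z 2 - 2 * Y 1) := by
    rw [val_sub, val_mul, val_two, hZ', hY']; ring
  have e3 : ((- Z' 1 : 𝓞 k) : k) = cubicDenom k * (- Z 1) := by
    rw [val_neg, hZ']; ring
  have h2h : ∀ z : k, house (2 * z) = 2 * house z := fun z => by
    exact_mod_cast house_nat_mul z 2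
  refine ⟨![X' 2, 2 * Y' 2 - X' 1, Z' 2 - 2 * Y' 1, - Z' 1], ?_, ?_,
    ⟨cubicDenom k * (α - algebraMap k L (Y 2)), ?_, ?_⟩,
    X 0, X 1, X 2, Y 0, Y 1, Y 2, hw, hX, hY, ?_, ?_⟩
  · intro h
    apply hq0
    simp only [Matrix.cons_val_zero] at h
    rw [h, val_zero]
  · intro i
    fin_cases i
    · simp only [Fin.zero_eta, Matrix.cons_val_zero, cubicBox, cubicBoxConst]
      rw [hX', house_nat_mul, mul_assoc]
      gcongr
    · simp only [Fin.mk_one, Matrix.cons_val_one, Matrix.cons_val_zero, cubicBox, cubicBoxConst]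
      rw [e1, house_nat_mul, mul_assoc]
      refine mul_le_mul_of_nonneg_left ((house_sub_le _ _).trans ?_) (by positivity)
      rw [h2h]
      nlinarith
    · simp only [Fin.reduceFinMk, Matrix.cons_val, cubicBox, cubicBoxConst]
      rw [e2, house_nat_mul, mul_assoc]
      refine mul_le_mul_of_nonneg_left ((house_sub_le _ _).trans ?_) (by positivity)
      rw [h2h]
      nlinarith
    · simp only [Fin.reduceFinMk, Matrix.cons_val, cubicBox, cubicBoxConst]
      rw [e3, house_nat_mul, mul_assoc, house_neg]
      gcongr
  · simp only [IsCubicRoot, Matrix.cons_val_zero, Matrix.cons_val_one, Matrix.cons_val]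
    rw [hX', e1, e2, e3]
    simp only [map_sub, map_mul, map_neg, map_natCast, map_ofNat] at hrel ⊢
    linear_combination (cubicDenom k : L) ^ 3 * hrel
  · refine adjoin_simple_eq_top_of_prime (by rw [h3]; exact Nat.prime_three) fun h => hα ?_
    obtain ⟨c, hc⟩ := Submodule.mem_span_singleton.mp h
    refine Submodule.mem_span_singleton.mpr ⟨c / cubicDenom k + Y 2, ?_⟩
    rw [Algebra.smul_def, mul_one] at hc ⊢
    have hN' : (cubicDenom k : L) ≠ 0 := by
      have := (map_ne_zero (algebraMap k L)).mpr hN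
      rwa [map_natCast] at this
    rw [map_add, map_div₀, map_natCast, hc]
    field_simp
    ring
  · simp only [Matrix.cons_val_zero]
    exact hX' 2
  · simp only [Matrix.cons_val_one, Matrix.cons_val_zero]
    exact e1

/-- Different shifts of the second basis vector have different multiplication tables. -/
lemma shift_injective {α β : L} (hα : α ∉ Submodule.span k {(1 : L)})
    (hβ : β ∉ Submodule.span k {1, α}) {c d u₁ v₁ w₁ u₂ v₂ w₂ u₁' v₁' w₁' u₂' v₂' w₂' : k}
    (hw : w₁ ≠ 0) (e0 : w₁ = w₁') (e1 : 2 * w₂ - v₁ = 2 * w₂' - v₁')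
    (a1 : α ^ 2 = algebraMap k L u₁ + algebraMap k L v₁ * α +
      algebraMap k L w₁ * (β + algebraMap k L c * α))
    (a2 : α * (β + algebraMap k L c * α) = algebraMap k L u₂ + algebraMap k L v₂ * α +
      algebraMap k L w₂ * (β + algebraMap k L c * α))
    (b1 : α ^ 2 = algebraMap k L u₁' + algebraMap k L v₁' * α +
      algebraMap k L w₁' * (β + algebraMap k L d * α))
    (b2 : α * (β + algebraMap k L d * α) = algebraMap k L u₂' + algebraMap k L v₂' * α +
      algebraMap k L w₂' * (β + algebraMap k L d * α)) : c = d := by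
  have E1 := eq_of_cubic_coordinates hα hβ (a₀ := u₁) (a₁ := v₁ + w₁ * c)
    (a₂ := w₁) (b₀ := u₁') (b₁ := v₁' + w₁' * d) (b₂ := w₁') (by
      simp only [map_add, map_mul]
      linear_combination b1 - a1)
  have E2 := eq_of_cubic_coordinates hα hβ (a₀ := u₂ - c * u₁)
    (a₁ := v₂ + w₂ * c - c * (v₁ + w₁ * c)) (a₂ := w₂ - c * w₁) (b₀ := u₂' - d * u₁')
    (b₁ := v₂' + w₂' * d - d * (v₁' + w₁' * d)) (b₂ := w₂' - d * w₁') (by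
      simp only [map_add, map_mul, map_sub]
      linear_combination b2 - a2 - algebraMap k L d * b1 + algebraMap k L c * a1)
  have h : (3 : k) * w₁ * (c - d) = 0 := by
    linear_combination e1 + E1.2.1 - 2 * E2.2.2 - 3 * d * e0
  exact sub_eq_zero.mp ((mul_eq_zero.mp h).resolve_left (mul_ne_zero (by norm_num) hw))

/-- The coefficients `q 0` and `q 1` come from the multiplication table of `1, α, β + c α`. -/
def IsShiftQuadruple (α β : L) (N : k) (q : Fin 4 → 𝓞 k) (c : k) : Prop :=
  ∃ u₁ v₁ w₁ u₂ v₂ w₂ : k, w₁ ≠ 0 ∧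
    α ^ 2 = algebraMap k L u₁ + algebraMap k L v₁ * α +
      algebraMap k L w₁ * (β + algebraMap k L c * α) ∧
    α * (β + algebraMap k L c * α) = algebraMap k L u₂ + algebraMap k L v₂ * α +
      algebraMap k L w₂ * (β + algebraMap k L c * α) ∧
    (q 0 : k) = N * w₁ ∧ (q 1 : k) = N * (2 * w₂ - v₁)

lemma IsShiftQuadruple.eq {α β : L} (hα : α ∉ Submodule.span k {(1 : L)})
    (hβ : β ∉ Submodule.span k {1, α}) {N : k} (hN : N ≠ 0) {q : Fin 4 → 𝓞 k} {c d : k}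
    (hc : IsShiftQuadruple α β N q c) (hd : IsShiftQuadruple α β N q d) : c = d := by
  obtain ⟨u₁, v₁, w₁, u₂, v₂, w₂, hw, a1, a2, h₃, h₄⟩ := hc
  obtain ⟨u₁', v₁', w₁', u₂', v₂', w₂', -, b1, b2, h₃', h₄'⟩ := hd
  exact shift_injective hα hβ hw (mul_left_cancel₀ hN (h₃.symm.trans h₃'))
    (mul_left_cancel₀ hN (h₄.symm.trans h₄')) a1 a2 b1 b2

lemma exists_shift_quadruple (h3 : finrank k L = 3) {α β : 𝓞 L}
    (hα : (α : L) ∉ Submodule.span k {(1 : L)}) (hβ : (β : L) ∉ Submodule.span k {1, (α : L)})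
    {x y : ℝ} (hx : 1 ≤ x) (hy : 1 ≤ y) (hα1 : 1 ≤ house (α : L)) (hμ : y ≤ house (β : L))
    (hμ' : house (β : L) ≤ 2 * y)
    (hαx : house (α : L) ≤ 2 * x)
    (hlm : (house (α : L) * house (β : L)) ^ finrank ℚ k ≤
      flagConst (finrank ℚ k * 3) * √|(discr L : ℝ)|) (hαx' : x ≤ house (α : L))
    (c : 𝓞 k) (hc : house (c : k) ≤ house (β : L) / house (α : L)) :
    ∃ q : Fin 4 → 𝓞 k, q 0 ≠ 0 ∧ (∀ i, house (q i : k) ≤ cubicBox (cubicBoxConst k) x y i) ∧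
      (∃ z : L, IsCubicRoot q z ∧ IntermediateField.adjoin k {z} = ⊤) ∧
      IsShiftQuadruple (α : L) (β : L) (cubicDenom k : k) q (c : k) := by
  have hβ' : ((β + algebraMap (𝓞 k) (𝓞 L) c * α : 𝓞 L) : L) ∉ Submodule.span k {1, (α : L)} :=
    not_mem_span_shift hβ (c : k)
  have h₁ : house (algebraMap k L (c : k)) ≤ house (β : L) / house (α : L) :=
    (house_algebraMap_le (c : k)).trans hc
  have hb : house ((β + algebraMap (𝓞 k) (𝓞 L) c * α : 𝓞 L) : L) ≤ 2 * house (β : L) := by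
    have h₂ := (house_mul_le (algebraMap k L (c : k)) (α : L)).trans
      (mul_le_mul_of_nonneg_right h₁ (house_nonneg _))
    rw [div_mul_cancel₀ _ (by linarith)] at h₂
    have h₃ := house_add_le (β : L) (algebraMap k L (c : k) * (α : L))
    have h₄ : ((β + algebraMap (𝓞 k) (𝓞 L) c * α : 𝓞 L) : L) =
      (β : L) + algebraMap k L (c : k) * (α : L) := rfl
    rw [h₄]
    linarith
  obtain ⟨q, h0, hbox, hroot, u₁, v₁, w₁, u₂, v₂, w₂, h⟩ :=
    exists_cubic_quadruple h3 hα hβ' hx hy hα1 hμ hμ' hαx hb hlm hαx'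
  exact ⟨q, h0, hbox, hroot, u₁, v₁, w₁, u₂, v₂, w₂, h⟩

/-- Every cubic extension is generated by roots of many cubic polynomials with small
coefficients. -/
theorem exists_cubic_data (h3 : finrank k L = 3) : ∃ s t : ℕ, s ≤ t ∧
    ((2 : ℝ) ^ (s + t)) ^ finrank ℚ k ≤ flagConst (finrank ℚ k * 3) * √|(discr L : ℝ)| ∧
    ∃ Q : Finset (Fin 4 → 𝓞 k),
      ((2 : ℝ) ^ (t - s)) ^ finrank ℚ k ≤ (2 * basisHouse k) ^ finrank ℚ k * Q.card ∧
      ∀ q ∈ Q, q 0 ≠ 0 ∧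
        (∀ i, house (q i : k) ≤ cubicBox (cubicBoxConst k) (2 ^ s) (2 ^ t) i) ∧
        ∃ z : L, IsCubicRoot q z ∧ IntermediateField.adjoin k {z} = ⊤ := by
  obtain ⟨α, β, hα, hβ, hα1, hαβ, hD⟩ := exists_cubic_basis (k := k) h3
  obtain ⟨s, hs, hs'⟩ := exists_nat_pow_near hα1 (one_lt_two (α := ℝ))
  obtain ⟨t, ht, ht'⟩ := exists_nat_pow_near (hα1.trans hαβ) (one_lt_two (α := ℝ))
  rw [pow_succ'] at hs' ht'
  have hst : s ≤ t := by
    by_contra! h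
    have : (2 : ℝ) ^ (t + 1) ≤ 2 ^ s := pow_le_pow_right₀ one_le_two h
    rw [pow_succ'] at this
    linarith
  refine ⟨s, t, hst, le_trans ?_ hD, ?_⟩
  · rw [pow_add]; gcongr
  obtain ⟨T, hT, hTcard⟩ := exists_finset_house_le k (B := house (β : L) / house (α : L))
    (div_nonneg (house_nonneg _) (house_nonneg _))
  have key : ∀ c : T, ∃ q : Fin 4 → 𝓞 k, q 0 ≠ 0 ∧
      (∀ i, house (q i : k) ≤ cubicBox (cubicBoxConst k) (2 ^ s) (2 ^ t) i) ∧
      (∃ z : L, IsCubicRoot q z ∧ IntermediateField.adjoin k {z} = ⊤) ∧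
      IsShiftQuadruple (α : L) (β : L) (cubicDenom k : k) q ((c : 𝓞 k) : k) := fun c =>
    exists_shift_quadruple h3 hα hβ (one_le_pow₀ one_le_two) (one_le_pow₀ one_le_two) hα1 ht
      ht'.le hs'.le hD hs c.1 (hT c c.2)
  choose q hq0 hqbox hqroot hqc using key
  have hinj : Function.Injective q := by
    intro c d hcd
    have h := hqc c
    rw [hcd] at h
    exact Subtype.ext (RingOfIntegers.coe_injective
      (h.eq hα hβ (cubicDenom_ne_zero k) (hqc d)))
  generalize house (α : L) = l at *
  generalize house (β : L) = m at *
  refine ⟨Finset.univ.image q, ?_, ?_⟩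
  · rw [Finset.card_image_of_injective _ hinj, Finset.card_univ, Fintype.card_coe]
    have hb := one_le_basisHouse k
    have h5 : (2 : ℝ) ^ (t - s) ≤ 2 * basisHouse k * (m / l / basisHouse k) := by
      have : (2 : ℝ) ^ (t - s) = 2 ^ t / 2 ^ s := by rw [pow_sub₀ _ two_ne_zero hst]; rfl
      rw [this]
      have h6 : 2 * basisHouse k * (m / l / basisHouse k) = 2 * m / l := by field_simp
      rw [h6, div_le_div_iff₀ (by positivity) (by linarith)]
      have h7 : (0 : ℝ) < 2 ^ s := by positivity
      have h8 : (0 : ℝ) < 2 ^ t := by positivity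
      nlinarith
    calc _ ≤ (2 * basisHouse k * (m / l / basisHouse k)) ^ finrank ℚ k := by gcongr
      _ = (2 * basisHouse k) ^ finrank ℚ k * (m / l / basisHouse k) ^ finrank ℚ k := mul_pow _ _ _
      _ ≤ _ := by gcongr
  · intro p hp
    obtain ⟨c, -, rfl⟩ := Finset.mem_image.mp hp
    exact ⟨hq0 c, hqbox c, hqroot c⟩

end cubic

section cubicCount
open NumberField Module

lemma sum_pow_le {b Z : ℝ} (hb : 2 ≤ b) (hZ : 0 ≤ Z) (P : Finset ℕ) (hP : ∀ e ∈ P, b ^ e ≤ Z) :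
    ∑ e ∈ P, b ^ e ≤ 2 * Z := by
  rcases P.eq_empty_or_nonempty with rfl | hne
  · simpa using hZ
  have h : ∀ E : ℕ, ∑ e ∈ Finset.range (E + 1), b ^ e ≤ 2 * b ^ E := by
    intro E
    induction E with
    | zero => simp
    | succ E ih =>
      rw [Finset.sum_range_succ, pow_succ b E]
      have : 0 < b ^ E := by positivity
      nlinarith
  calc ∑ e ∈ P, b ^ e ≤ ∑ e ∈ Finset.range (P.max' hne + 1), b ^ e :=
        Finset.sum_le_sum_of_subset_of_nonneg
          (fun e he => Finset.mem_range_succ_iff.mpr (P.le_max' e he)) fun _ _ _ => by positivity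
    _ ≤ 2 * b ^ P.max' hne := h _
    _ ≤ 2 * Z := by gcongr; exact hP _ (P.max'_mem hne)

/-- Summation over pairs of scales. -/
lemma card_le_of_scales {ι : Type*} (S : Finset ι) (s t : ι → ℕ) (hst : ∀ K ∈ S, s K ≤ t K)
    {n : ℕ} (hn : 1 ≤ n) {C Y : ℝ} (hC : 0 ≤ C)
    (hY : ∀ K ∈ S, ((2 : ℝ) ^ (s K + t K)) ^ n ≤ Y)
    (hS : ∀ a b : ℕ, ((S.filter fun K => s K = a ∧ t K = b).card : ℝ) * ((2 : ℝ) ^ (b - a)) ^ n ≤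
      C * (((2 : ℝ) ^ (a + b)) ^ n) ^ 2) :
    (S.card : ℝ) ≤ C * 4 * Y ^ 2 := by
  set f : ι → ℕ × ℕ := fun K => (s K + t K, t K - s K) with hf
  set P := (S.image f).image Prod.fst
  set R := (S.image f).image Prod.snd
  have hsub : S.image f ⊆ P ×ˢ R := fun x hx => Finset.mem_product.mpr
    ⟨Finset.mem_image_of_mem _ hx, Finset.mem_image_of_mem _ hx⟩
  have h2n : (2 : ℝ) ≤ 2 ^ n := by
    simpa using pow_le_pow_right₀ (one_le_two (α := ℝ)) hn
  have hfib : ∀ x ∈ S.image f, ((S.filter fun K => f K = x).card : ℝ) ≤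
      C * ((((2 : ℝ) ^ n) ^ 2) ^ x.1 * (1 / 2) ^ x.2) := by
    intro x hx
    obtain ⟨K, hK, rfl⟩ := Finset.mem_image.mp hx
    have h1 : (S.filter fun K' => f K' = f K) ⊆ S.filter fun K' => s K' = s K ∧ t K' = t K := by
      intro K' hK'
      rw [Finset.mem_filter] at hK' ⊢
      refine ⟨hK'.1, ?_⟩
      have h2 := hK'.2
      simp only [hf, Prod.mk.injEq] at h2
      have := hst K hK
      have := hst K' hK'.1
      omega
    have h2 := hS (s K) (t K)
    have h3 : ((S.filter fun K' => f K' = f K).card : ℝ) ≤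
        (S.filter fun K' => s K' = s K ∧ t K' = t K).card := by
      exact_mod_cast Finset.card_le_card h1
    simp only [hf]
    have h4 : (1 : ℝ) ≤ (1 / 2) ^ (t K - s K) * ((2 : ℝ) ^ (t K - s K)) ^ n := by
      have : ((2 : ℝ) ^ (t K - s K)) ^ 1 ≤ ((2 : ℝ) ^ (t K - s K)) ^ n :=
        pow_le_pow_right₀ (one_le_pow₀ one_le_two) hn
      calc (1 : ℝ) = (1 / 2) ^ (t K - s K) * ((2 : ℝ) ^ (t K - s K)) ^ 1 := by
            rw [pow_one, ← mul_pow]; norm_num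
        _ ≤ _ := by gcongr
    calc ((S.filter fun K' => f K' = f K).card : ℝ) ≤ _ := h3
      _ ≤ (S.filter fun K' => s K' = s K ∧ t K' = t K).card *
          ((1 / 2) ^ (t K - s K) * ((2 : ℝ) ^ (t K - s K)) ^ n) :=
          le_mul_of_one_le_right (by positivity) h4
      _ = (1 / 2) ^ (t K - s K) * ((S.filter fun K' => s K' = s K ∧ t K' = t K).card *
          ((2 : ℝ) ^ (t K - s K)) ^ n) := by ring
      _ ≤ (1 / 2) ^ (t K - s K) * (C * (((2 : ℝ) ^ (s K + t K)) ^ n) ^ 2) := by gcongr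
      _ = _ := by
        rw [← pow_mul, ← pow_mul, ← pow_mul, ← pow_mul, mul_comm (s K + t K), ]
        rw [show n * 2 * (s K + t K) = n * (s K + t K) * 2 by ring]
        ring
  have hYP : ∀ e ∈ P, (((2 : ℝ) ^ n) ^ 2) ^ e ≤ Y ^ 2 := by
    intro e he
    obtain ⟨x, hx, rfl⟩ := Finset.mem_image.mp he
    obtain ⟨K, hK, rfl⟩ := Finset.mem_image.mp hx
    have := hY K hK
    calc (((2 : ℝ) ^ n) ^ 2) ^ (s K + t K) = (((2 : ℝ) ^ (s K + t K)) ^ n) ^ 2 := by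
          simp only [← pow_mul]; congr 1; ring
      _ ≤ Y ^ 2 := by gcongr
  have hR : ∑ i ∈ R, ((1 : ℝ) / 2) ^ i ≤ 2 := by
    have := Summable.sum_le_tsum R (fun i _ => by positivity) (summable_geometric_two)
    rwa [tsum_geometric_two] at this
  calc (S.card : ℝ) = ∑ x ∈ S.image f, ((S.filter fun K => f K = x).card : ℝ) := by
        rw [Finset.card_eq_sum_card_image f S]; push_cast; rfl
    _ ≤ ∑ x ∈ S.image f, C * ((((2 : ℝ) ^ n) ^ 2) ^ x.1 * (1 / 2) ^ x.2) :=
        Finset.sum_le_sum hfib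
    _ ≤ ∑ x ∈ P ×ˢ R, C * ((((2 : ℝ) ^ n) ^ 2) ^ x.1 * (1 / 2) ^ x.2) :=
        Finset.sum_le_sum_of_subset_of_nonneg hsub fun _ _ _ => by positivity
    _ = C * ((∑ e ∈ P, (((2 : ℝ) ^ n) ^ 2) ^ e) * ∑ i ∈ R, (1 / 2) ^ i) := by
        rw [← Finset.mul_sum, Finset.sum_product, Finset.sum_mul_sum]
    _ ≤ C * ((2 * Y ^ 2) * 2) := by
        gcongr
        exact sum_pow_le (by nlinarith) (by positivity) P hYP
    _ = _ := by ring

variable {k : Type*} [Field k] [NumberField k]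

lemma one_le_house_of_ne_zero {x : 𝓞 k} (hx : x ≠ 0) : 1 ≤ house (x : k) := by
  exact one_le_house_of_isIntegral x.2 fun h => hx (RingOfIntegers.coe_injective (h.trans rfl))

/-- A finite set of coefficient vectors is bounded by the volume of a box containing it. -/
lemma card_le_of_box {m : ℕ} (U : Finset (Fin m → 𝓞 k)) (B : Fin m → ℝ) (hB : ∀ i, 1 ≤ B i)
    (hU : ∀ q ∈ U, ∀ i, house (q i : k) ≤ B i) :
    (U.card : ℝ) ≤ countConst k ^ m * (∏ i, B i) ^ finrank ℚ k := by
  have h1 : U ⊆ Fintype.piFinset fun i => U.image (· i) := fun q hq =>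
    Fintype.mem_piFinset.mpr fun i => Finset.mem_image_of_mem (· i) hq
  calc (U.card : ℝ) ≤ ∏ i, ((U.image (· i)).card : ℝ) := by
        have := Finset.card_le_card h1
        rw [Fintype.card_piFinset] at this
        exact_mod_cast this
    _ ≤ ∏ i, countConst k * B i ^ finrank ℚ k := by
        refine Finset.prod_le_prod (fun _ _ => by positivity) fun i _ => ?_
        refine card_le_of_house_le k (hB i) _ fun x hx => ?_
        obtain ⟨q, hq, rfl⟩ := Finset.mem_image.mp hx
        exact hU q hq i
    _ = _ := by
        rw [Finset.prod_mul_distrib, Finset.prod_const, Finset.card_univ, Fintype.card_fin,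
          Finset.prod_pow]

/-- At most `d` subfields are generated by a root of a given polynomial of degree `d`. -/
lemma card_le_of_isRoot {Ω : Type*} [Field Ω] [Algebra k Ω] (S : Finset (IntermediateField k Ω))
    {f : Polynomial Ω} (hf : f ≠ 0)
    (hS : ∀ K ∈ S, ∃ z : Ω, f.IsRoot z ∧ IntermediateField.adjoin k {z} = K) :
    S.card ≤ f.natDegree := by
  choose! z hz hK using hS
  calc S.card ≤ f.roots.toFinset.card := by
        refine Finset.card_le_card_of_injOn z (fun K h => ?_) fun K h K' h' e => ?_
        · simpa [hf] using hz K h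
        · rw [← hK K h, ← hK K' h', e]
    _ ≤ f.roots.card := Multiset.toFinset_card_le _
    _ ≤ _ := f.card_roots'

/-- Double counting. -/
lemma sum_card_le_mul_card {ι α : Type*} [DecidableEq α] (S : Finset ι) (Q : ι → Finset α) (d : ℕ)
    (h : ∀ q, (S.filter fun K => q ∈ Q K).card ≤ d) :
    ∑ K ∈ S, (Q K).card ≤ d * (S.biUnion Q).card := by
  have : ∀ K ∈ S, (Q K).card = ((S.biUnion Q).filter fun q => q ∈ Q K).card := by
    intro K hK
    congr 1
    ext q
    simp only [Finset.mem_filter, Finset.mem_biUnion]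
    exact ⟨fun hq => ⟨⟨K, hK, hq⟩, hq⟩, fun hq => hq.2⟩
  rw [Finset.sum_congr rfl this, mul_comm, ← smul_eq_mul]
  have h2 := Finset.sum_card_bipartiteAbove_eq_sum_card_bipartiteBelow
    (s := S) (t := S.biUnion Q) (fun K q => q ∈ Q K)
  simp only [Finset.bipartiteAbove, Finset.bipartiteBelow] at h2
  rw [h2]
  exact Finset.sum_le_card_nsmul _ _ _ fun q _ => h q

open Polynomial in
/-- The monic polynomial whose roots satisfy `IsCubicRoot q`. -/
def cubicPoly (Ω : Type*) [Field Ω] [Algebra k Ω] (q : Fin 4 → 𝓞 k) : Polynomial Ω :=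
  X ^ 3 + C (algebraMap k Ω (q 1)) * X ^ 2 + C (algebraMap k Ω (q 0 * q 2)) * X +
    C (algebraMap k Ω (q 0 ^ 2 * q 3))

lemma natDegree_cubicPoly (Ω : Type*) [Field Ω] [Algebra k Ω] (q : Fin 4 → 𝓞 k) :
    (cubicPoly Ω q).natDegree = 3 := by
  rw [cubicPoly]
  compute_degree!

lemma cubicPoly_ne_zero (Ω : Type*) [Field Ω] [Algebra k Ω] (q : Fin 4 → 𝓞 k) :
    cubicPoly Ω q ≠ 0 := fun h => by
  have := natDegree_cubicPoly Ω q
  simp [h] at this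

lemma IntermediateField.adjoin_coe_eq {Ω : Type*} [Field Ω] [Algebra k Ω]
    {K : IntermediateField k Ω} {z : K} (hz : IntermediateField.adjoin k {z} = ⊤) :
    IntermediateField.adjoin k {(z : Ω)} = K := by
  have := congrArg (IntermediateField.map K.val) hz
  rw [IntermediateField.adjoin_map, ← AlgHom.fieldRange_eq_map, IntermediateField.fieldRange_val,
    Set.image_singleton] at this
  exact this

lemma isRoot_cubicPoly {Ω : Type*} [Field Ω] [Algebra k Ω] {K : IntermediateField k Ω}
    {q : Fin 4 → 𝓞 k} {z : K} (hz : IsCubicRoot q z) : (cubicPoly Ω q).IsRoot (z : Ω) := by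
  have := congrArg (algebraMap K Ω) hz
  simp only [map_add, map_mul, map_pow, map_zero, ← IsScalarTower.algebraMap_apply k K Ω] at this
  rw [Polynomial.IsRoot, cubicPoly]
  simp only [Polynomial.eval_add, Polynomial.eval_mul, Polynomial.eval_pow, Polynomial.eval_X,
    Polynomial.eval_C, map_mul, map_pow]
  exact this

/-- The number of cubic subfields with coefficient vectors in a given box. -/
lemma card_cubic_scale {Ω : Type*} [Field Ω] [NumberField Ω] [Algebra k Ω]
    (S : Finset (IntermediateField k Ω)) (Q : IntermediateField k Ω → Finset (Fin 4 → 𝓞 k))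
    {c : ℝ} (hc : 0 ≤ c) (a b : ℕ)
    (hQ : ∀ K ∈ S, a ≤ b ∧ ((2 : ℝ) ^ (b - a)) ^ finrank ℚ k ≤ c * (Q K).card ∧
      ∀ q ∈ Q K, q 0 ≠ 0 ∧
        (∀ i, house (q i : k) ≤ cubicBox (cubicBoxConst k) (2 ^ a) (2 ^ b) i) ∧
        ∃ z : K, IsCubicRoot q z ∧ IntermediateField.adjoin k {z} = ⊤) :
    (S.card : ℝ) * ((2 : ℝ) ^ (b - a)) ^ finrank ℚ k ≤
      c * 3 * countConst k ^ 4 * (max 1 (cubicBoxConst k) ^ 4) ^ finrank ℚ k *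
        (((2 : ℝ) ^ (a + b)) ^ finrank ℚ k) ^ 2 := by
  have hc1 := one_le_countConst k
  rcases (S.biUnion Q).eq_empty_or_nonempty with hempty | ⟨q₀, hq₀⟩
  · have h0 : (S.card : ℝ) = 0 := by
      rw [Nat.cast_eq_zero, Finset.card_eq_zero]
      by_contra hne
      obtain ⟨K, hK⟩ := Finset.nonempty_iff_ne_empty.mpr hne
      have h1 := (hQ K hK).2.1
      have h2 : Q K = ∅ := by
        rw [← Finset.subset_empty, ← hempty]
        exact Finset.subset_biUnion_of_mem Q hK
      rw [h2] at h1
      have : (0 : ℝ) < ((2 : ℝ) ^ (b - a)) ^ finrank ℚ k := by positivity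
      simp at h1
      linarith
    rw [h0, zero_mul]
    positivity
  set A := max 1 (cubicBoxConst k) with hA
  have hA1 : 1 ≤ A := le_max_left _ _
  have hx : (1 : ℝ) ≤ 2 ^ a := one_le_pow₀ one_le_two
  have hy : (1 : ℝ) ≤ 2 ^ b := one_le_pow₀ one_le_two
  have hmono : ∀ i, cubicBox (cubicBoxConst k) (2 ^ a) (2 ^ b) i ≤
      cubicBox A (2 ^ a) (2 ^ b) i := by
    have := le_max_right 1 (cubicBoxConst k)
    intro i
    fin_cases i <;> simp only [cubicBox, Fin.zero_eta, Fin.mk_one, Fin.reduceFinMk,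
      Matrix.cons_val_zero, Matrix.cons_val_one, Matrix.cons_val] <;> gcongr
  have hmem : ∀ q ∈ S.biUnion Q, q 0 ≠ 0 ∧ ∀ i, house (q i : k) ≤ cubicBox A (2 ^ a) (2 ^ b) i := by
    intro q hq
    obtain ⟨K, hK, hqK⟩ := Finset.mem_biUnion.mp hq
    obtain ⟨h0, h1, -⟩ := (hQ K hK).2.2 q hqK
    exact ⟨h0, fun i => (h1 i).trans (hmono i)⟩
  have hxy : (2 : ℝ) ^ a ≤ 2 ^ b := by
    obtain ⟨K, hK, -⟩ := Finset.mem_biUnion.mp hq₀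
    exact pow_le_pow_right₀ one_le_two (hQ K hK).1
  have hB : ∀ i, 1 ≤ cubicBox A (2 ^ a) (2 ^ b) i := by
    intro i
    fin_cases i
    · exact (one_le_house_of_ne_zero (hmem q₀ hq₀).1).trans ((hmem q₀ hq₀).2 0)
    · simp only [cubicBox, Fin.mk_one, Matrix.cons_val_one, Matrix.cons_val_zero]
      exact one_le_mul_of_one_le_of_one_le hA1 hx
    · simp only [cubicBox, Fin.reduceFinMk, Matrix.cons_val]
      exact one_le_mul_of_one_le_of_one_le hA1 hy
    · simp only [cubicBox, Fin.reduceFinMk, Matrix.cons_val]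
      refine one_le_mul_of_one_le_of_one_le hA1 ?_
      rw [one_le_div (by linarith)]
      nlinarith
  have hbox := card_le_of_box (S.biUnion Q) _ hB fun q hq => (hmem q hq).2
  have hprod : ∏ i, cubicBox A (2 ^ a) (2 ^ b) i = A ^ 4 * (2 ^ (a + b)) ^ 2 := by
    simp only [Fin.prod_univ_four, cubicBox, Matrix.cons_val_zero, Matrix.cons_val_one,
      Matrix.cons_val]
    rw [pow_add]
    field_simp
  rw [hprod, mul_pow] at hbox
  have hdc : ∑ K ∈ S, (Q K).card ≤ 3 * (S.biUnion Q).card := by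
    refine sum_card_le_mul_card S Q 3 fun q => ?_
    rw [← natDegree_cubicPoly Ω q]
    refine card_le_of_isRoot _ (cubicPoly_ne_zero Ω q) fun K hK => ?_
    rw [Finset.mem_filter] at hK
    obtain ⟨-, -, z, hz, hz'⟩ := (hQ K hK.1).2.2 q hK.2
    exact ⟨z, isRoot_cubicPoly hz, IntermediateField.adjoin_coe_eq hz'⟩
  have hdc' : (∑ K ∈ S, (Q K).card : ℝ) ≤ 3 * (S.biUnion Q).card := by exact_mod_cast hdc
  calc (S.card : ℝ) * ((2 : ℝ) ^ (b - a)) ^ finrank ℚ k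
      = ∑ K ∈ S, ((2 : ℝ) ^ (b - a)) ^ finrank ℚ k := by rw [Finset.sum_const, nsmul_eq_mul]
    _ ≤ ∑ K ∈ S, c * (Q K).card := Finset.sum_le_sum fun K hK => (hQ K hK).2.1
    _ = c * ∑ K ∈ S, ((Q K).card : ℝ) := by rw [Finset.mul_sum]
    _ ≤ c * (3 * (countConst k ^ 4 *
        ((A ^ 4) ^ finrank ℚ k * ((2 ^ (a + b)) ^ 2) ^ finrank ℚ k))) := by
        gcongr
        exact hdc'.trans (by gcongr)
    _ = _ := by ring

/-- There are `O(X)` cubic subfields of discriminant at most `X`, uniformly in the ambient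
field. -/
theorem exists_card_cubic_le (k : Type*) [Field k] [NumberField k] : ∃ C : ℝ, 0 < C ∧
    ∀ (Ω : Type*) [Field Ω] [NumberField Ω] [Algebra k Ω] (X : ℝ), 0 ≤ X →
      ∀ S : Finset (IntermediateField k Ω),
        (∀ K ∈ S, finrank k K = 3 ∧ |(discr K : ℝ)| ≤ X) → (S.card : ℝ) ≤ C * X := by
  set n := finrank ℚ k with hn
  have hn1 : 1 ≤ n := finrank_pos
  have hF := flagConst_pos (n * 3)
  have hc1 := one_le_countConst k
  have hb := one_le_basisHouse k
  set C₁ := (2 * basisHouse k) ^ n * 3 * countConst k ^ 4 * (max 1 (cubicBoxConst k) ^ 4) ^ n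
    with hC₁
  have hC₁0 : 0 < C₁ := by
    have : (0 : ℝ) < max 1 (cubicBoxConst k) := lt_max_of_lt_left one_pos
    positivity
  refine ⟨C₁ * 4 * flagConst (n * 3) ^ 2, by positivity, fun Ω _ _ _ X hX S hS => ?_⟩
  have data : ∀ K : IntermediateField k Ω, K ∈ S → _ := fun K hK =>
    exists_cubic_data (k := k) (L := K) (hS K hK).1
  choose! s t hst hD Q hQ using data
  have := card_le_of_scales S s t hst hn1 (C := C₁) (Y := flagConst (n * 3) * √X) hC₁0.le
    (fun K hK => (hD K hK).trans (by
      have := (hS K hK).2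
      gcongr)) (fun a b => ?_)
  · refine this.trans_eq ?_
    rw [mul_pow, Real.sq_sqrt hX]
    ring
  · refine card_cubic_scale _ Q (by positivity) a b fun K hK => ?_
    obtain ⟨hKS, rfl, rfl⟩ := Finset.mem_filter.mp hK
    exact ⟨hst K hKS, hQ K hKS⟩

end cubicCount

section quadraticCount
open NumberField Module

variable {k L : Type*} [Field k] [NumberField k] [Field L] [NumberField L] [Algebra k L]

lemma linearIndependent_one_single {α : L} (hα : α ∉ Submodule.span k {(1 : L)}) :
    LinearIndependent k ![1, α] := by
  rw [LinearIndependent.pair_iff]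
  intro s t h
  have ht : t = 0 := by
    by_contra ht
    apply hα
    rw [Submodule.mem_span_singleton]
    refine ⟨-(s / t), ?_⟩
    have : t⁻¹ • (s • (1 : L) + t • α) = 0 := by rw [h, smul_zero]
    rw [smul_add, smul_smul, smul_smul, inv_mul_cancel₀ ht, one_smul] at this
    rw [neg_smul, div_eq_inv_mul]
    linear_combination -this
  rw [ht, zero_smul, add_zero] at h
  exact ⟨by simpa using h, ht⟩

lemma exists_quadratic_generator (h2 : finrank k L = 2) : ∃ α : 𝓞 L,
    (α : L) ∉ Submodule.span k {(1 : L)} ∧ 1 ≤ house (α : L) ∧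
    house (α : L) ^ finrank ℚ k ≤ flagConst (finrank ℚ k * 2) * √|(discr L : ℝ)| := by
  have : IsScalarTower ℚ k L := IsScalarTower.of_algebraMap_eq' (Subsingleton.elim _ _)
  have hfin : FiniteDimensional k L := FiniteDimensional.of_finrank_pos (by omega)
  have hrank : ∀ (V : Submodule k L), finrank ℚ (V.restrictScalars ℚ) = finrank ℚ k * finrank k V :=
    fun V => (finrank_mul_finrank ℚ k V).symm
  set U := Submodule.span k {(1 : L)} with hU
  have hUr : finrank k U ≤ 1 := by
    have := finrank_span_le_card (R := k) ({(1 : L)} : Set L)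
    simpa using this
  have hUtop : U.restrictScalars ℚ ≠ ⊤ := by
    intro h
    rw [Submodule.restrictScalars_eq_top_iff] at h
    rw [h, finrank_top] at hUr
    omega
  obtain ⟨α, hα, hαmin⟩ := exists_min_house (U.restrictScalars ℚ) hUtop
  have hα1 : 1 ≤ house (α : L) := by
    refine one_le_house_of_isIntegral α.2 fun h => hα ?_
    rw [show (α : L) = 0 from h]
    exact zero_mem _
  refine ⟨α, hα, hα1, ?_⟩
  have hN : finrank ℚ L = finrank ℚ k * 2 := by rw [← h2, finrank_mul_finrank]
  have hu : finrank ℚ (U.restrictScalars ℚ) ≤ finrank ℚ k := by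
    rw [hrank]; exact (Nat.mul_le_mul_left _ hUr).trans_eq (mul_one _)
  have key := flag_bound L (U.restrictScalars ℚ) (U.restrictScalars ℚ) le_rfl hu hu hα1 le_rfl
    hαmin hαmin
  rwa [hN, show finrank ℚ k * 2 - finrank ℚ k = finrank ℚ k by omega, div_self (by linarith),
    one_pow, mul_one] at key

/-- Constant in `exists_quadratic_discriminant`. -/
def quadraticConst (k : Type*) [Field k] [NumberField k] : ℝ :=
  (⌊coordConst k 2 (flagConst (finrank ℚ k * 2))⌋₊.factorial : ℝ) ^ 2 *
    ((finrank ℚ k * coordConst k 2 (flagConst (finrank ℚ k * 2)) * basisHouse k) ^ 2 +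
      4 * (finrank ℚ k * coordConst k 2 (flagConst (finrank ℚ k * 2)) * basisHouse k))

lemma exists_quadratic_discriminant (h2 : finrank k L = 2) : ∃ l : ℝ, 1 ≤ l ∧
    l ^ finrank ℚ k ≤ flagConst (finrank ℚ k * 2) * √|(discr L : ℝ)| ∧
    ∃ d : 𝓞 k, house (d : k) ≤ quadraticConst k * l ^ 2 ∧
      ∃ y : L, y ^ 2 = algebraMap k L d ∧ IntermediateField.adjoin k {y} = ⊤ := by
  obtain ⟨α, hα, hα1, hD⟩ := exists_quadratic_generator (k := k) h2
  refine ⟨house (α : L), hα1, hD, ?_⟩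
  obtain ⟨x, hx, h⟩ := exists_coordinates h2 (C₁ := flagConst (finrank ℚ k * 2))
    (![1, α] : Fin 2 → 𝓞 L) (by
      convert linearIndependent_one_single hα using 1
      ext i
      fin_cases i <;> simp) ![1, house (α : L)]
    (by
      intro j
      fin_cases j
      · simp
      · simpa using hα1)
    (by
      intro j
      fin_cases j
      · simpa using (house_intCast (K := L) 1).le
      · simp)
    (by simpa using hD) (α ^ 2)
  choose h₁ h₂ using h
  choose z hz using h₁
  have h₃ := h₂ 0
  have h₄ := h₂ 1
  rw [Fin.sum_univ_two] at hx
  simp only [Matrix.cons_val_zero, Matrix.cons_val_one, map_one, mul_one] at h₃ h₄ hx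
  rw [quadraticConst]
  set N := ⌊coordConst k 2 (flagConst (finrank ℚ k * 2))⌋₊.factorial with hN
  have hN0 : (N : k) ≠ 0 := by exact_mod_cast Nat.factorial_ne_zero _
  clear_value N
  set c := (finrank ℚ k * coordConst k 2 (flagConst (finrank ℚ k * 2)) * basisHouse k) with hc
  have hc0 : 0 ≤ c := by
    have := flagConst_pos (finrank ℚ k * 2)
    have := one_le_basisHouse k
    rw [hc, coordConst]
    positivity
  clear_value c
  set l := house (α : L) with hl
  have hsq : house ((α ^ 2 : 𝓞 L) : L) ≤ l ^ 2 := by rw [val_pow]; exact house_pow_le _ _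
  clear_value l
  have hu : house (x 0) ≤ c * l ^ 2 := by
    refine h₃.trans ?_
    rw [div_one]
    gcongr
  have hv : house (x 1) ≤ c * l := by
    refine h₄.trans ?_
    rw [div_le_iff₀ (by linarith), mul_assoc, ← pow_two]
    gcongr
  rw [val_pow] at hx
  have hd : ((z 1 ^ 2 + ((4 * N : ℕ) : 𝓞 k) * z 0 : 𝓞 k) : k) =
      (N ^ 2 : ℕ) * (x 1 ^ 2 + (4 : ℕ) * x 0) := by
    have : ((z 1 ^ 2 + ((4 * N : ℕ) : 𝓞 k) * z 0 : 𝓞 k) : k) =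
      (z 1 : k) ^ 2 + (4 * N : ℕ) * (z 0 : k) := rfl
    rw [this, hz, hz]
    push_cast
    ring
  refine ⟨z 1 ^ 2 + ((4 * N : ℕ) : 𝓞 k) * z 0, ?_,
    algebraMap k L N * (2 * α - algebraMap k L (x 1)), ?_, ?_⟩
  · rw [hd, house_nat_mul]
    have h5 := house_add_le (x 1 ^ 2) ((4 : ℕ) * x 0)
    have h6 := house_pow_le (x 1) 2
    rw [house_nat_mul] at h5
    have h7 : house (x 1) ^ 2 ≤ (c * l) ^ 2 := pow_le_pow_left₀ (house_nonneg _) hv 2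
    rw [mul_assoc]
    push_cast at h5 ⊢
    gcongr
    linarith
  · rw [hd]
    simp only [map_mul, map_add, map_pow, map_natCast]
    push_cast
    linear_combination 4 * (N : L) ^ 2 * hx
  · refine adjoin_simple_eq_top_of_prime (by rw [h2]; exact Nat.prime_two) fun h => hα ?_
    obtain ⟨e, he⟩ := Submodule.mem_span_singleton.mp h
    refine Submodule.mem_span_singleton.mpr ⟨(e / N + x 1) / 2, ?_⟩
    rw [Algebra.smul_def, mul_one] at he ⊢
    have hN' : (N : L) ≠ 0 := by
      have := (map_ne_zero (algebraMap k L)).mpr hN0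
      rwa [map_natCast] at this
    rw [map_div₀, map_add, map_div₀, he, map_natCast, map_ofNat]
    field_simp
    ring

/-- There are `O(X)` quadratic subfields of discriminant at most `X`, uniformly in the ambient
field. -/
theorem exists_card_quadratic_le (k : Type*) [Field k] [NumberField k] : ∃ C : ℝ, 0 < C ∧
    ∀ (Ω : Type*) [Field Ω] [NumberField Ω] [Algebra k Ω] (X : ℝ), 0 ≤ X →
      ∀ S : Finset (IntermediateField k Ω),
        (∀ K ∈ S, finrank k K = 2 ∧ |(discr K : ℝ)| ≤ X) → (S.card : ℝ) ≤ C * X := by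
  set n := finrank ℚ k with hn
  have hF := flagConst_pos (n * 2)
  have hc1 := one_le_countConst k
  set A := max 1 (quadraticConst k) with hA
  have hA1 : 1 ≤ A := le_max_left _ _
  refine ⟨2 * countConst k * A ^ n * flagConst (n * 2) ^ 2, by positivity,
    fun Ω _ _ _ X hX S hS => ?_⟩
  rcases S.eq_empty_or_nonempty with rfl | hne
  · simp only [Finset.card_empty, Nat.cast_zero]
    positivity
  have data : ∀ K : IntermediateField k Ω, K ∈ S → _ := fun K hK =>
    exists_quadratic_discriminant (k := k) (L := K) (hS K hK).1
  choose! l hl hlD d hd hy using data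
  obtain ⟨K₀, hK₀, hmax⟩ := S.exists_max_image l hne
  have hT := card_le_of_house_le k (B := A * l K₀ ^ 2)
    (one_le_mul_of_one_le_of_one_le hA1 (one_le_pow₀ (hl K₀ hK₀))) (S.image d) (by
      intro x hx
      obtain ⟨K, hK, rfl⟩ := Finset.mem_image.mp hx
      have := hl K hK
      exact (hd K hK).trans (mul_le_mul (le_max_right _ _)
        (pow_le_pow_left₀ (by linarith) (hmax K hK) 2) (by positivity) (by linarith)))
  have hfib : S.card ≤ 2 * (S.image d).card := by
    refine Finset.card_le_mul_card_image _ _ fun e he => ?_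
    have hdeg : (Polynomial.X ^ 2 - Polynomial.C (algebraMap k Ω e)).natDegree = 2 :=
      Polynomial.natDegree_X_pow_sub_C
    rw [← hdeg]
    refine card_le_of_isRoot _ (fun h => by simp [h] at hdeg) fun K hK => ?_
    obtain ⟨hKS, rfl⟩ := Finset.mem_filter.mp hK
    obtain ⟨y, hy₁, hy₂⟩ := hy K hKS
    refine ⟨y, ?_, IntermediateField.adjoin_coe_eq hy₂⟩
    have := congrArg (algebraMap K Ω) hy₁
    rw [map_pow, ← IsScalarTower.algebraMap_apply k K Ω] at this
    simp only [Polynomial.IsRoot, Polynomial.eval_sub, Polynomial.eval_pow, Polynomial.eval_X,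
      Polynomial.eval_C, sub_eq_zero]
    exact this
  have hY : (l K₀ ^ n) ^ 2 ≤ flagConst (n * 2) ^ 2 * X := by
    have h1 := hl K₀ hK₀
    have h2 := (hS K₀ hK₀).2
    calc (l K₀ ^ n) ^ 2 ≤ (flagConst (n * 2) * √X) ^ 2 := by
          gcongr
          exact (hlD K₀ hK₀).trans (by gcongr)
      _ = _ := by rw [mul_pow, Real.sq_sqrt hX]
  calc (S.card : ℝ) ≤ 2 * (S.image d).card := by exact_mod_cast hfib
    _ ≤ 2 * (countConst k * (A * l K₀ ^ 2) ^ n) := by gcongr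
    _ = 2 * countConst k * A ^ n * (l K₀ ^ n) ^ 2 := by ring
    _ ≤ 2 * countConst k * A ^ n * (flagConst (n * 2) ^ 2 * X) := by gcongr
    _ = _ := by ring

end quadraticCount

section tame

variable {S G : Type*} [CommRing S] [IsDedekindDomain S] [Group G] [Finite G]
  [MulSemiringAction G S] {P : Ideal S}

lemma smul_mem_pow_of_mem_inertia {σ : G} (hσ : σ ∈ P.inertia G) {i : ℕ} {y : S}
    (hy : y ∈ P ^ i) : σ • y ∈ P ^ i := by
  have h1 : ∀ x ∈ P, σ • x ∈ P := fun x hx => by simpa using P.add_mem (hσ x) hx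
  have h2 : P ≤ P.comap (MulSemiringAction.toRingHom G S σ) := h1
  have h3 := (Ideal.pow_right_mono h2 i).trans (Ideal.le_comap_pow _ i)
  exact h3 hy

/-- An inertia element acting trivially on `P / P²` acts trivially on `Pⁱ / Pⁱ⁺¹`. -/
lemma smul_sub_mem_pow_succ {σ : G} (hσ : σ ∈ P.inertia G) (h : ∀ y ∈ P, σ • y - y ∈ P ^ 2)
    (i : ℕ) : ∀ y ∈ P ^ i, σ • y - y ∈ P ^ (i + 1) := by
  induction i with
  | zero => intro y _; simpa using hσ y
  | succ i ih =>
    intro y hy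
    rw [pow_succ] at hy
    refine Submodule.mul_induction_on hy (fun a ha b hb => ?_) fun a b ha hb => ?_
    · have e : σ • (a • b) - a • b = (σ • a) * (σ • b - b) + (σ • a - a) * b := by
        rw [smul_eq_mul, smul_mul']; ring
      rw [← smul_eq_mul, e]
      refine Ideal.add_mem _ ?_ ?_
      · have := Ideal.mul_mem_mul (smul_mem_pow_of_mem_inertia hσ ha) (h b hb)
        rwa [← pow_add] at this
      · have := Ideal.mul_mem_mul (ih a ha) hb
        rwa [← pow_succ] at this
    · rw [smul_add, add_sub_add_comm]
      exact Ideal.add_mem _ ha hb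

variable [P.IsPrime]

/-- Inertia modulo wild inertia is cyclic. -/
lemma exists_inertia_generator (hP0 : P ≠ ⊥) (hP1 : P ≠ ⊤) [Finite (S ⧸ P)] :
    ∃ g ∈ P.inertia G, ∀ σ ∈ P.inertia G, ∃ j : ℤ, ∀ y ∈ P, (σ * (g ^ j)⁻¹) • y - y ∈ P ^ 2 := by
  obtain ⟨π, hπ, hπ2⟩ := P.exists_mem_pow_notMem_pow_succ hP0 hP1 1
  rw [pow_one] at hπ
  norm_num at hπ2
  have hex : ∀ y ∈ P, ∃ c : S, y - π * c ∈ P ^ 2 := by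
    intro y hy
    obtain ⟨c, e, he, h⟩ := Ideal.exists_mul_add_mem_pow_succ (P := P) hP0 (i := 1) π y
      (by simpa) (by simpa) (by simpa)
    exact ⟨c, by rw [← h]; simpa using he⟩
  have huniq : ∀ c, π * c ∈ P ^ 2 → c ∈ P := by
    intro c hc
    rw [mul_comm] at hc
    exact (Ideal.IsPrime.mul_mem_pow P hc).resolve_right hπ2
  have hσP : ∀ σ : P.inertia G, (σ : G) • π ∈ P := fun σ => by
    simpa using smul_mem_pow_of_mem_inertia σ.2 (i := 1) (y := π) (by simpa)
  choose c hc using fun σ : P.inertia G => hex _ (hσP σ)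
  have hmk : ∀ (σ : P.inertia G) (d : S), (σ : G) • π - π * d ∈ P ^ 2 →
      Ideal.Quotient.mk P (c σ) = Ideal.Quotient.mk P d := by
    intro σ d hd
    rw [Ideal.Quotient.eq]
    apply huniq
    have := Ideal.sub_mem _ hd (hc σ)
    convert this using 1
    ring
  let f : P.inertia G →* S ⧸ P :=
    { toFun := fun σ => Ideal.Quotient.mk P (c σ)
      map_one' := by
        rw [hmk 1 1 (by simp), map_one]
      map_mul' := by
        intro σ τ
        rw [← map_mul]
        apply hmk
        have h1 := smul_mem_pow_of_mem_inertia σ.2 (hc τ)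
        have h2 := Ideal.mul_mem_right (c τ) _ (hc σ)
        have h3 : ((σ : G) • π) * ((σ : G) • c τ - c τ) ∈ P ^ 2 := by
          rw [pow_two]
          exact Ideal.mul_mem_mul (hσP σ) (σ.2 (c τ))
        convert Ideal.add_mem _ (Ideal.add_mem _ h1 h2) h3 using 1
        rw [Subgroup.coe_mul, mul_smul, smul_sub, smul_mul']
        ring }
  have : IsDomain (S ⧸ P) := Ideal.Quotient.isDomain P
  obtain ⟨⟨_, g, rfl⟩, hg⟩ := IsCyclic.exists_generator (α := f.toHomUnits.range)
  refine ⟨g, g.2, fun σ hσ => ?_⟩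
  obtain ⟨j, hj⟩ := Subgroup.mem_zpowers_iff.mp (hg ⟨_, ⟨σ, hσ⟩, rfl⟩)
  refine ⟨j, fun y hy => ?_⟩
  have hj' : f.toHomUnits g ^ j = f.toHomUnits ⟨σ, hσ⟩ := congrArg Subtype.val hj
  set τ : P.inertia G := ⟨σ, hσ⟩ * (g ^ j)⁻¹ with hτ
  have hτ1 : f τ = 1 := by
    have : f.toHomUnits τ = 1 := by
      rw [hτ, map_mul, map_inv, map_zpow, hj', mul_inv_cancel]
    rw [← MonoidHom.coe_toHomUnits, this, Units.val_one]
  have hτπ : (τ : G) • π - π ∈ P ^ 2 := by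
    have h1 : c τ - 1 ∈ P := by
      rw [← Ideal.Quotient.eq, map_one]
      exact hτ1
    have h2 : π * (c τ - 1) ∈ P ^ 2 := by
      rw [pow_two]; exact Ideal.mul_mem_mul hπ h1
    convert Ideal.add_mem _ (hc τ) h2 using 1
    ring
  have e : σ * ((g : G) ^ j)⁻¹ = τ := by simp [hτ]
  rw [e]
  obtain ⟨d, hd⟩ := hex y hy
  have h1 := smul_mem_pow_of_mem_inertia τ.2 hd
  have h2 := Ideal.mul_mem_right d _ hτπ
  have h3 : ((τ : G) • π) * ((τ : G) • d - d) ∈ P ^ 2 := by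
    rw [pow_two]
    exact Ideal.mul_mem_mul (hσP τ) (τ.2 d)
  convert Ideal.sub_mem _ (Ideal.add_mem _ (Ideal.add_mem _ h1 h2) h3) hd using 1
  rw [smul_sub, smul_mul']
  ring

variable [FaithfulSMul G S]

/-- Wild inertia has no elements of order prime to the residue characteristic. -/
lemma eq_one_of_wild (hP : P ≠ ⊤) {σ : G} (hσ : σ ∈ P.inertia G)
    (h : ∀ y ∈ P, σ • y - y ∈ P ^ 2) {q : ℕ} (hq : (q : S) ∉ P) (hσq : σ ^ q = 1) : σ = 1 := by
  have key : ∀ i, ∀ x : S, σ • x - x ∈ P ^ (i + 1) := by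
    intro i
    induction i with
    | zero => intro x; simpa using hσ x
    | succ i ih =>
      intro x
      have h1 : ∀ j : ℕ, σ ^ j • x - (x + j * (σ • x - x)) ∈ P ^ (i + 2) := by
        intro j
        induction j with
        | zero => simp
        | succ j ihj =>
          have h2 := smul_mem_pow_of_mem_inertia hσ ihj
          have h3 := smul_sub_mem_pow_succ hσ h (i + 1) _ (ih x)
          have h4 := Ideal.add_mem _ h2 (Ideal.mul_mem_left _ (j : S) h3)
          convert h4 using 1
          have : σ • (j : S) = j := by
            have := map_natCast (MulSemiringAction.toRingHom G S σ) j
            exact this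
          rw [pow_succ', mul_smul, smul_sub, smul_add, smul_mul', this]
          push_cast
          ring
      have h2 := h1 q
      rw [hσq, one_smul, sub_add_cancel_left, neg_mem_iff] at h2
      exact (Ideal.IsPrime.mul_mem_pow P h2).resolve_left hq
  refine FaithfulSMul.eq_of_smul_eq_smul (α := S) fun x => ?_
  rw [one_smul, ← sub_eq_zero]
  have hb : σ • x - x ∈ ⨅ i : ℕ, P ^ i := by
    rw [Ideal.mem_iInf]
    intro i
    exact Ideal.pow_le_pow_right (Nat.le_succ i) (key i x)
  rwa [Ideal.iInf_pow_eq_bot_of_isDomain _ hP, Ideal.mem_bot] at hb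

/-- A single inertia element describes the action of inertia on all sets with at most three
elements, at primes not above `6`. -/
theorem exists_tame_generator (hP0 : P ≠ ⊥) [Finite (S ⧸ P)] (h2 : (2 : S) ∉ P)
    (h3 : (3 : S) ∉ P) :
    ∃ g ∈ P.inertia G, ∀ σ ∈ P.inertia G, ∃ j : ℤ, ∀ (α : Type*) [Fintype α] [DecidableEq α],
      Fintype.card α ≤ 3 → ∀ ψ : G →* Equiv.Perm α, ψ σ = ψ g ^ j := by
  have hP1 : P ≠ ⊤ := Ideal.IsPrime.ne_top inferInstance
  obtain ⟨g, hg, h⟩ := exists_inertia_generator (G := G) hP0 hP1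
  refine ⟨g, hg, fun σ hσ => ?_⟩
  obtain ⟨j, hj⟩ := h σ hσ
  refine ⟨j, fun α _ _ hα ψ => ?_⟩
  set τ := σ * (g ^ j)⁻¹ with hτ
  have hτI : τ ∈ P.inertia G := mul_mem hσ (inv_mem (zpow_mem hg j))
  have hcop : ∀ q : ℕ, q.Prime → (q : S) ∉ P → ¬ q ∣ orderOf τ := by
    rintro q hq hqP ⟨m, hm⟩
    have hm0 : m ≠ 0 := by
      rintro rfl
      exact (orderOf_pos τ).ne' (by simpa using hm)
    have h1 : τ ^ m = 1 := by
      refine eq_one_of_wild hP1 (pow_mem hτI m) ?_ hqP (q := q) ?_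
      · intro y hy
        have : ∀ m : ℕ, τ ^ m • y - y ∈ P ^ 2 := by
          intro m
          induction m with
          | zero => simp
          | succ m ih =>
            have e : τ ^ (m + 1) • y - y = τ • (τ ^ m • y - y) + (τ • y - y) := by
              rw [pow_succ', mul_smul, smul_sub]; ring
            rw [e]
            exact Ideal.add_mem _ (smul_mem_pow_of_mem_inertia hτI ih) (hj y hy)
        exact this m
      · rw [← pow_mul, mul_comm, ← hm, pow_orderOf_eq_one]
    have h4 := Nat.le_of_dvd (Nat.pos_of_ne_zero hm0) (orderOf_dvd_of_pow_eq_one h1)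
    have := hq.two_le
    nlinarith [Nat.pos_of_ne_zero hm0]
  have h6 : (orderOf τ).Coprime 6 := by
    rw [show 6 = 2 * 3 from rfl]
    exact Nat.Coprime.mul_right
      (Nat.Coprime.symm ((Nat.Prime.coprime_iff_not_dvd Nat.prime_two).mpr
        (hcop 2 Nat.prime_two (by exact_mod_cast h2))))
      (Nat.Coprime.symm ((Nat.Prime.coprime_iff_not_dvd Nat.prime_three).mpr
        (hcop 3 Nat.prime_three (by exact_mod_cast h3))))
  have h7 : orderOf (ψ τ) ∣ 6 := by
    have h8 : Fintype.card (Equiv.Perm α) ∣ 6 := by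
      rw [Fintype.card_perm]
      exact (Nat.factorial_dvd_factorial hα)
    exact orderOf_dvd_card.trans h8
  have h9 : ψ τ = 1 := by
    rw [← orderOf_eq_one_iff]
    exact Nat.eq_one_of_dvd_coprimes h6 (orderOf_map_dvd ψ τ) h7
  rw [hτ, map_mul, map_inv, map_zpow, mul_inv_eq_one] at h9
  exact h9

end tame

section inertiaIndex

open NumberField Module Pointwise

variable {k L : Type*} [Field k] [NumberField k] [Field L] [NumberField L] [Algebra k L]
  [IsGalois k L]

instance faithfulSMul_galois_ringOfIntegers : FaithfulSMul (L ≃ₐ[k] L) (𝓞 L) :=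
  (inferInstance : IsGaloisGroup (L ≃ₐ[k] L) (𝓞 k) (𝓞 L)).faithful

instance isGaloisGroup_fixingSubgroup (E : IntermediateField k L) :
    IsGaloisGroup E.fixingSubgroup E L :=
  .of_mulEquiv_algEquiv (IntermediateField.fixingSubgroupEquiv E) fun _ _ => rfl

instance isGaloisGroup_fixingSubgroup_ringOfIntegers (E : IntermediateField k L) :
    IsGaloisGroup E.fixingSubgroup (𝓞 E) (𝓞 L) :=
  instIsGaloisGroupRingOfIntegersOfNumberField E L E.fixingSubgroup

lemma ramificationIdx_eq_relIndex (E : IntermediateField k L) (Q : Ideal (𝓞 L)) [Q.IsPrime] :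
    (Q.under (𝓞 E)).ramificationIdx (𝓞 k) =
      E.fixingSubgroup.relIndex (Q.inertia (L ≃ₐ[k] L)) := by
  have h : (Q.under (𝓞 E)).ramificationIdx (𝓞 k) * Nat.card (Q.inertia E.fixingSubgroup) =
      Nat.card (Q.inertia (L ≃ₐ[k] L)) := by
    rw [Ideal.card_inertia_eq_ramificationIdxIn (Q.under (𝓞 E)) Q,
      Ideal.card_inertia_eq_ramificationIdxIn (Q.under (𝓞 k)) Q,
      Ideal.ramificationIdxIn_eq_ramificationIdx (Q.under (𝓞 E)) Q E.fixingSubgroup,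
      Ideal.ramificationIdxIn_eq_ramificationIdx (Q.under (𝓞 k)) Q (L ≃ₐ[k] L),
      ← Ideal.ramificationIdx_tower]
  have h2 : Nat.card (Q.inertia E.fixingSubgroup) =
      Nat.card (E.fixingSubgroup.subgroupOf (Q.inertia (L ≃ₐ[k] L))) :=
    Nat.card_congr ⟨fun x => ⟨⟨x.1.1, x.2⟩, x.1.2⟩, fun x => ⟨⟨x.1.1, x.2⟩, x.1.2⟩,
      fun _ => rfl, fun _ => rfl⟩
  have h3 := (E.fixingSubgroup.subgroupOf (Q.inertia (L ≃ₐ[k] L))).card_mul_index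
  rw [h2, ← h3, mul_comm] at h
  exact Nat.eq_of_mul_eq_mul_left Nat.card_pos h

lemma mem_inertia_smul {S G : Type*} [CommRing S] [Group G] [MulSemiringAction G S] (P : Ideal S)
    (x g : G) : g ∈ (x • P).inertia G ↔ x⁻¹ * g * x ∈ P.inertia G := by
  have key : ∀ y : S, g • (x • y) - x • y ∈ x • P ↔ (x⁻¹ * g * x) • y - y ∈ P := by
    intro y
    rw [Ideal.mem_pointwise_smul_iff_inv_smul_mem, smul_sub, inv_smul_smul, mul_smul, mul_smul]
  constructor
  · exact fun h y => (key y).1 (h (x • y))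
  · intro h y
    have := (key (x⁻¹ • y)).2 (h (x⁻¹ • y))
    rwa [smul_inv_smul] at this

lemma relIndex_eq_of_forall_exists {G : Type*} [Group G] {H Z I : Subgroup G} (hZ : Z ≤ I)
    (h : ∀ i ∈ I, ∃ z ∈ Z, z⁻¹ * i ∈ H) : H.relIndex I = H.relIndex Z := by
  refine (Nat.card_congr (Equiv.ofBijective (Subgroup.quotientSubgroupOfEmbeddingOfLE H hZ)
    ⟨(Subgroup.quotientSubgroupOfEmbeddingOfLE H hZ).injective, ?_⟩)).symm
  intro q
  induction q using Quotient.inductionOn' with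
  | h i =>
    obtain ⟨z, hz, hzi⟩ := h i i.2
    refine ⟨QuotientGroup.mk ⟨z, hz⟩, ?_⟩
    rw [Subgroup.quotientSubgroupOfEmbeddingOfLE_apply_mk]
    exact QuotientGroup.eq.2 hzi

universe u

/-- Given a prime `p` of `k` not above `6`, there is an element `g` of the Galois group which
controls ramification at `p` of all subextensions of degree at most three. -/
lemma exists_ramification_generator {k : Type*} {L : Type u} [Field k] [NumberField k] [Field L]
    [NumberField L] [Algebra k L] [IsGalois k L] (p : Ideal (𝓞 k)) [p.IsPrime] (hp0 : p ≠ ⊥)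
    (h2 : (2 : 𝓞 k) ∉ p) (h3 : (3 : 𝓞 k) ∉ p) :
    ∃ g : L ≃ₐ[k] L, ∀ E : IntermediateField k L, finrank k E ≤ 3 →
      (∀ P : Ideal (𝓞 E), P.IsPrime → P.under (𝓞 k) = p → ∃ x : L ≃ₐ[k] L,
        P.ramificationIdx (𝓞 k) = E.fixingSubgroup.relIndex (Subgroup.zpowers (x⁻¹ * g * x))) ∧
      (∀ x : L ≃ₐ[k] L, ∃ P : Ideal (𝓞 E), P.IsPrime ∧ P.under (𝓞 k) = p ∧
        P.ramificationIdx (𝓞 k) = E.fixingSubgroup.relIndex (Subgroup.zpowers (x⁻¹ * g * x))) := by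
  obtain ⟨Q, hQ, hQp⟩ : ∃ Q : Ideal (𝓞 L), Q.IsPrime ∧ Q.LiesOver p := by
    obtain ⟨Q, hQ⟩ := Ideal.nonempty_primesOver (S := 𝓞 L) p
    exact ⟨Q, hQ.1, hQ.2⟩
  have hover : ∀ n : ℕ, (n : 𝓞 k) ∉ p → (n : 𝓞 L) ∉ Q := by
    intro n hn h
    apply hn
    rw [hQp.over, Ideal.mem_comap]
    simpa using h
  have hQ0 : Q ≠ ⊥ := Ideal.ne_bot_of_liesOver_of_ne_bot hp0 Q
  have : Finite (𝓞 L ⧸ Q) := Ideal.finiteQuotientOfFreeOfNeBot Q hQ0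
  obtain ⟨g, hg, H⟩ :=
    exists_tame_generator.{_, _, u} (G := L ≃ₐ[k] L) hQ0 (by exact_mod_cast hover 2 h2)
    (by exact_mod_cast hover 3 h3)
  refine ⟨g, fun E hE => ?_⟩
  have key : ∀ x : L ≃ₐ[k] L, ((x⁻¹ • Q).under (𝓞 E)).ramificationIdx (𝓞 k) =
      E.fixingSubgroup.relIndex (Subgroup.zpowers (x⁻¹ * g * x)) := by
    intro x
    rw [ramificationIdx_eq_relIndex]
    refine relIndex_eq_of_forall_exists ?_ ?_
    · rw [Subgroup.zpowers_le, mem_inertia_smul]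
      simpa [mul_assoc] using hg
    · intro i hi
      rw [mem_inertia_smul] at hi
      obtain ⟨j, hj⟩ := H _ hi
      have : Fintype ((L ≃ₐ[k] L) ⧸ E.fixingSubgroup) := Fintype.ofFinite _
      have hcard : Fintype.card ((L ≃ₐ[k] L) ⧸ E.fixingSubgroup) ≤ 3 := by
        rw [← Nat.card_eq_fintype_card]
        exact (IntermediateField.finrank_eq_fixingSubgroup_index L E).symm.trans_le hE
      have h1 := hj _ hcard (MulAction.toPermHom _ _)
      refine ⟨(x⁻¹ * g * x) ^ j, ⟨j, rfl⟩, ?_⟩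
      have h2 := congrArg (fun f : Equiv.Perm ((L ≃ₐ[k] L) ⧸ E.fixingSubgroup) =>
        f (QuotientGroup.mk x)) h1
      simp only [← map_zpow] at h2
      have h3 : (QuotientGroup.mk (x⁻¹⁻¹ * i * x⁻¹ * x) : (L ≃ₐ[k] L) ⧸ E.fixingSubgroup) =
        QuotientGroup.mk (g ^ j * x) := h2
      rw [QuotientGroup.eq] at h3
      have h4 := E.fixingSubgroup.inv_mem h3
      have h5 : (x⁻¹ * g * x) ^ j = x⁻¹ * g ^ j * x := by
        simpa using (conj_zpow (a := x⁻¹) (b := g) (i := j))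
      rw [h5]
      simpa [mul_assoc] using h4
  refine ⟨fun P hP hPp => ?_, fun x => ⟨(x⁻¹ • Q).under (𝓞 E), ?_, ?_, key x⟩⟩
  · obtain ⟨Q', hQ'⟩ := Ideal.nonempty_primesOver (S := 𝓞 L) P
    have := hQ'.1
    have := hQ'.2
    have : Q'.LiesOver p := ⟨by rw [← hPp, Q'.over_def P, Ideal.under_under]⟩
    obtain ⟨x, hx⟩ := Ideal.exists_smul_eq_of_isGaloisGroup p Q Q' (L ≃ₐ[k] L)
    refine ⟨x⁻¹, ?_⟩
    rw [← key, inv_inv, hx, ← Q'.over_def P]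
  · infer_instance
  · rw [Ideal.under_under]
    exact (Ideal.LiesOver.over (P := x⁻¹ • Q) (p := p)).symm

end inertiaIndex

section traceIdentity

open NumberField Module

lemma Matrix.six_smul_cube_fin_three {R : Type*} [CommRing R] (M : Matrix (Fin 3) (Fin 3) R) :
    (6 : R) • M ^ 3 = (6 * M.trace) • M ^ 2 - (3 * (M.trace ^ 2 - (M ^ 2).trace)) • M +
      (M.trace ^ 3 - 3 * M.trace * (M ^ 2).trace + 2 * (M ^ 3).trace) • 1 := by
  ext i j
  fin_cases i <;> fin_cases j <;>
    simp [pow_succ, Matrix.mul_apply, Fin.sum_univ_three, Matrix.trace] <;> ring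

lemma Matrix.two_smul_sq_fin_two {R : Type*} [CommRing R] (M : Matrix (Fin 2) (Fin 2) R) :
    (2 : R) • M ^ 2 = (2 * M.trace) • M - (M.trace ^ 2 - (M ^ 2).trace) • 1 := by
  ext i j
  fin_cases i <;> fin_cases j <;>
    simp [pow_succ, Matrix.mul_apply, Fin.sum_univ_two, Matrix.trace] <;> ring

variable {F K : Type*} [Field F] [Field K] [Algebra F K]

lemma six_smul_cube_of_finrank_eq_three (h : finrank F K = 3) (x : K) :
    (6 : F) • x ^ 3 = (6 * Algebra.trace F K x) • x ^ 2 -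
      (3 * (Algebra.trace F K x ^ 2 - Algebra.trace F K (x ^ 2))) • x +
      (Algebra.trace F K x ^ 3 - 3 * Algebra.trace F K x * Algebra.trace F K (x ^ 2) +
        2 * Algebra.trace F K (x ^ 3)) • 1 := by
  have : FiniteDimensional F K := FiniteDimensional.of_finrank_pos (by omega)
  let b := finBasisOfFinrankEq F K h
  apply Algebra.leftMulMatrix_injective b
  simp only [map_add, map_sub, map_smul, map_pow, map_one, Algebra.trace_eq_matrix_trace b]
  exact Matrix.six_smul_cube_fin_three _

lemma two_smul_sq_of_finrank_eq_two (h : finrank F K = 2) (x : K) :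
    (2 : F) • x ^ 2 = (2 * Algebra.trace F K x) • x -
      (Algebra.trace F K x ^ 2 - Algebra.trace F K (x ^ 2)) • 1 := by
  have : FiniteDimensional F K := FiniteDimensional.of_finrank_pos (by omega)
  let b := finBasisOfFinrankEq F K h
  apply Algebra.leftMulMatrix_injective b
  simp only [map_sub, map_smul, map_pow, map_one, Algebra.trace_eq_matrix_trace b]
  exact Matrix.two_smul_sq_fin_two _

variable [NumberField F] [NumberField K]

/-- In degree two or three, if the traces of all powers of `x` lie in `I` then `6 xᵈ ∈ I 𝒪_K`. -/
lemma exists_six_mul_pow_mem_map (h : finrank F K = 2 ∨ finrank F K = 3) (I : Ideal (𝓞 F))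
    (x : 𝓞 K) (hx : ∀ i ≠ 0, Algebra.intTrace (𝓞 F) (𝓞 K) (x ^ i) ∈ I) :
    ∃ d : ℕ, 6 * x ^ d ∈ I.map (algebraMap (𝓞 F) (𝓞 K)) := by
  set t : ℕ → 𝓞 F := fun i => Algebra.intTrace (𝓞 F) (𝓞 K) (x ^ i) with ht
  have htr : ∀ i, Algebra.trace F K (algebraMap (𝓞 K) K x ^ i) = algebraMap (𝓞 F) F (t i) :=
    fun i => by
      rw [← map_pow]
      exact (Algebra.algebraMap_intTrace (A := 𝓞 F) (B := 𝓞 K) (K := F) (L := K) (x ^ i)).symm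
  have hcoe : ∀ a : 𝓞 F, algebraMap F K (algebraMap (𝓞 F) F a) =
      algebraMap (𝓞 K) K (algebraMap (𝓞 F) (𝓞 K) a) := fun a => rfl
  have hmem : ∀ i ≠ 0, algebraMap (𝓞 F) (𝓞 K) (t i) ∈ I.map (algebraMap (𝓞 F) (𝓞 K)) :=
    fun i hi => Ideal.mem_map_of_mem _ (hx i hi)
  have htr1 : Algebra.trace F K (algebraMap (𝓞 K) K x) = algebraMap (𝓞 F) F (t 1) := by
      simpa using htr 1
  rcases h with h | h
  · refine ⟨2, ?_⟩
    have h1 := two_smul_sq_of_finrank_eq_two h (algebraMap (𝓞 K) K x)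
    simp only [Algebra.smul_def, htr, htr1, map_sub, map_mul, map_pow, map_ofNat, hcoe] at h1
    have h2 : 6 * x ^ 2 = algebraMap (𝓞 F) (𝓞 K) (t 1) *
        (6 * x - 3 * algebraMap (𝓞 F) (𝓞 K) (t 1)) + algebraMap (𝓞 F) (𝓞 K) (t 2) * 3 := by
      apply RingOfIntegers.coe_injective
      simp only [map_add, map_sub, map_mul, map_pow, map_ofNat]
      linear_combination 3 * h1
    rw [h2]
    exact Ideal.add_mem _ (Ideal.mul_mem_right _ _ (hmem 1 one_ne_zero))
      (Ideal.mul_mem_right _ _ (hmem 2 two_ne_zero))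
  · refine ⟨3, ?_⟩
    have h1 := six_smul_cube_of_finrank_eq_three h (algebraMap (𝓞 K) K x)
    simp only [Algebra.smul_def, htr, htr1, map_sub, map_add, map_mul, map_pow, map_ofNat,
      hcoe] at h1
    have h2 : 6 * x ^ 3 = algebraMap (𝓞 F) (𝓞 K) (t 1) *
        (6 * x ^ 2 - 3 * algebraMap (𝓞 F) (𝓞 K) (t 1) * x + algebraMap (𝓞 F) (𝓞 K) (t 1) ^ 2
          - 3 * algebraMap (𝓞 F) (𝓞 K) (t 2)) + algebraMap (𝓞 F) (𝓞 K) (t 2) * (3 * x) +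
        algebraMap (𝓞 F) (𝓞 K) (t 3) * 2 := by
      apply RingOfIntegers.coe_injective
      simp only [map_add, map_sub, map_mul, map_pow, map_ofNat]
      linear_combination h1
    rw [h2]
    exact Ideal.add_mem _ (Ideal.add_mem _ (Ideal.mul_mem_right _ _ (hmem 1 one_ne_zero))
      (Ideal.mul_mem_right _ _ (hmem 2 two_ne_zero))) (Ideal.mul_mem_right _ _ (hmem 3 (by simp)))

/-- If `p` exactly divides `6` to the order `a`, then `P^(e (a+1))` does not contain `6`. -/
lemma not_mem_pow_of_span_eq {A B : Type*} [CommRing A] [CommRing B] [IsDedekindDomain B]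
    [Algebra A B] {n : ℕ} {p b : Ideal A} {P J : Ideal B} [hP : P.IsPrime] (hP0 : P ≠ ⊥)
    (hPp : P.under A = p) {a e : ℕ} (he : 0 < e) (h6 : Ideal.span {(n : A)} = p ^ a * b)
    (hb : ¬ b ≤ p) (hp : p.map (algebraMap A B) = P ^ e * J) (hJ : ¬ J ≤ P) :
    (n : B) ∉ P ^ (e * (a + 1)) := by
  intro h6P
  have h6B : Ideal.span {(n : B)} = P ^ (e * a) * (J ^ a * b.map (algebraMap A B)) := by
    have := congrArg (Ideal.map (algebraMap A B)) h6
    rw [Ideal.map_span, Ideal.map_mul, Ideal.map_pow, hp, Set.image_singleton, map_natCast] at this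
    rw [this]
    ring
  have h1 : P ^ (e * (a + 1)) ∣ P ^ (e * a) * (J ^ a * b.map (algebraMap A B)) := by
    rw [← h6B, Ideal.dvd_span_singleton]
    exact h6P
  rw [mul_add, pow_add, mul_one, mul_dvd_mul_iff_left (pow_ne_zero _ hP0)] at h1
  have h2 := Ideal.dvd_iff_le.1 ((dvd_pow_self P he.ne').trans h1)
  rcases hP.mul_le.1 h2 with h3 | h3
  · exact hJ (Ideal.IsPrime.le_of_pow_le h3)
  · exact hb (hPp ▸ Ideal.map_le_iff_le_comap.1 h3)

/-- An upper bound for the exponent of a prime in the different of a quadratic or cubic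
extension. -/
lemma not_pow_dvd_differentIdeal (h : finrank F K = 2 ∨ finrank F K = 3) {p b : Ideal (𝓞 F)}
    {P J : Ideal (𝓞 K)} [hP : P.IsPrime] (hP0 : P ≠ ⊥) (hPp : P.under (𝓞 F) = p) {a e : ℕ}
    (he : 0 < e) (h6 : Ideal.span {((6 : ℕ) : 𝓞 F)} = p ^ a * b) (hb : ¬ b ≤ p)
    (hp : p.map (algebraMap (𝓞 F) (𝓞 K)) = P ^ e * J) (hJ : ¬ J ≤ P) :
    ¬ P ^ (e * (a + 1)) ∣ differentIdeal (𝓞 F) (𝓞 K) := by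
  intro hdvd
  have hmap : P ^ (e * (a + 1)) * J ^ (a + 1) = (p ^ (a + 1)).map (algebraMap (𝓞 F) (𝓞 K)) := by
    rw [Ideal.map_pow, hp, mul_pow, pow_mul]
  have htr : ∀ y ∈ J ^ (a + 1), Algebra.intTrace (𝓞 F) (𝓞 K) y ∈ p ^ (a + 1) := by
    intro y hy
    by_contra hcon
    exact not_dvd_differentIdeal_of_intTrace_not_mem (𝓞 F) _ _ hmap y hy hcon hdvd
  have hJ' : ¬ J ^ (a + 1) ≤ P := fun h => hJ (hP.le_of_pow_le h)
  obtain ⟨x, hxJ, hxP⟩ := SetLike.not_le_iff_exists.1 hJ'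
  obtain ⟨d, hd⟩ := exists_six_mul_pow_mem_map h (p ^ (a + 1)) x fun i hi =>
    htr _ (Ideal.pow_mem_of_mem _ hxJ i (Nat.pos_of_ne_zero hi))
  rw [← hmap] at hd
  have h6P : ((6 : ℕ) : 𝓞 K) ∈ P ^ (e * (a + 1)) := by
    rw [← Nat.cast_ofNat (R := 𝓞 K) (n := 6)] at hd
    rcases Ideal.IsPrime.mem_pow_mul P (Ideal.mul_le_left hd) with h | h
    · exact h
    · exact absurd (hP.mem_of_pow_mem _ h) hxP
  exact not_mem_pow_of_span_eq hP0 hPp he h6 hb hp hJ h6P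

end traceIdentity

section discriminantBounds

open NumberField Module

variable {F K : Type*} [Field F] [Field K] [NumberField F] [NumberField K] [Algebra F K]

lemma exists_not_le_map_eq_pow_mul (p : Ideal (𝓞 F)) (hp0 : p ≠ ⊥) (P : Ideal (𝓞 K)) [P.IsPrime]
    (hPp : P.under (𝓞 F) = p) :
    ∃ J : Ideal (𝓞 K), ¬ J ≤ P ∧
      p.map (algebraMap (𝓞 F) (𝓞 K)) = P ^ P.ramificationIdx (𝓞 F) * J := by
  have : P.LiesOver p := ⟨hPp.symm⟩
  have hP0 : P ≠ ⊥ := by rintro rfl; exact hp0 (by rw [← hPp]; exact Ideal.under_bot _ _)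
  have : P.IsMaximal := Ideal.IsPrime.isMaximal ‹_› hP0
  have hmap : p.map (algebraMap (𝓞 F) (𝓞 K)) ≠ ⊥ := Ideal.map_ne_bot_of_ne_bot hp0
  obtain ⟨J, hJ, h⟩ := Ideal.eq_prime_pow_mul_coprime hmap P
  refine ⟨J, fun hle => ?_, ?_⟩
  · rw [sup_of_le_left hle] at hJ
    exact Ideal.IsPrime.ne_top ‹_› hJ
  · rwa [Ideal.IsDedekindDomain.ramificationIdx_eq_normalizedFactors_count p P hmap]

lemma absNorm_le_absNorm_of_under_eq (p : Ideal (𝓞 F)) (P : Ideal (𝓞 K)) [P.IsPrime]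
    (hPp : P.under (𝓞 F) = p) : Ideal.absNorm p ≤ Ideal.absNorm P := by
  have : P.LiesOver p := ⟨hPp.symm⟩
  rw [← Ideal.absNorm_pow_inertiaDeg p P]
  exact Nat.le_self_pow (Ideal.inertiaDeg_pos P (𝓞 F)).ne' _

variable (K) in
lemma prod_absNorm_pow_le_natAbs_discr (S : Finset (Ideal (𝓞 F))) (c : Ideal (𝓞 F) → ℕ)
    (hS : ∀ p ∈ S, p ≠ ⊥ ∧ ∃ P : Ideal (𝓞 K), P.IsPrime ∧ P.under (𝓞 F) = p ∧
      c p + 1 ≤ P.ramificationIdx (𝓞 F)) :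
    ∏ p ∈ S, Ideal.absNorm p ^ c p ≤ (discr K).natAbs := by
  choose! hp0 P hP hPp hc using hS
  have hdvd : ∏ p ∈ S, P p ^ c p ∣ differentIdeal (𝓞 F) (𝓞 K) := by
    refine Finset.prod_dvd_of_coprime (fun p hp q hq hpq => ?_) fun p hp => ?_
    · have hmax : ∀ p ∈ S, (P p).IsMaximal := fun p hp =>
        (hP p hp).isMaximal (by
          intro h; refine hp0 p hp ?_; rw [← hPp p hp, h]; exact Ideal.under_bot _ _)
      refine IsCoprime.pow (Ideal.isCoprime_iff_sup_eq.2
        ((hmax p hp).coprime_of_ne (hmax q hq) fun h => hpq ?_))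
      rw [← hPp p hp, ← hPp q hq, h]
    · have := hP p hp
      have : p.IsPrime := by rw [← hPp p hp]; infer_instance
      have : p.IsMaximal := this.isMaximal (hp0 p hp)
      obtain ⟨J, -, hJ⟩ := exists_not_le_map_eq_pow_mul p (hp0 p hp) (P p) (hPp p hp)
      have h := pow_sub_one_dvd_differentIdeal (𝓞 F) (P p) (c p + 1) (hp0 p hp)
        ((pow_dvd_pow _ (hc p hp)).trans ⟨J, hJ⟩)
      simpa using h
  have h1 : ∏ p ∈ S, Ideal.absNorm (P p) ^ c p ∣ Ideal.absNorm (differentIdeal (𝓞 F) (𝓞 K)) := by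
    have := Ideal.absNorm_dvd_absNorm_of_le (Ideal.dvd_iff_le.1 hdvd)
    simpa [map_prod, map_pow] using this
  have h2 := natAbs_discr_eq_absNorm_differentIdeal_mul_natAbs_discr_pow F (𝓞 F) K (𝓞 K)
  calc ∏ p ∈ S, Ideal.absNorm p ^ c p ≤ ∏ p ∈ S, Ideal.absNorm (P p) ^ c p :=
        Finset.prod_le_prod' fun p hp => by
          have := hP p hp
          exact Nat.pow_le_pow_left (absNorm_le_absNorm_of_under_eq p _ (hPp p hp)) _
    _ ≤ (discr K).natAbs := Nat.le_of_dvd (Int.natAbs_pos.2 (discr_ne_zero K))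
        (h1.trans ⟨_, h2⟩)

/-- If `p` has small total ramification, at most one prime above it is ramified, with
ramification index two and inertia degree one. -/
lemma exists_ideal_of_ramified (h : finrank F K = 2 ∨ finrank F K = 3) (p : Ideal (𝓞 F))
    [p.IsPrime] (hp0 : p ≠ ⊥)
    (hp : finrank F K = 2 ∨ ∃ P₀ : Ideal (𝓞 K), P₀.IsPrime ∧ P₀.under (𝓞 F) = p ∧
      P₀.ramificationIdx (𝓞 F) = 1) :
    ∃ J : Ideal (𝓞 K), J ≠ ⊥ ∧ Ideal.absNorm J ≤ Ideal.absNorm p ∧ ∀ P : Ideal (𝓞 K), P.IsPrime →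
      P.under (𝓞 F) = p → P.ramificationIdx (𝓞 F) ≠ 1 → P.ramificationIdx (𝓞 F) = 2 ∧ J = P := by
  let := (Algebra.QuasiFinite.finite_primesOver (S := 𝓞 K) p).fintype
  have hsum := Ideal.sum_ramification_inertia_eq_finrank p (𝓞 K)
  rw [← IsFractionRing.finrank_eq (𝓞 F) F (𝓞 K) K] at hsum
  have hle : ∀ T : Finset (p.primesOver (𝓞 K)),
      ∑ q ∈ T, q.1.ramificationIdx (𝓞 F) * q.1.inertiaDeg (𝓞 F) ≤ finrank F K := fun T =>
    (Finset.sum_le_univ_sum_of_nonneg fun _ => Nat.zero_le _).trans hsum.le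
  have he : ∀ q : p.primesOver (𝓞 K), 0 < q.1.ramificationIdx (𝓞 F) := fun q => by
    have := q.2.1
    exact Ideal.ramificationIdx_pos q.1 (𝓞 F)
  have hf : ∀ q : p.primesOver (𝓞 K), 0 < q.1.inertiaDeg (𝓞 F) := fun q => by
    have := q.2.1
    exact Ideal.inertiaDeg_pos q.1 (𝓞 F)
  have hef : ∀ q : p.primesOver (𝓞 K), q.1.ramificationIdx (𝓞 F) ≠ 1 →
      2 * q.1.inertiaDeg (𝓞 F) ≤ q.1.ramificationIdx (𝓞 F) * q.1.inertiaDeg (𝓞 F) ∧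
      q.1.ramificationIdx (𝓞 F) ≤ q.1.ramificationIdx (𝓞 F) * q.1.inertiaDeg (𝓞 F) :=
    fun q hq => ⟨Nat.mul_le_mul_right _ (by have := he q; omega), Nat.le_mul_of_pos_right _ (hf q)⟩
  have hval : ∀ q : p.primesOver (𝓞 K), q.1.ramificationIdx (𝓞 F) ≠ 1 →
      q.1.ramificationIdx (𝓞 F) * q.1.inertiaDeg (𝓞 F) ≤ 2 := by
    intro q hq
    rcases hp with hp | ⟨P₀, hP₀, hP₀p, hP₀e⟩
    · simpa [hp] using hle {q}
    · have hne : (⟨P₀, hP₀, ⟨hP₀p.symm⟩⟩ : p.primesOver (𝓞 K)) ≠ q := by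
        rintro rfl; exact hq hP₀e
      have h1 := hle {⟨P₀, hP₀, ⟨hP₀p.symm⟩⟩, q}
      rw [Finset.sum_pair hne] at h1
      have h2 := Nat.mul_pos (he ⟨P₀, hP₀, ⟨hP₀p.symm⟩⟩) (hf ⟨P₀, hP₀, ⟨hP₀p.symm⟩⟩)
      omega
  have huniq : ∀ q q' : p.primesOver (𝓞 K), q.1.ramificationIdx (𝓞 F) ≠ 1 →
      q'.1.ramificationIdx (𝓞 F) ≠ 1 → q = q' := by
    intro q q' hq hq'
    by_contra hne
    have h1 := hle {q, q'}
    rw [Finset.sum_pair hne] at h1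
    have h2 := hef q hq
    have h3 := hef q' hq'
    have := hf q
    have := hf q'
    clear hp
    omega
  by_cases hex : ∃ q : p.primesOver (𝓞 K), q.1.ramificationIdx (𝓞 F) ≠ 1
  · obtain ⟨q, hq⟩ := hex
    have h1 := hval q hq
    have h2 := hef q hq
    have h3 := he q
    have h4 := hf q
    have := q.2.1
    have := q.2.2
    refine ⟨q.1, Ideal.ne_bot_of_liesOver_of_ne_bot hp0 _, ?_, fun P hP hPp hPe => ?_⟩
    · rw [← Ideal.absNorm_pow_inertiaDeg p q.1, show q.1.inertiaDeg (𝓞 F) = 1 by omega, pow_one]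
    · have := huniq ⟨P, hP, ⟨hPp.symm⟩⟩ q hPe hq
      subst this
      exact ⟨by simp only at *; omega, rfl⟩
  · push Not at hex
    refine ⟨⊤, top_ne_bot, ?_, fun P hP hPp hPe => absurd (hex ⟨P, hP, ⟨hPp.symm⟩⟩) hPe⟩
    rw [Ideal.absNorm_top, Nat.one_le_iff_ne_zero]
    exact fun h => hp0 (Ideal.absNorm_eq_zero_iff.1 h)

lemma natAbs_discr_le (h : finrank F K = 2 ∨ finrank F K = 3) (S : Finset (Ideal (𝓞 F)))
    (hS : ∀ p ∈ S, p.IsPrime ∧ p ≠ ⊥ ∧ (finrank F K = 2 ∨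
      ∃ P₀ : Ideal (𝓞 K), P₀.IsPrime ∧ P₀.under (𝓞 F) = p ∧ P₀.ramificationIdx (𝓞 F) = 1))
    (hSc : ∀ P : Ideal (𝓞 K), P.IsPrime → P ≠ ⊥ → ((6 : ℕ) : 𝓞 F) ∉ P.under (𝓞 F) →
      P.under (𝓞 F) ∉ S → P.ramificationIdx (𝓞 F) = 1) :
    (discr K).natAbs ≤ 36 ^ finrank ℚ K * (∏ p ∈ S, Ideal.absNorm p) *
      (discr F).natAbs ^ finrank F K := by
  have hJ : ∀ p ∈ S, ∃ J : Ideal (𝓞 K), J ≠ ⊥ ∧ Ideal.absNorm J ≤ Ideal.absNorm p ∧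
      ∀ P : Ideal (𝓞 K), P.IsPrime → P.under (𝓞 F) = p → P.ramificationIdx (𝓞 F) ≠ 1 →
        P.ramificationIdx (𝓞 F) = 2 ∧ J = P := fun p hp => by
    have := (hS p hp).1
    exact exists_ideal_of_ramified h p (hS p hp).2.1 (hS p hp).2.2
  choose! J hJ0 hJn hJ using hJ
  have h36 : Ideal.span {((36 : ℕ) : 𝓞 K)} ≠ ⊥ := by
    rw [Ne, Ideal.span_singleton_eq_bot]; exact Nat.cast_ne_zero.2 (by norm_num)
  have hdvd : differentIdeal (𝓞 F) (𝓞 K) ∣ Ideal.span {((36 : ℕ) : 𝓞 K)} * ∏ p ∈ S, J p := by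
    rw [UniqueFactorizationMonoid.dvd_iff_emultiplicity_le differentIdeal_ne_bot]
    intro P hPprime
    have hP0 : P ≠ ⊥ := hPprime.ne_zero
    have hP : P.IsPrime := Ideal.isPrime_of_prime hPprime
    set p := P.under (𝓞 F) with hp
    have hp0 : p ≠ ⊥ := mt Ideal.eq_bot_of_comap_eq_bot hP0
    have hpm : p.IsMaximal := Ideal.IsPrime.isMaximal (by rw [hp]; infer_instance) hp0
    obtain ⟨I, hI, hmap⟩ := exists_not_le_map_eq_pow_mul p hp0 P hp.symm
    set e := P.ramificationIdx (𝓞 F) with he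
    have hepos : 0 < e := Ideal.ramificationIdx_pos P (𝓞 F)
    have h6 : Ideal.span {((6 : ℕ) : 𝓞 F)} ≠ ⊥ := by
      rw [Ne, Ideal.span_singleton_eq_bot]; exact Nat.cast_ne_zero.2 (by norm_num)
    obtain ⟨b, hb, hpb⟩ := Ideal.eq_prime_pow_mul_coprime h6 p
    set a := Multiset.count p (UniqueFactorizationMonoid.normalizedFactors
      (Ideal.span {((6 : ℕ) : 𝓞 F)}))
    have hbp : ¬ b ≤ p := fun hle => hpm.ne_top (by rwa [sup_of_le_left hle] at hb)
    have hlt := not_pow_dvd_differentIdeal h hP0 hp.symm hepos hpb hbp hmap hI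
    have hlt' := emultiplicity_lt_iff_not_dvd.2 hlt
    rcases Nat.eq_zero_or_pos a with ha | ha
    · rw [ha, zero_add, mul_one] at hlt'
      by_cases he1 : e = 1
      · rw [he1, Nat.cast_one, Order.lt_one_iff] at hlt'
        rw [hlt']; exact zero_le
      · have h6p : ((6 : ℕ) : 𝓞 F) ∉ p := by
          rw [ha, pow_zero, one_mul] at hpb
          rw [← hpb] at hbp
          exact fun h => hbp ((Ideal.span_singleton_le_iff_mem _).2 h)
        have hpS : p ∈ S := by
          by_contra hpS
          exact he1 (hSc P hP hP0 h6p hpS)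
        obtain ⟨he2, hJP⟩ := hJ p hpS P hP hp.symm he1
        rw [he, he2] at hlt'
        have h1 : emultiplicity P (differentIdeal (𝓞 F) (𝓞 K)) ≤ (1 : ℕ) :=
          Order.le_of_lt_add_one (by exact_mod_cast hlt')
        refine h1.trans (le_emultiplicity_of_pow_dvd ?_)
        rw [pow_one]
        exact ((dvd_of_eq hJP.symm).trans (Finset.dvd_prod_of_mem J hpS)).trans (dvd_mul_left _ _)
    · refine hlt'.le.trans (le_emultiplicity_of_pow_dvd (Dvd.dvd.mul_right ?_ _))
      have h1 : e * (a + 1) ≤ e * a * 2 := by nlinarith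
      refine (pow_dvd_pow P h1).trans ?_
      rw [pow_mul, pow_mul, show (36 : ℕ) = 6 ^ 2 by norm_num, Nat.cast_pow,
        ← Ideal.span_singleton_pow]
      refine pow_dvd_pow_of_dvd ?_ 2
      have h2 : Ideal.span {((6 : ℕ) : 𝓞 K)} =
          (Ideal.span {((6 : ℕ) : 𝓞 F)}).map (algebraMap (𝓞 F) (𝓞 K)) := by
        rw [Ideal.map_span, Set.image_singleton, map_natCast]
      rw [h2, hpb, Ideal.map_mul, Ideal.map_pow, hmap, mul_pow, mul_assoc]
      exact dvd_mul_right _ _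
  have h1 := Ideal.absNorm_dvd_absNorm_of_le (Ideal.dvd_iff_le.1 hdvd)
  have hne : Ideal.absNorm (Ideal.span {((36 : ℕ) : 𝓞 K)} * ∏ p ∈ S, J p) ≠ 0 := by
    rw [Ne, Ideal.absNorm_eq_zero_iff]
    exact mul_ne_zero h36 (Finset.prod_ne_zero_iff.2 hJ0)
  have h2 := Nat.le_of_dvd (Nat.pos_of_ne_zero hne) h1
  rw [natAbs_discr_eq_absNorm_differentIdeal_mul_natAbs_discr_pow F (𝓞 F) K (𝓞 K)]
  refine Nat.mul_le_mul_right _ (h2.trans ?_)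
  rw [map_mul, map_prod]
  refine Nat.mul_le_mul (le_of_eq ?_) (Finset.prod_le_prod' hJn)
  rw [Ideal.absNorm_span_singleton, ← map_natCast (algebraMap ℤ (𝓞 K)), Algebra.norm_algebraMap,
    RingOfIntegers.rank, Int.natAbs_pow, Int.natAbs_natCast]

end discriminantBounds

section ramificationData

open NumberField Module

lemma Equiv.Perm.apply_apply_ne_of_card_eq_three {α : Type*} (hα : Nat.card α = 3)
    (σ : Equiv.Perm α) (h : ∀ x, σ x ≠ x) (a : α) : σ (σ a) ≠ a := by
  have key : ∀ σ : Equiv.Perm (Fin 3), (∀ x, σ x ≠ x) → ∀ a, σ (σ a) ≠ a := by decide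
  have : Finite α := Nat.finite_of_card_ne_zero (by omega)
  let e : α ≃ Fin 3 := Finite.equivFinOfCardEq hα
  intro ha
  refine key (e.permCongr σ) (fun x hx => h (e.symm x) ?_) (e a) ?_
  · apply e.injective
    simpa [Equiv.permCongr_apply] using hx
  · simp [Equiv.permCongr_apply, ha]

lemma Subgroup.three_le_relIndex_zpowers {G : Type*} [Group G] [Finite G] (H : Subgroup G)
    (hH : H.index = 3) (g : G) (h : ∀ x, x⁻¹ * g * x ∉ H) :
    3 ≤ H.relIndex (Subgroup.zpowers g) := by
  have h0 : H.relIndex (Subgroup.zpowers g) ≠ 0 := Subgroup.index_ne_zero_of_finite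
  have h1 : H.relIndex (Subgroup.zpowers g) ≠ 1 := by
    rw [Ne, Subgroup.relIndex_eq_one, Subgroup.zpowers_le]
    simpa using h 1
  have h2 : H.relIndex (Subgroup.zpowers g) ≠ 2 := by
    intro h2
    have hsq : g ^ 2 ∈ H := Subgroup.sq_mem_of_index_two (H := H.subgroupOf (Subgroup.zpowers g)) h2
      ⟨g, Subgroup.mem_zpowers g⟩
    refine Equiv.Perm.apply_apply_ne_of_card_eq_three (α := G ⧸ H) hH (MulAction.toPerm g)
      (fun x => ?_) ((1 : G) : G ⧸ H) ?_
    · induction x using QuotientGroup.induction_on with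
      | H z =>
        intro hz
        have := QuotientGroup.eq.1 hz.symm
        exact h z (by simpa [mul_assoc] using this)
    · rw [MulAction.toPerm_apply, MulAction.toPerm_apply, smul_smul, ← pow_two]
      refine (QuotientGroup.eq.2 ?_).symm
      simpa using hsq
  omega

/-- A nonzero prime ideal not dividing `6`. -/
def IsTamePrime {k : Type*} [Field k] (p : Ideal (𝓞 k)) : Prop :=
  p.IsPrime ∧ p ≠ ⊥ ∧ ((6 : ℕ) : 𝓞 k) ∉ p

universe u

variable {k : Type*} {L : Type u} [Field k] [NumberField k] [Field L] [NumberField L]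
  [Algebra k L] [IsGalois k L]

variable (k L) in
lemma exists_ramification_generators :
    ∃ g : Ideal (𝓞 k) → (L ≃ₐ[k] L), ∀ p, IsTamePrime p → ∀ E : IntermediateField k L,
      finrank k E ≤ 3 →
      (∀ P : Ideal (𝓞 E), P.IsPrime → P.under (𝓞 k) = p → ∃ x : L ≃ₐ[k] L,
        P.ramificationIdx (𝓞 k) = E.fixingSubgroup.relIndex (Subgroup.zpowers (x⁻¹ * g p * x))) ∧
      (∀ x : L ≃ₐ[k] L, ∃ P : Ideal (𝓞 E), P.IsPrime ∧ P.under (𝓞 k) = p ∧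
        P.ramificationIdx (𝓞 k) = E.fixingSubgroup.relIndex (Subgroup.zpowers (x⁻¹ * g p * x))) := by
  have key : ∀ p : Ideal (𝓞 k), IsTamePrime p → ∃ g : L ≃ₐ[k] L, ∀ E : IntermediateField k L,
      finrank k E ≤ 3 →
      (∀ P : Ideal (𝓞 E), P.IsPrime → P.under (𝓞 k) = p → ∃ x : L ≃ₐ[k] L,
        P.ramificationIdx (𝓞 k) = E.fixingSubgroup.relIndex (Subgroup.zpowers (x⁻¹ * g * x))) ∧
      (∀ x : L ≃ₐ[k] L, ∃ P : Ideal (𝓞 E), P.IsPrime ∧ P.under (𝓞 k) = p ∧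
        P.ramificationIdx (𝓞 k) = E.fixingSubgroup.relIndex (Subgroup.zpowers (x⁻¹ * g * x))) := by
    rintro p ⟨hp, hp0, h6⟩
    have h23 : ((6 : ℕ) : 𝓞 k) = 2 * 3 := by
      rw [show (6 : ℕ) = 2 * 3 by norm_num, Nat.cast_mul, Nat.cast_ofNat, Nat.cast_ofNat]
    rw [h23] at h6
    exact exists_ramification_generator p hp0 (fun h => h6 (p.mul_mem_right _ h))
      (fun h => h6 (p.mul_mem_left _ h))
  choose! g hg using key
  exact ⟨g, hg⟩

lemma relIndex_zpowers_eq_one_iff {G : Type*} [Group G] (H : Subgroup G) (g : G) :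
    H.relIndex (Subgroup.zpowers g) = 1 ↔ g ∈ H := by
  rw [Subgroup.relIndex_eq_one, Subgroup.zpowers_le]

variable (k L) in
/-- The ramification of all cubic and quadratic subextensions of `L` at tame primes, and the
resulting bounds for their discriminants, are governed by elements of the Galois group. -/
lemma exists_ramification_data :
    ∃ g : Ideal (𝓞 k) → (L ≃ₐ[k] L),
      (∀ E : IntermediateField k L, finrank k E = 3 → ∀ R S : Finset (Ideal (𝓞 k)),
        Disjoint R S →
        (∀ p ∈ R, IsTamePrime p ∧ ∀ x, x⁻¹ * g p * x ∉ E.fixingSubgroup) →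
        (∀ p ∈ S, IsTamePrime p ∧ ∃ x, x⁻¹ * g p * x ∉ E.fixingSubgroup) →
        (∏ p ∈ R, Ideal.absNorm p) ^ 2 * ∏ p ∈ S, Ideal.absNorm p ≤ (discr E).natAbs) ∧
      (∀ E : IntermediateField k L, finrank k E = 2 ∨ finrank k E = 3 →
        ∀ S : Finset (Ideal (𝓞 k)),
        (∀ p ∈ S, IsTamePrime p ∧ (finrank k E = 2 ∨ ∃ x, x⁻¹ * g p * x ∈ E.fixingSubgroup)) →
        (∀ p, IsTamePrime p → p ∉ S → ∀ x, x⁻¹ * g p * x ∈ E.fixingSubgroup) →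
        (discr E).natAbs ≤ 36 ^ (finrank ℚ k * 3) * (discr k).natAbs ^ 3 *
          ∏ p ∈ S, Ideal.absNorm p) ∧
      (∀ E : IntermediateField k L, finrank k E = 3 → ∀ p, IsTamePrime p →
        (∃ P : Ideal (𝓞 E), P.IsPrime ∧ p.map (algebraMap (𝓞 k) (𝓞 E)) = P ^ 3) →
        ∀ x, x⁻¹ * g p * x ∉ E.fixingSubgroup) ∧
      (∀ E : IntermediateField k L, finrank k E = 3 →
        {p | IsTamePrime p ∧ ∃ x, x⁻¹ * g p * x ∉ E.fixingSubgroup}.Finite) := by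
  obtain ⟨g, hg⟩ := exists_ramification_generators k L
  have hlow : ∀ E : IntermediateField k L, finrank k E = 3 → ∀ R S : Finset (Ideal (𝓞 k)),
        Disjoint R S →
        (∀ p ∈ R, IsTamePrime p ∧ ∀ x, x⁻¹ * g p * x ∉ E.fixingSubgroup) →
        (∀ p ∈ S, IsTamePrime p ∧ ∃ x, x⁻¹ * g p * x ∉ E.fixingSubgroup) →
        (∏ p ∈ R, Ideal.absNorm p) ^ 2 * ∏ p ∈ S, Ideal.absNorm p ≤ (discr E).natAbs := by
    intro E hE R S hRS hR hS
    have hidx : E.fixingSubgroup.index = 3 := by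
      rw [← IntermediateField.finrank_eq_fixingSubgroup_index L E, hE]
    have hnR : ∀ p ∈ S, p ∉ R := fun p hp hpR => Finset.disjoint_left.1 hRS hpR hp
    have h := prod_absNorm_pow_le_natAbs_discr E (R ∪ S) (fun p => if p ∈ R then 2 else 1) ?_
    · rw [Finset.prod_union hRS] at h
      refine le_trans (le_of_eq ?_) h
      rw [← Finset.prod_pow]
      congr 1
      · exact Finset.prod_congr rfl fun p hp => by rw [if_pos hp]
      · exact Finset.prod_congr rfl fun p hp => by rw [if_neg (hnR p hp), pow_one]
    · intro p hp
      rcases Finset.mem_union.1 hp with hp | hp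
      · obtain ⟨ht, hx⟩ := hR p hp
        obtain ⟨P, hP, hPp, he⟩ := (hg p ht E hE.le).2 1
        refine ⟨ht.2.1, P, hP, hPp, ?_⟩
        rw [if_pos hp, he, inv_one, one_mul, mul_one]
        exact Subgroup.three_le_relIndex_zpowers _ hidx _ hx
      · obtain ⟨ht, x, hx⟩ := hS p hp
        obtain ⟨P, hP, hPp, he⟩ := (hg p ht E hE.le).2 x
        refine ⟨ht.2.1, P, hP, hPp, ?_⟩
        rw [if_neg (hnR p hp), he]
        have h0 : E.fixingSubgroup.relIndex (Subgroup.zpowers (x⁻¹ * g p * x)) ≠ 0 :=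
          Subgroup.index_ne_zero_of_finite
        have h1 := mt (relIndex_zpowers_eq_one_iff _ _).1 hx
        omega
  refine ⟨g, hlow, ?_, ?_, ?_⟩
  · intro E hE S hS hSc
    have hE3 : finrank k E ≤ 3 := by omega
    have h := natAbs_discr_le hE S (fun p hp => ?_) (fun P hP hP0 h6 hPS => ?_)
    · refine h.trans ?_
      have hd : 1 ≤ (discr k).natAbs := Int.natAbs_pos.2 (discr_ne_zero k)
      rw [← finrank_mul_finrank ℚ k E, mul_right_comm]
      gcongr
      norm_num
    · obtain ⟨ht, hx⟩ := hS p hp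
      refine ⟨ht.1, ht.2.1, hx.imp_right ?_⟩
      rintro ⟨x, hx⟩
      obtain ⟨P, hP, hPp, he⟩ := (hg p ht E hE3).2 x
      exact ⟨P, hP, hPp, he.trans ((relIndex_zpowers_eq_one_iff _ _).2 hx)⟩
    · have ht : IsTamePrime (P.under (𝓞 k)) :=
        ⟨inferInstance, mt Ideal.eq_bot_of_comap_eq_bot hP0, h6⟩
      obtain ⟨x, he⟩ := (hg _ ht E hE3).1 P hP rfl
      exact he.trans ((relIndex_zpowers_eq_one_iff _ _).2 (hSc _ ht hPS x))
  · rintro E hE p ht ⟨P, hP, hmap⟩ x hx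
    obtain ⟨P', hP', hPp', he⟩ := (hg p ht E hE.le).2 x
    obtain ⟨J, hJ, hmap'⟩ := exists_not_le_map_eq_pow_mul p ht.2.1 P' hPp'
    rw [he, (relIndex_zpowers_eq_one_iff _ _).2 hx, pow_one, hmap] at hmap'
    have hP0 : P ≠ ⊥ := by
      rintro rfl
      refine Ideal.map_ne_bot_of_ne_bot (S := 𝓞 E) ht.2.1 (hmap.trans ?_)
      exact zero_pow (by norm_num)
    have hle : P ≤ P' := hP'.le_of_pow_le (n := 3) (by
      rw [hmap']
      exact Ideal.mul_le_right.trans' (by rw [mul_comm]))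
    have heq : P = P' := (hP.isMaximal hP0).eq_of_le hP'.ne_top hle
    subst heq
    rw [pow_succ'] at hmap'
    have := mul_left_cancel₀ (show P ≠ 0 from hP0) hmap'
    exact hJ (this ▸ Ideal.pow_le_self two_ne_zero)
  · intro E hE
    by_contra hinf
    obtain ⟨T, hT, hcard⟩ := Set.Infinite.exists_subset_card_eq hinf ((discr E).natAbs + 1)
    have h := hlow E hE ∅ T (Finset.disjoint_empty_left _) (by simp) (fun p hp => hT hp)
    rw [Finset.prod_empty, one_pow, one_mul] at h
    have h2 : 2 ^ T.card ≤ ∏ p ∈ T, Ideal.absNorm p := by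
      rw [← Finset.prod_const]
      refine Finset.prod_le_prod' fun p hp => ?_
      have ht := (hT hp).1
      have h0 : Ideal.absNorm p ≠ 0 := mt Ideal.absNorm_eq_zero_iff.1 ht.2.1
      have h1 : Ideal.absNorm p ≠ 1 := mt Ideal.absNorm_eq_one_iff.1 ht.1.ne_top
      omega
    have h3 := Nat.lt_two_pow_self (n := T.card)
    omega

end ramificationData

section affineCocycle

variable {G : Type*} [Group G]

/-- `a` is a crossed homomorphism to `ZMod 3` on which `G` acts through the character `ε`; such
pairs are the same as homomorphisms from `G` to the affine group of `ZMod 3`. -/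
def IsAffineCocycle (ε : G →* (ZMod 3)ˣ) (a : G → ZMod 3) : Prop :=
  ∀ g h, a (g * h) = a g + ε g * a h

namespace IsAffineCocycle

variable {ε ε' : G →* (ZMod 3)ˣ} {a b : G → ZMod 3}

lemma map_one (h : IsAffineCocycle ε a) : a 1 = 0 := by
  simpa using h 1 1

lemma sub (ha : IsAffineCocycle ε a) (hb : IsAffineCocycle ε b) : IsAffineCocycle ε (a - b) := by
  intro g h
  simp only [Pi.sub_apply, ha g h, hb g h]
  ring

lemma inv_mul (h : IsAffineCocycle ε a) (x y : G) :
    a (x⁻¹ * y) = ε x⁻¹ * (a y - a x) := by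
  have h1 := h x⁻¹ x
  rw [inv_mul_cancel, h.map_one] at h1
  rw [h x⁻¹ y]
  linear_combination -h1

lemma inv_mul_eq_zero_iff (h : IsAffineCocycle ε a) (x y : G) : a (x⁻¹ * y) = 0 ↔ a x = a y := by
  rw [h.inv_mul, Units.mul_right_eq_zero, sub_eq_zero, eq_comm]

lemma conj_eq_zero_iff (h : IsAffineCocycle ε a) (x g : G) :
    a (x⁻¹ * g * x) = 0 ↔ a g + ε g * a x = a x := by
  rw [mul_assoc, h.inv_mul_eq_zero_iff, h g x, eq_comm]

lemma conj_eq_zero_iff_of_eq_one (h : IsAffineCocycle ε a) (x : G) {g : G} (hg : ε g = 1) :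
    a (x⁻¹ * g * x) = 0 ↔ a g = 0 := by
  rw [h.conj_eq_zero_iff, hg, Units.val_one, one_mul, add_eq_right]

lemma exists_conj_eq_zero (h : IsAffineCocycle ε a) (hs : Function.Surjective a) {g : G}
    (hg : ε g ≠ 1) : ∃ x, a (x⁻¹ * g * x) = 0 := by
  have key : ∀ (u : (ZMod 3)ˣ) (v : ZMod 3), u ≠ 1 → ∃ w, v + u * w = w := by decide
  obtain ⟨w, hw⟩ := key (ε g) (a g) hg
  obtain ⟨x, rfl⟩ := hs w
  exact ⟨x, (h.conj_eq_zero_iff x g).2 hw⟩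

lemma exists_conj_ne_zero (h : IsAffineCocycle ε a) (hs : Function.Surjective a) {g : G}
    (hg : ε g ≠ 1) : ∃ x, a (x⁻¹ * g * x) ≠ 0 := by
  have key : ∀ (u : (ZMod 3)ˣ) (v : ZMod 3), u ≠ 1 → ∃ w, v + u * w ≠ w := by decide
  obtain ⟨w, hw⟩ := key (ε g) (a g) hg
  obtain ⟨x, rfl⟩ := hs w
  exact ⟨x, mt (h.conj_eq_zero_iff x g).1 hw⟩

lemma eq_coboundary_of_not_surjective (h : IsAffineCocycle ε a)
    (hs : ¬ Function.Surjective a) : ∃ t : ZMod 3, ∀ g, a g = t - ε g * t := by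
  obtain ⟨t, ht⟩ := not_forall.1 hs
  by_cases h0 : ∀ g, a g = 0
  · exact ⟨0, fun g => by simp [h0 g]⟩
  · obtain ⟨g₀, hg₀⟩ := not_forall.1 h0
    refine ⟨t, fun g => eq_sub_of_add_eq ?_⟩
    have hne : ∀ y, a g + ε g * t ≠ a y := by
      intro y hy
      refine ht ⟨g⁻¹ * y, ?_⟩
      rw [h.inv_mul, ← hy, add_sub_cancel_left, ← mul_assoc, ← Units.val_mul, ← _root_.map_mul,
        inv_mul_cancel, _root_.map_one, Units.val_one, one_mul]
    have key : ∀ v t w : ZMod 3, v ≠ 0 → t ≠ v → t ≠ 0 → w ≠ v → w ≠ 0 → w = t := by decide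
    exact key (a g₀) t _ hg₀ (fun h => ht ⟨g₀, h.symm⟩) (fun h' => ht ⟨1, h.map_one.trans h'.symm⟩)
      (hne g₀) (fun h' => hne 1 (h'.trans h.map_one.symm))

lemma eq_or_eq_neg (ha : IsAffineCocycle ε a) (hb : IsAffineCocycle ε' b)
    (hs : Function.Surjective a) (hab : ∀ g, a g = 0 ↔ b g = 0) :
    ε = ε' ∧ ∃ u : (ZMod 3)ˣ, ∀ g, b g = u * a g := by
  have hiff : ∀ x y, a x = a y ↔ b x = b y := fun x y => by
    rw [← ha.inv_mul_eq_zero_iff, ← hb.inv_mul_eq_zero_iff, hab]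
  obtain ⟨g₁, hg₁⟩ := hs 1
  have hu : b g₁ ≠ 0 := fun h => by rw [(hab g₁).2 h] at hg₁; exact absurd hg₁ (by decide)
  have hmul : ∀ g, b g = b g₁ * a g := by
    intro g
    have key : ∀ w v t : ZMod 3, w ≠ 0 → (v = 0 ↔ t = 0) → (v = 1 ↔ t = w) → t = w * v := by decide
    exact key _ _ _ hu (hab g) (by rw [← hg₁, hiff])
  refine ⟨MonoidHom.ext fun g => Units.ext ?_, Units.mk0 _ hu, hmul⟩
  have h1 := hb g g₁
  rw [hmul (g * g₁), ha g g₁, hmul g, hg₁, mul_one] at h1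
  have h2 : b g₁ * (ε g : ZMod 3) = b g₁ * ε' g := by linear_combination h1
  exact mul_left_cancel₀ hu h2

/-- The subgroup on which an affine cocycle vanishes. -/
def zeros (h : IsAffineCocycle ε a) : Subgroup G where
  carrier := {g | a g = 0}
  one_mem' := h.map_one
  mul_mem' := fun {x y} hx hy => by
    simp only [Set.mem_ofPred_eq] at *
    rw [h x y, hx, hy, mul_zero, add_zero]
  inv_mem' := fun {x} hx => by
    simp only [Set.mem_ofPred_eq] at *
    have := h.inv_mul x 1
    rwa [mul_one, h.map_one, hx, sub_zero, mul_zero] at this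

lemma mem_zeros (h : IsAffineCocycle ε a) {g : G} : g ∈ h.zeros ↔ a g = 0 := Iff.rfl

/-- The cosets of the zero subgroup are parametrised by the values of the cocycle. -/
lemma index_zeros (h : IsAffineCocycle ε a) : h.zeros.index = Nat.card (Set.range a) := by
  refine Nat.card_congr (Equiv.ofBijective (fun q => Quotient.liftOn' q
    (fun g => (⟨a g, g, rfl⟩ : Set.range a)) ?_) ⟨?_, ?_⟩)
  · intro x y hxy
    rw [QuotientGroup.leftRel_apply] at hxy
    exact Subtype.ext ((h.inv_mul_eq_zero_iff x y).1 hxy)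
  · rintro ⟨x⟩ ⟨y⟩ hxy
    exact QuotientGroup.eq.2 ((h.inv_mul_eq_zero_iff x y).2 (congrArg Subtype.val hxy))
  · rintro ⟨_, g, rfl⟩
    exact ⟨QuotientGroup.mk g, rfl⟩

lemma surjective_iff_index_zeros (h : IsAffineCocycle ε a) :
    Function.Surjective a ↔ h.zeros.index = 3 := by
  rw [h.index_zeros, ← Set.range_eq_univ]
  constructor
  · intro h; rw [h, Nat.card_univ, Nat.card_zmod]
  · intro h
    refine Set.eq_of_subset_of_ncard_le (Set.subset_univ _) ?_
    rw [Set.ncard_univ, Nat.card_zmod, ← Nat.card_coe_set_eq]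
    exact h.ge

lemma ne_one_of_not_normal (h : IsAffineCocycle ε a) (hn : ¬ h.zeros.Normal) : ε ≠ 1 := by
  rintro rfl
  refine hn ⟨fun g hg x => ?_⟩
  have := (h.conj_eq_zero_iff_of_eq_one x⁻¹ (g := g) rfl).2 hg
  rwa [inv_inv] at this

end IsAffineCocycle

/-- Every subgroup of index three is the zero set of an affine cocycle. -/
lemma Subgroup.exists_isAffineCocycle (H : Subgroup G) (hH : H.index = 3) :
    ∃ (ε : G →* (ZMod 3)ˣ) (a : G → ZMod 3), IsAffineCocycle ε a ∧ ∀ g, a g = 0 ↔ g ∈ H := by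
  have : Finite (G ⧸ H) := Nat.finite_of_card_ne_zero (by rw [← Subgroup.index]; omega)
  obtain ⟨e, he⟩ : ∃ e : G ⧸ H ≃ ZMod 3, e ((1 : G) : G ⧸ H) = 0 := by
    let e₀ : G ⧸ H ≃ ZMod 3 := (Finite.equivFinOfCardEq hH).trans
      (Finite.equivFinOfCardEq (Nat.card_zmod 3)).symm
    exact ⟨e₀.trans (Equiv.subRight (e₀ ((1 : G) : G ⧸ H))), by simp⟩
  let π : G →* Equiv.Perm (ZMod 3) :=
    (e.permCongrHom.toMonoidHom).comp (MulAction.toPermHom G (G ⧸ H))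
  have key : ∀ σ : Equiv.Perm (ZMod 3), ∀ x, σ x = (σ 1 - σ 0) * x + σ 0 := by decide
  have hne : ∀ g, π g 1 - π g 0 ≠ 0 := fun g h => by
    have := (π g).injective (sub_eq_zero.1 h)
    exact absurd this (by decide)
  have hmul : ∀ g h x, π (g * h) x = π g (π h x) := fun g h x => by
    rw [_root_.map_mul, Equiv.Perm.mul_apply]
  refine ⟨⟨⟨fun g => Units.mk0 _ (hne g), ?_⟩, ?_⟩, fun g => π g 0, ?_, ?_⟩
  · ext; simp
  · intro g h
    ext
    simp only [Units.val_mk0, Units.val_mul, hmul]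
    rw [key (π g) (π h 1), key (π g) (π h 0)]
    ring
  · intro g h
    simp only [hmul]
    rw [key (π g) (π h 0), add_comm]
    rfl
  · intro g
    have h1 : π g 0 = e (g • ((1 : G) : G ⧸ H)) := by
      have : e.symm 0 = ((1 : G) : G ⧸ H) := by rw [← he, Equiv.symm_apply_apply]
      rw [← this]; rfl
    show π g 0 = 0 ↔ _
    rw [h1, ← he, e.injective.eq_iff, eq_comm, MulAction.Quotient.smul_coe, QuotientGroup.eq]
    simp

lemma MonoidHom.index_ker_of_ne_one (ε : G →* (ZMod 3)ˣ) (h : ε ≠ 1) : ε.ker.index = 2 := by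
  have hc : Nat.card (ZMod 3)ˣ = 2 := by rw [Nat.card_eq_fintype_card]; decide
  have : Fact (Nat.card (ZMod 3)ˣ).Prime := ⟨by rw [hc]; exact Nat.prime_two⟩
  rw [Subgroup.index_ker]
  rcases Subgroup.eq_bot_or_eq_top_of_prime_card ε.range with h' | h'
  · exact absurd (MonoidHom.range_eq_bot_iff.1 h') h
  · rw [h', Subgroup.card_top, hc]

lemma MonoidHom.eq_of_ker_eq {ε ε' : G →* (ZMod 3)ˣ} (h : ε.ker = ε'.ker) : ε = ε' := by
  have key : ∀ u v : (ZMod 3)ˣ, (u = 1 ↔ v = 1) → u = v := by decide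
  refine MonoidHom.ext fun g => key _ _ ?_
  rw [← MonoidHom.mem_ker, h, MonoidHom.mem_ker]

end affineCocycle

section countCocycles

variable {G ι : Type*} [Group G]

/-- A family of affine cocycles is bounded in terms of the kernels of the associated characters
and the zero subgroups of the surjective differences. -/
lemma card_le_of_isAffineCocycle (T : Finset ι) (ε : ι → G →* (ZMod 3)ˣ) (a : ι → G → ZMod 3)
    (ha : ∀ i ∈ T, IsAffineCocycle (ε i) (a i)) (hinj : Set.InjOn a T) (F K : Finset (Subgroup G))
    (hF : ∀ i ∈ T, (ε i).ker ∈ F)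
    (hK : ∀ i ∈ T, ∀ j ∈ T, ε i = ε j → Function.Surjective (a i - a j) →
      ∃ Z ∈ K, ∀ g, g ∈ Z ↔ (a i - a j) g = 0) :
    T.card ≤ 3 * (F.card + K.card) := by
  rcases T.eq_empty_or_nonempty with rfl | ⟨i₀, -⟩
  · simp
  have : Nonempty ι := ⟨i₀⟩
  have hbase : ∀ χ : G →* (ZMod 3)ˣ, (∃ i ∈ T, ε i = χ) → ∃ i, i ∈ T ∧ ε i = χ :=
    fun χ ⟨i, hi⟩ => ⟨i, hi⟩
  choose! base hbT hbε using hbase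
  set c : ι → G → ZMod 3 := fun i => a i - a (base (ε i)) with hc
  have hb1 : ∀ i ∈ T, base (ε i) ∈ T := fun i hi => hbT _ ⟨i, hi, rfl⟩
  have hb2 : ∀ i ∈ T, ε (base (ε i)) = ε i := fun i hi => hbε _ ⟨i, hi, rfl⟩
  have hcc : ∀ i ∈ T, IsAffineCocycle (ε i) (c i) := fun i hi =>
    (ha i hi).sub (by rw [← hb2 i hi]; simpa only [hb2 i hi] using ha _ (hb1 i hi))
  have heq : ∀ i ∈ T, ∀ j ∈ T, ε i = ε j → c i = c j → i = j := by
    intro i hi j hj hε h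
    refine hinj hi hj ?_
    simp only [hc, hε] at h
    exact sub_left_injective h
  have hA : ∀ i, i ∈ T.filter (fun i => ¬ Function.Surjective (c i)) →
      ∃ t : ZMod 3, ∀ g, c i g = t - ε i g * t := fun i hi =>
    (hcc i (Finset.mem_filter.1 hi).1).eq_coboundary_of_not_surjective (Finset.mem_filter.1 hi).2
  choose! t ht using hA
  have hB : ∀ i, i ∈ T.filter (fun i => Function.Surjective (c i)) →
      ∃ Z ∈ K, ∀ g, g ∈ Z ↔ c i g = 0 := fun i hi => by
    obtain ⟨hi, hs⟩ := Finset.mem_filter.1 hi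
    exact hK i hi _ (hb1 i hi) (hb2 i hi).symm hs
  choose! Z hZK hZ using hB
  have hh : ∀ H : Subgroup G, H ≠ ⊤ → ∃ g, g ∉ H := fun H hH => by
    by_contra! hcon
    exact hH (eq_top_iff.2 fun g _ => hcon g)
  choose! h hh using hh
  have cardA : (T.filter (fun i => ¬ Function.Surjective (c i))).card ≤
      (F ×ˢ (Finset.univ : Finset (ZMod 3))).card := by
    refine Finset.card_le_card_of_injOn (fun i => ((ε i).ker, t i)) (fun i hi => ?_) ?_
    · exact Finset.mem_coe.2 (Finset.mem_product.2
        ⟨hF i (Finset.mem_filter.1 hi).1, Finset.mem_univ _⟩)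
    · intro i hi j hj hij
      obtain ⟨h1, h2⟩ := Prod.mk.inj hij
      have hε := MonoidHom.eq_of_ker_eq h1
      refine heq i (Finset.mem_filter.1 hi).1 j (Finset.mem_filter.1 hj).1 hε (funext fun g => ?_)
      rw [ht i hi, ht j hj, h2, hε]
  have cardB : (T.filter (fun i => Function.Surjective (c i))).card ≤
      (K ×ˢ (Finset.univ : Finset (ZMod 3))).card := by
    refine Finset.card_le_card_of_injOn (fun i => (Z i, c i (h (Z i)))) (fun i hi => ?_) ?_
    · exact Finset.mem_coe.2 (Finset.mem_product.2 ⟨hZK i hi, Finset.mem_univ _⟩)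
    · intro i hi j hj hij
      obtain ⟨h1, h2⟩ := Prod.mk.inj hij
      obtain ⟨hiT, his⟩ := Finset.mem_filter.1 hi
      obtain ⟨hjT, hjs⟩ := Finset.mem_filter.1 hj
      obtain ⟨hε, u, hu⟩ := (hcc i hiT).eq_or_eq_neg (hcc j hjT) his
        fun g => by rw [← hZ i hi, h1, hZ j hj]
      have hne : c i (h (Z i)) ≠ 0 := by
        rw [Ne, ← hZ i hi]
        refine hh _ fun htop => ?_
        obtain ⟨g, hg⟩ := his 1
        have := (hZ i hi g).1 (htop ▸ Subgroup.mem_top g)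
        rw [hg] at this
        exact absurd this (by decide)
      rw [← h1, hu] at h2
      have hu1 : (u : ZMod 3) = 1 := by
        have := mul_right_cancel₀ hne ((one_mul _).trans h2)
        exact this.symm
      refine heq i hiT j hjT hε (funext fun g => ?_)
      rw [hu, hu1, one_mul]
  rw [Finset.card_product, Finset.card_univ, ZMod.card] at cardA cardB
  rw [← Finset.card_filter_add_card_filter_not (s := T) (fun i => Function.Surjective (c i))]
  omega

end countCocycles

section countRamified

open NumberField Module

lemma IsAffineCocycle.forall_conj_ne_zero_iff {G : Type*} [Group G] {ε : G →* (ZMod 3)ˣ}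
    {a : G → ZMod 3} (h : IsAffineCocycle ε a) (hs : Function.Surjective a) (g : G) :
    (∀ x, a (x⁻¹ * g * x) ≠ 0) ↔ ε g = 1 ∧ a g ≠ 0 := by
  constructor
  · intro hx
    have hg : ε g = 1 := by
      by_contra hg
      obtain ⟨x, h0⟩ := h.exists_conj_eq_zero hs hg
      exact hx x h0
    exact ⟨hg, (h.conj_eq_zero_iff_of_eq_one 1 hg).not.1 (hx 1)⟩
  · rintro ⟨hg, h0⟩ x
    exact (h.conj_eq_zero_iff_of_eq_one x hg).not.2 h0

lemma IsAffineCocycle.exists_conj_iff {G : Type*} [Group G] {ε : G →* (ZMod 3)ˣ}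
    {a : G → ZMod 3} (h : IsAffineCocycle ε a) (hs : Function.Surjective a) (g : G) :
    ((∃ x, a (x⁻¹ * g * x) ≠ 0) ∧ ∃ x, a (x⁻¹ * g * x) = 0) ↔ ε g ≠ 1 := by
  constructor
  · rintro ⟨⟨x, hx⟩, y, hy⟩ hg
    rw [Ne, h.conj_eq_zero_iff_of_eq_one x hg] at hx
    rw [h.conj_eq_zero_iff_of_eq_one y hg] at hy
    exact hx hy
  · exact fun hg => ⟨h.exists_conj_ne_zero hs hg, h.exists_conj_eq_zero hs hg⟩

/-- Bounds on the number of subfields, phrased for subgroups of the Galois group. -/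
lemma card_subgroup_le {k L : Type*} [Field k] [NumberField k] [Field L] [NumberField L]
    [Algebra k L] [IsGalois k L] {d : ℕ} {C Y : ℝ}
    (hC : ∀ S : Finset (IntermediateField k L),
      (∀ K ∈ S, finrank k K = d ∧ |(discr K : ℝ)| ≤ Y) → (S.card : ℝ) ≤ C * Y)
    (F : Finset (Subgroup (L ≃ₐ[k] L))) (hF : ∀ H ∈ F, H.index = d ∧
      (finrank k (IntermediateField.fixedField H) = d →
        |(discr (IntermediateField.fixedField H) : ℝ)| ≤ Y)) : (F.card : ℝ) ≤ C * Y := by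
  have hinj : Function.Injective
      (IntermediateField.fixedField : Subgroup (L ≃ₐ[k] L) → IntermediateField k L) :=
    fun H H' h => by
      rw [← IntermediateField.fixingSubgroup_fixedField H, h,
        IntermediateField.fixingSubgroup_fixedField]
  rw [← Finset.card_image_of_injective F hinj]
  refine hC _ fun K hK => ?_
  obtain ⟨H, hH, rfl⟩ := Finset.mem_image.1 hK
  have : finrank k (IntermediateField.fixedField H) = d := by
    rw [IntermediateField.finrank_eq_fixingSubgroup_index,
      IntermediateField.fixingSubgroup_fixedField, (hF H hH).1]
  exact ⟨this, (hF H hH).2 this⟩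

/-- The number of `S₃`-cubic subfields with a given set of tame totally ramified primes. -/
theorem exists_card_le_of_ramified (k : Type*) [Field k] [NumberField k] : ∃ C : ℝ, 0 < C ∧
    ∀ (L : Type*) [Field L] [NumberField L] [Algebra k L] [IsGalois k L],
      ∃ ρ : IntermediateField k L → Finset (Ideal (𝓞 k)),
        (∀ E : IntermediateField k L, finrank k E = 3 → (∀ p ∈ ρ E, IsTamePrime p) ∧
          ∀ p, IsTamePrime p →
            (∃ P : Ideal (𝓞 E), P.IsPrime ∧ p.map (algebraMap (𝓞 k) (𝓞 E)) = P ^ 3) →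
            p ∈ ρ E) ∧
        ∀ X : ℝ, 0 ≤ X → ∀ (R : Finset (Ideal (𝓞 k))) (T : Finset (IntermediateField k L)),
          (∀ E ∈ T, finrank k E = 3 ∧ ¬ E.fixingSubgroup.Normal ∧ |(discr E : ℝ)| ≤ X ∧
            ρ E = R) →
          (T.card : ℝ) * (∏ p ∈ R, (Ideal.absNorm p : ℝ)) ^ 2 ≤ C * 2 ^ R.card * X := by
  obtain ⟨C₂, hC₂, h₂⟩ := exists_card_quadratic_le k
  obtain ⟨C₃, hC₃, h₃⟩ := exists_card_cubic_le k
  set B : ℝ := 36 ^ (finrank ℚ k * 3) * |(discr k : ℝ)| ^ 3 with hB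
  have hB0 : 0 < B := by
    have : (discr k : ℝ) ≠ 0 := by exact_mod_cast discr_ne_zero k
    positivity
  refine ⟨3 * (C₂ + C₃) * B, by positivity, ?_⟩
  intro L _ _ _ _
  obtain ⟨g, hlow, hup, htot, hfin⟩ := exists_ramification_data k L
  let ram : IntermediateField k L → Finset (Ideal (𝓞 k)) := fun E =>
    if h : finrank k E = 3 then (hfin E h).toFinset else ∅
  have mem_ram : ∀ E : IntermediateField k L, finrank k E = 3 → ∀ p, p ∈ ram E ↔
      IsTamePrime p ∧ ∃ x, x⁻¹ * g p * x ∉ E.fixingSubgroup := fun E hE p => by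
    simp only [ram, dif_pos hE, Set.Finite.mem_toFinset, Set.mem_ofPred_eq]
  let ρ : IntermediateField k L → Finset (Ideal (𝓞 k)) := fun E =>
    (ram E).filter fun p => ∀ x, x⁻¹ * g p * x ∉ E.fixingSubgroup
  let σ : IntermediateField k L → Finset (Ideal (𝓞 k)) := fun E =>
    (ram E).filter fun p => ∃ x, x⁻¹ * g p * x ∈ E.fixingSubgroup
  have mem_ρ : ∀ E : IntermediateField k L, finrank k E = 3 → ∀ p, p ∈ ρ E ↔
      IsTamePrime p ∧ ∀ x, x⁻¹ * g p * x ∉ E.fixingSubgroup := fun E hE p => by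
    rw [Finset.mem_filter, mem_ram E hE]
    exact ⟨fun h => ⟨h.1.1, h.2⟩, fun h => ⟨⟨h.1, 1, h.2 1⟩, h.2⟩⟩
  have mem_σ : ∀ E : IntermediateField k L, finrank k E = 3 → ∀ p, p ∈ σ E ↔
      IsTamePrime p ∧ (∃ x, x⁻¹ * g p * x ∉ E.fixingSubgroup) ∧
        ∃ x, x⁻¹ * g p * x ∈ E.fixingSubgroup := fun E hE p => by
    rw [Finset.mem_filter, mem_ram E hE, and_assoc]
  refine ⟨ρ, fun E hE => ⟨fun p hp => ((mem_ρ E hE p).1 hp).1,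
    fun p hp hP => (mem_ρ E hE p).2 ⟨hp, htot E hE p hp hP⟩⟩, fun X hX R T hT => ?_⟩
  set N : ℝ := ∏ p ∈ R, (Ideal.absNorm p : ℝ) with hN
  have hN0 : 0 ≤ N := Finset.prod_nonneg fun p _ => Nat.cast_nonneg _
  rcases hN0.eq_or_lt with hN1 | hN1
  · rw [← hN1]
    have : 0 ≤ 3 * (C₂ + C₃) * B * 2 ^ R.card * X := by positivity
    simpa using this
  have hdisc : ∀ E ∈ T, N ^ 2 * ∏ p ∈ σ E, (Ideal.absNorm p : ℝ) ≤ X := by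
    intro E hE
    obtain ⟨h3, -, hXE, hR⟩ := hT E hE
    have h := hlow E h3 (ρ E) (σ E) ?_ (fun p hp => (mem_ρ E h3 p).1 hp)
      (fun p hp => let h := (mem_σ E h3 p).1 hp; ⟨h.1, h.2.1⟩)
    · refine le_trans ?_ hXE
      rw [hN, ← hR]
      have h' : (((∏ p ∈ ρ E, Ideal.absNorm p) ^ 2 * ∏ p ∈ σ E, Ideal.absNorm p : ℕ) : ℝ) ≤
        ((discr E).natAbs : ℕ) := by exact_mod_cast h
      rw [Nat.cast_natAbs] at h'
      push_cast at h'
      exact h'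
    · refine Finset.disjoint_left.2 fun p hp hp' => ?_
      obtain ⟨x, hx⟩ := ((mem_σ E h3 p).1 hp').2.2
      exact ((mem_ρ E h3 p).1 hp).2 x hx
  have hσ : ∀ E ∈ T, B * ∏ p ∈ σ E, (Ideal.absNorm p : ℝ) ≤ B * (X / N ^ 2) := fun E hE => by
    refine mul_le_mul_of_nonneg_left ?_ hB0.le
    rw [le_div_iff₀ (by positivity), mul_comm]
    exact hdisc E hE
  have hup' : ∀ E' : IntermediateField k L, finrank k E' = 2 ∨ finrank k E' = 3 → ∀ E ∈ T,
      (∀ p ∈ σ E, finrank k E' = 2 ∨ ∃ x, x⁻¹ * g p * x ∈ E'.fixingSubgroup) →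
      (∀ p, IsTamePrime p → p ∉ σ E → ∀ x, x⁻¹ * g p * x ∈ E'.fixingSubgroup) →
      |(discr E' : ℝ)| ≤ B * (X / N ^ 2) := by
    intro E' hE' E hE h1 h2
    refine le_trans ?_ (hσ E hE)
    have h := hup E' hE' (σ E)
      (fun p hp => ⟨((mem_σ E (hT E hE).1 p).1 hp).1, h1 p hp⟩) h2
    have h' : (((discr E').natAbs : ℕ) : ℝ) ≤
      ((36 ^ (finrank ℚ k * 3) * (discr k).natAbs ^ 3 * ∏ p ∈ σ E, Ideal.absNorm p : ℕ) : ℝ) := by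
      exact_mod_cast h
    push_cast [Nat.cast_natAbs] at h'
    exact h'
  have hcoc : ∀ E : IntermediateField k L, finrank k E = 3 →
      ∃ (ε : (L ≃ₐ[k] L) →* (ZMod 3)ˣ) (a : (L ≃ₐ[k] L) → ZMod 3), IsAffineCocycle ε a ∧
        Function.Surjective a ∧ ∀ g, a g = 0 ↔ g ∈ E.fixingSubgroup := by
    intro E hE
    have hidx : E.fixingSubgroup.index = 3 := by
      rw [← IntermediateField.finrank_eq_fixingSubgroup_index L E, hE]
    obtain ⟨ε, a, ha, h⟩ := E.fixingSubgroup.exists_isAffineCocycle hidx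
    refine ⟨ε, a, ha, ?_, h⟩
    rw [ha.surjective_iff_index_zeros, ← hidx]
    congr 1
    exact Subgroup.ext fun g => by rw [ha.mem_zeros, h]
  choose! ε a ha hs hmem using hcoc
  have ρ_iff : ∀ E : IntermediateField k L, finrank k E = 3 → ∀ p, p ∈ ρ E ↔
      IsTamePrime p ∧ ε E (g p) = 1 ∧ a E (g p) ≠ 0 := fun E hE p => by
    rw [mem_ρ E hE, ← (ha E hE).forall_conj_ne_zero_iff (hs E hE)]
    simp only [ne_eq, hmem E hE]
  have σ_iff : ∀ E : IntermediateField k L, finrank k E = 3 → ∀ p, p ∈ σ E ↔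
      IsTamePrime p ∧ ε E (g p) ≠ 1 := fun E hE p => by
    rw [mem_σ E hE, ← (ha E hE).exists_conj_iff (hs E hE)]
    simp only [ne_eq, hmem E hE]
  have hclass : ∀ s ∈ R.powerset,
      ((T.filter fun E => R.filter (fun p => a E (g p) = 1) = s).card : ℝ) ≤
        3 * (C₂ + C₃) * (B * (X / N ^ 2)) := by
    intro s _
    set U := T.filter fun E => R.filter (fun p => a E (g p) = 1) = s with hU
    have hUT : ∀ E ∈ U, E ∈ T := fun E hE => (Finset.mem_filter.1 hE).1
    have hU3 : ∀ E ∈ U, finrank k E = 3 := fun E hE => (hT E (hUT E hE)).1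
    have hUs : ∀ E ∈ U, R.filter (fun p => a E (g p) = 1) = s :=
      fun E hE => (Finset.mem_filter.1 hE).2
    set F : Finset (Subgroup (L ≃ₐ[k] L)) := U.image fun E => (ε E).ker with hF
    set K : Finset (Subgroup (L ≃ₐ[k] L)) := Finset.univ.filter fun Z => Z.index = 3 ∧
      ∃ E ∈ U, ∃ E' ∈ U, ε E = ε E' ∧ ∀ g, g ∈ Z ↔ (a E - a E') g = 0 with hK
    have hFcard : (F.card : ℝ) ≤ C₂ * (B * (X / N ^ 2)) := by
      refine card_subgroup_le (fun S hS => h₂ L _ (by positivity) S hS) F fun H hH => ?_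
      obtain ⟨E, hE, rfl⟩ := Finset.mem_image.1 hH
      obtain ⟨h3, hnorm, -, -⟩ := hT E (hUT E hE)
      refine ⟨MonoidHom.index_ker_of_ne_one _ ((ha E h3).ne_one_of_not_normal ?_), fun h2 => ?_⟩
      · convert hnorm
        exact Subgroup.ext fun g => by rw [(ha E h3).mem_zeros, hmem E h3]
      · refine hup' _ (Or.inl h2) E (hUT E hE) (fun _ _ => Or.inl h2) fun p hp hpσ x => ?_
        rw [IntermediateField.fixingSubgroup_fixedField, MonoidHom.mem_ker]
        have : ε E (g p) = 1 := by
          by_contra h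
          exact hpσ ((σ_iff E h3 p).2 ⟨hp, h⟩)
        rw [map_mul, map_mul, this, mul_one, ← map_mul, inv_mul_cancel, map_one]
    have hKcard : (K.card : ℝ) ≤ C₃ * (B * (X / N ^ 2)) := by
      refine card_subgroup_le (fun S hS => h₃ L _ (by positivity) S hS) K fun H hH => ?_
      obtain ⟨-, hH3, E, hE, E', hE', hεε, hZ⟩ := Finset.mem_filter.1 hH
      refine ⟨hH3, fun h3 => ?_⟩
      have hc : IsAffineCocycle (ε E) (a E - a E') :=
        (ha E (hU3 E hE)).sub (hεε ▸ ha E' (hU3 E' hE'))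
      have hcs : Function.Surjective (a E - a E') := by
        refine hc.surjective_iff_index_zeros.2 (Eq.trans (congrArg Subgroup.index ?_) hH3)
        exact Subgroup.ext fun g => by rw [hc.mem_zeros, hZ]
      refine hup' _ (Or.inr h3) E (hUT E hE) (fun p hp => Or.inr ?_) fun p hp hpσ x => ?_
      · obtain ⟨x, hx⟩ := hc.exists_conj_eq_zero hcs ((σ_iff E (hU3 E hE) p).1 hp).2
        refine ⟨x, ?_⟩
        rwa [IntermediateField.fixingSubgroup_fixedField, hZ]
      · have hε1 : ε E (g p) = 1 := by
          by_contra h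
          exact hpσ ((σ_iff E (hU3 E hE) p).2 ⟨hp, h⟩)
        rw [IntermediateField.fixingSubgroup_fixedField, hZ,
          hc.conj_eq_zero_iff_of_eq_one x hε1, Pi.sub_apply, sub_eq_zero]
        have hR : p ∈ R ↔ a E (g p) ≠ 0 := by
          rw [← (hT E (hUT E hE)).2.2.2, ρ_iff E (hU3 E hE)]
          exact ⟨fun h => h.2.2, fun h => ⟨hp, hε1, h⟩⟩
        have hR' : p ∈ R ↔ a E' (g p) ≠ 0 := by
          rw [← (hT E' (hUT E' hE')).2.2.2, ρ_iff E' (hU3 E' hE')]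
          exact ⟨fun h => h.2.2, fun h => ⟨hp, hεε ▸ hε1, h⟩⟩
        have hsgn : (p ∈ R ∧ a E (g p) = 1) ↔ (p ∈ R ∧ a E' (g p) = 1) := by
          simpa only [Finset.mem_filter] using
            Finset.ext_iff.1 ((hUs E hE).trans (hUs E' hE').symm) p
        have key : ∀ (P : Prop) (u v : ZMod 3), (P ↔ u ≠ 0) → (P ↔ v ≠ 0) →
            ((P ∧ u = 1) ↔ (P ∧ v = 1)) → u = v := by
          intro P u v h1 h2 h3
          by_cases hP : P
          · simp only [hP, true_iff, true_and] at h1 h2 h3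
            revert u v; decide
          · simp only [hP, false_iff, not_not, ne_eq] at h1 h2
            rw [h1, h2]
        exact key _ _ _ hR hR' hsgn
    have hcard := card_le_of_isAffineCocycle U ε a (fun E hE => ha E (hU3 E hE)) ?_ F K
      (fun E hE => Finset.mem_image_of_mem _ hE) ?_
    · have hcard' : (U.card : ℝ) ≤ 3 * (F.card + K.card) := by exact_mod_cast hcard
      linarith
    · intro E hE E' hE' h
      have : E.fixingSubgroup = E'.fixingSubgroup := Subgroup.ext fun g => by
        rw [← hmem E (hU3 E hE), ← hmem E' (hU3 E' hE'), h]
      rw [← IsGalois.fixedField_fixingSubgroup E, this, IsGalois.fixedField_fixingSubgroup]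
    · intro E hE E' hE' hεε hsur
      have hc : IsAffineCocycle (ε E) (a E - a E') :=
        (ha E (hU3 E hE)).sub (hεε ▸ ha E' (hU3 E' hE'))
      exact ⟨hc.zeros, Finset.mem_filter.2 ⟨Finset.mem_univ _,
        hc.surjective_iff_index_zeros.1 hsur, E, hE, E', hE', hεε, fun g => hc.mem_zeros⟩,
        fun g => hc.mem_zeros⟩
  have hsum : T.card = ∑ s ∈ R.powerset,
      (T.filter fun E => R.filter (fun p => a E (g p) = 1) = s).card :=
    Finset.card_eq_sum_card_fiberwise fun E _ =>
      Finset.mem_coe.2 (Finset.mem_powerset.2 (Finset.filter_subset _ _))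
  have hcard : (T.card : ℝ) ≤ 2 ^ R.card * (3 * (C₂ + C₃) * (B * (X / N ^ 2))) := by
    rw [hsum, Nat.cast_sum]
    refine (Finset.sum_le_sum hclass).trans_eq ?_
    rw [Finset.sum_const, Finset.card_powerset, nsmul_eq_mul]
    push_cast
    rfl
  calc (T.card : ℝ) * N ^ 2
      ≤ 2 ^ R.card * (3 * (C₂ + C₃) * (B * (X / N ^ 2))) * N ^ 2 := by gcongr
    _ = _ := by field_simp

end countRamified

section primeSums

open NumberField Module

variable {k : Type*} [Field k] [NumberField k]

lemma prod_absNorm_le_pow_of_mem (m : ℕ) (hm : m ≠ 0) (W : Finset (Ideal (𝓞 k)))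
    (hW : ∀ p ∈ W, Prime p ∧ (m : 𝓞 k) ∈ p) :
    ∏ p ∈ W, Ideal.absNorm p ≤ m ^ finrank ℚ k := by
  have h : ∏ p ∈ W, p ∣ Ideal.span {(m : 𝓞 k)} :=
    Finset.prod_primes_dvd _ (fun p hp => (hW p hp).1) fun p hp =>
      Ideal.dvd_span_singleton.2 (hW p hp).2
  have h1 := Ideal.absNorm_dvd_absNorm_of_le (Ideal.dvd_iff_le.1 h)
  rw [Ideal.absNorm_span_natCast, RingOfIntegers.rank, map_prod] at h1
  exact Nat.le_of_dvd (by positivity) h1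

lemma exists_prime_mem_of_prime {p : Ideal (𝓞 k)} (hp : Prime p) :
    ∃ q : ℕ, q.Prime ∧ (q : 𝓞 k) ∈ p ∧ q ≤ Ideal.absNorm p := by
  have hp' : p.IsPrime := Ideal.isPrime_of_prime hp
  have h0 : Ideal.absNorm p ≠ 0 := fun h => hp.ne_zero (Ideal.absNorm_eq_zero_iff.1 h)
  have key : ∀ n : ℕ, n ≠ 0 → (n : 𝓞 k) ∈ p → ∃ q : ℕ, q.Prime ∧ (q : 𝓞 k) ∈ p ∧ q ≤ n := by
    intro n
    induction n using Nat.strong_induction_on with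
    | _ n ih =>
      intro hn hmem
      have hn1 : n ≠ 1 := by
        rintro rfl
        rw [Nat.cast_one] at hmem
        exact hp'.ne_top ((Ideal.eq_top_iff_one p).2 hmem)
      obtain ⟨m, hm⟩ := n.minFac_dvd
      have hq := Nat.minFac_prime hn1
      have hm0 : m ≠ 0 := by rintro rfl; exact hn (by simpa using hm)
      rw [hm, Nat.cast_mul] at hmem
      rcases hp'.mem_or_mem hmem with h | h
      · exact ⟨n.minFac, hq, h, Nat.minFac_le (Nat.pos_of_ne_zero hn)⟩
      · have hlt : m < n := by
          have := hq.two_le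
          have : 2 * m ≤ n.minFac * m := Nat.mul_le_mul_right _ this
          omega
        obtain ⟨q, h1, h2, h3⟩ := ih m hlt hm0 h
        exact ⟨q, h1, h2, h3.trans hlt.le⟩
  exact key _ h0 (Ideal.absNorm_mem p)

variable (k) in
/-- The sum of the inverse squares of the norms of the primes is finite. -/
lemma exists_sum_inv_absNorm_sq_le : ∃ M : ℝ, ∀ U : Finset (Ideal (𝓞 k)),
    (∀ p ∈ U, Prime p) → ∑ p ∈ U, ((Ideal.absNorm p : ℝ) ^ 2)⁻¹ ≤ M := by
  have hsum : Summable fun m : ℕ => ((m : ℝ) ^ 2)⁻¹ := Real.summable_nat_pow_inv.2 one_lt_two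
  refine ⟨finrank ℚ k * ∑' m : ℕ, ((m : ℝ) ^ 2)⁻¹, fun U hU => ?_⟩
  have hq : ∀ p : Ideal (𝓞 k), p ∈ U →
      ∃ q : ℕ, q.Prime ∧ (q : 𝓞 k) ∈ p ∧ q ≤ Ideal.absNorm p :=
    fun p hp => exists_prime_mem_of_prime (hU p hp)
  choose! q hq1 hq2 hq3 using hq
  have hfib : ∀ m ∈ U.image q, ∑ p ∈ U with q p = m, ((Ideal.absNorm p : ℝ) ^ 2)⁻¹ ≤
      finrank ℚ k * ((m : ℝ) ^ 2)⁻¹ := by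
    intro m hm
    obtain ⟨p₀, hp₀, rfl⟩ := Finset.mem_image.1 hm
    have hpos := (hq1 p₀ hp₀).pos
    have hcard : (U.filter fun p => q p = q p₀).card ≤ finrank ℚ k := by
      have h1 := prod_absNorm_le_pow_of_mem (q p₀) hpos.ne' (U.filter fun p => q p = q p₀)
        fun p hp => by
          obtain ⟨hp, hpq⟩ := Finset.mem_filter.1 hp
          exact ⟨hU p hp, hpq ▸ hq2 p hp⟩
      have h2 : q p₀ ^ (U.filter fun p => q p = q p₀).card ≤
          ∏ p ∈ U with q p = q p₀, Ideal.absNorm p := by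
        rw [← Finset.prod_const]
        refine Finset.prod_le_prod' fun p hp => ?_
        obtain ⟨hp, hpq⟩ := Finset.mem_filter.1 hp
        exact hpq ▸ hq3 p hp
      exact (Nat.pow_le_pow_iff_right (hq1 p₀ hp₀).one_lt).1 (h2.trans h1)
    calc ∑ p ∈ U with q p = q p₀, ((Ideal.absNorm p : ℝ) ^ 2)⁻¹
        ≤ ∑ p ∈ U with q p = q p₀, ((q p₀ : ℝ) ^ 2)⁻¹ := by
          refine Finset.sum_le_sum fun p hp => ?_
          obtain ⟨hp, hpq⟩ := Finset.mem_filter.1 hp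
          have : (q p₀ : ℝ) ≤ Ideal.absNorm p := by exact_mod_cast hpq ▸ hq3 p hp
          have h0 : (0 : ℝ) < q p₀ := by exact_mod_cast hpos
          gcongr
      _ ≤ _ := by
          rw [Finset.sum_const, nsmul_eq_mul]
          gcongr
  calc ∑ p ∈ U, ((Ideal.absNorm p : ℝ) ^ 2)⁻¹
      = ∑ m ∈ U.image q, ∑ p ∈ U with q p = m, ((Ideal.absNorm p : ℝ) ^ 2)⁻¹ :=
        (Finset.sum_fiberwise_of_maps_to (fun p hp => Finset.mem_image_of_mem q hp) _).symm
    _ ≤ ∑ m ∈ U.image q, finrank ℚ k * ((m : ℝ) ^ 2)⁻¹ := Finset.sum_le_sum hfib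
    _ = finrank ℚ k * ∑ m ∈ U.image q, ((m : ℝ) ^ 2)⁻¹ := (Finset.mul_sum _ _ _).symm
    _ ≤ _ := by
        gcongr
        exact hsum.sum_le_tsum _ fun m _ => by positivity

/-- The sum of a multiplicative weight over finite sets containing a given one. -/
lemma sum_prod_le_of_subset {α : Type*} [DecidableEq α] (f : α → ℝ) (hf : ∀ a, 0 ≤ f a)
    (A : Finset α) (𝓡 : Finset (Finset α)) (hA : ∀ R ∈ 𝓡, A ⊆ R) :
    ∑ R ∈ 𝓡, ∏ a ∈ R, f a ≤ (∏ a ∈ A, f a) * Real.exp (∑ a ∈ 𝓡.biUnion id, f a) := by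
  have hprod : ∀ s : Finset α, 0 ≤ ∏ a ∈ s, f a := fun s => Finset.prod_nonneg fun a _ => hf a
  calc ∑ R ∈ 𝓡, ∏ a ∈ R, f a
      = (∏ a ∈ A, f a) * ∑ R ∈ 𝓡, ∏ a ∈ R \ A, f a := by
        rw [Finset.mul_sum]
        refine Finset.sum_congr rfl fun R hR => ?_
        rw [mul_comm, Finset.prod_sdiff (hA R hR)]
    _ ≤ (∏ a ∈ A, f a) * ∑ S ∈ (𝓡.biUnion id).powerset, ∏ a ∈ S, f a := by
        refine mul_le_mul_of_nonneg_left ?_ (hprod A)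
        rw [← Finset.sum_image (s := 𝓡) (g := fun R => R \ A) (f := fun S => ∏ a ∈ S, f a)]
        · refine Finset.sum_le_sum_of_subset_of_nonneg (fun S hS => ?_) fun S _ _ => hprod S
          obtain ⟨R, hR, rfl⟩ := Finset.mem_image.1 hS
          exact Finset.mem_powerset.2 (Finset.sdiff_subset.trans
            (Finset.subset_biUnion_of_mem id hR))
        · intro R hR R' hR' h
          have h' : R \ A = R' \ A := h
          rw [← Finset.sdiff_union_of_subset (hA R hR), h',
            Finset.sdiff_union_of_subset (hA R' hR')]
    _ ≤ _ := by
        refine mul_le_mul_of_nonneg_left ?_ (hprod A)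
        rw [← Finset.prod_add_one, Real.exp_sum]
        exact Finset.prod_le_prod (fun a _ => add_nonneg (hf a) zero_le_one)
          fun a _ => Real.add_one_le_exp _

variable (k) in
/-- Two to the number of prime divisors is bounded by any power of the norm. -/
lemma exists_two_pow_card_le {ε : ℝ} (hε : 0 < ε) : ∃ D : ℝ, 0 < D ∧
    ∀ A : Finset (Ideal (𝓞 k)), (∀ p ∈ A, Prime p) →
      (2 : ℝ) ^ A.card ≤ D * (∏ p ∈ A, (Ideal.absNorm p : ℝ)) ^ ε := by
  set m := ⌈(2 : ℝ) ^ ε⁻¹⌉₊ with hm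
  have hfin : {I : Ideal (𝓞 k) | Ideal.absNorm I ≤ m}.Finite :=
    Ideal.finite_setOfPred_absNorm_le m
  refine ⟨2 ^ hfin.toFinset.card, by positivity, fun A hA => ?_⟩
  rw [← Real.finsetProd_rpow _ _ fun p _ => Nat.cast_nonneg _,
    ← Finset.card_filter_add_card_filter_not (s := A) (fun p => Ideal.absNorm p ≤ m), pow_add]
  have hone : ∀ p ∈ A, (1 : ℝ) ≤ (Ideal.absNorm p : ℝ) ^ ε := fun p hp => by
    refine Real.one_le_rpow ?_ hε.le
    have : Ideal.absNorm p ≠ 0 := fun h => (hA p hp).ne_zero (Ideal.absNorm_eq_zero_iff.1 h)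
    exact_mod_cast Nat.one_le_iff_ne_zero.2 this
  refine mul_le_mul ?_ ?_ (by positivity) (by positivity)
  · refine pow_le_pow_right₀ one_le_two (Finset.card_le_card fun p hp => ?_)
    simpa using (Finset.mem_filter.1 hp).2
  · rw [← Finset.prod_const]
    calc ∏ p ∈ A with ¬ Ideal.absNorm p ≤ m, (2 : ℝ)
        ≤ ∏ p ∈ A with ¬ Ideal.absNorm p ≤ m, (Ideal.absNorm p : ℝ) ^ ε := by
          refine Finset.prod_le_prod (fun _ _ => zero_le_two) fun p hp => ?_
          have h1 : (2 : ℝ) ^ ε⁻¹ ≤ Ideal.absNorm p :=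
            (Nat.le_ceil _).trans (by exact_mod_cast (not_le.1 (Finset.mem_filter.1 hp).2).le)
          calc (2 : ℝ) = ((2 : ℝ) ^ ε⁻¹) ^ ε := by
                rw [← Real.rpow_mul zero_le_two, inv_mul_cancel₀ hε.ne', Real.rpow_one]
            _ ≤ _ := Real.rpow_le_rpow (by positivity) h1 hε.le
      _ ≤ ∏ p ∈ A, (Ideal.absNorm p : ℝ) ^ ε :=
          Finset.prod_le_prod_of_subset_of_one_le (Finset.filter_subset _ _)
            (fun p hp => zero_le_one.trans (hone p (Finset.filter_subset _ _ hp)))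
            fun p hp _ => hone p hp

lemma isTamePrime_iff {p : Ideal (𝓞 k)} : IsTamePrime p ↔ Prime p ∧ ((6 : ℕ) : 𝓞 k) ∉ p :=
  ⟨fun h => ⟨Ideal.prime_of_isPrime h.2.1 h.1, h.2.2⟩,
    fun h => ⟨Ideal.isPrime_of_prime h.1, h.1.ne_zero, h.2⟩⟩

/-- The tame part of a squarefree ideal. -/
lemma exists_tame_part {r : Ideal (𝓞 k)} (hr : Squarefree r) :
    ∃ A : Finset (Ideal (𝓞 k)), (∀ p ∈ A, IsTamePrime p ∧ p ∣ r) ∧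
      ∏ p ∈ A, Ideal.absNorm p ≤ Ideal.absNorm r ∧
      Ideal.absNorm r ≤ 6 ^ finrank ℚ k * ∏ p ∈ A, Ideal.absNorm p := by
  have hr0 : r ≠ ⊥ := hr.ne_zero
  set P : Finset (Ideal (𝓞 k)) := ⟨UniqueFactorizationMonoid.normalizedFactors r,
    (UniqueFactorizationMonoid.squarefree_iff_nodup_normalizedFactors hr0).1 hr⟩ with hP
  have hprod : ∏ p ∈ P, p = r := by
    rw [hP, Finset.prod_mk, Multiset.map_id', Ideal.prod_normalizedFactors_eq_self hr0]
  have hmem : ∀ p ∈ P, Prime p ∧ p ∣ r := fun p hp => by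
    rw [hP, Finset.mem_mk] at hp
    exact ⟨UniqueFactorizationMonoid.prime_of_normalized_factor p hp,
      UniqueFactorizationMonoid.dvd_of_mem_normalizedFactors hp⟩
  have hnorm : (∏ p ∈ P with ((6 : ℕ) : 𝓞 k) ∉ p, Ideal.absNorm p) *
      ∏ p ∈ P with ¬ ((6 : ℕ) : 𝓞 k) ∉ p, Ideal.absNorm p = Ideal.absNorm r := by
    rw [Finset.prod_filter_mul_prod_filter_not, ← map_prod, hprod]
  have hne : Ideal.absNorm r ≠ 0 := fun h => hr0 (Ideal.absNorm_eq_zero_iff.1 h)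
  refine ⟨P.filter fun p => ((6 : ℕ) : 𝓞 k) ∉ p, fun p hp => ?_, ?_, ?_⟩
  · obtain ⟨hp, h6⟩ := Finset.mem_filter.1 hp
    exact ⟨isTamePrime_iff.2 ⟨(hmem p hp).1, h6⟩, (hmem p hp).2⟩
  · exact Nat.le_of_dvd (Nat.pos_of_ne_zero hne) ⟨_, hnorm.symm⟩
  · rw [← hnorm, mul_comm]
    refine Nat.mul_le_mul_right _ (prod_absNorm_le_pow_of_mem 6 (by norm_num) _ fun p hp => ?_)
    obtain ⟨hp, h6⟩ := Finset.mem_filter.1 hp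
    exact ⟨(hmem p hp).1, not_not.1 h6⟩

end primeSums

section countTotallyRamified

open NumberField Module

/-- The uniformity estimate for the subfields of a fixed Galois extension. -/
theorem exists_card_le_of_totallyRamified (k : Type*) [Field k] [NumberField k] {ε : ℝ}
    (hε : 0 < ε) : ∃ C : ℝ, 0 < C ∧
    ∀ (L : Type*) [Field L] [NumberField L] [Algebra k L] [IsGalois k L] (r : Ideal (𝓞 k)),
      Squarefree r → ∀ X : ℝ, 0 ≤ X → ∀ T : Finset (IntermediateField k L),
        (∀ E ∈ T, finrank k E = 3 ∧ ¬ E.fixingSubgroup.Normal ∧ |(discr E : ℝ)| ≤ X ∧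
          ∀ p : Ideal (𝓞 k), p.IsPrime → p ∣ r →
            ∃ P : Ideal (𝓞 E), P.IsPrime ∧ p.map (algebraMap (𝓞 k) (𝓞 E)) = P ^ 3) →
        (T.card : ℝ) ≤ C * X / (Ideal.absNorm r : ℝ) ^ ((2 : ℝ) - ε) := by
  obtain ⟨C, hC, hcount⟩ := exists_card_le_of_ramified k
  obtain ⟨M, hM⟩ := exists_sum_inv_absNorm_sq_le k
  obtain ⟨D, hD, hpow⟩ := exists_two_pow_card_le k hε
  set S : ℝ := 6 ^ finrank ℚ k with hS
  have hS0 : 0 < S := by positivity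
  refine ⟨C * Real.exp (2 * M) * D * S ^ 2, by positivity, ?_⟩
  intro L _ _ _ _ r hr X hX T hT
  obtain ⟨ρ, hρ, hcard⟩ := hcount L
  obtain ⟨A, hA, hA1, hA2⟩ := exists_tame_part hr
  set NA : ℝ := ∏ p ∈ A, (Ideal.absNorm p : ℝ) with hNA
  set Nr : ℝ := (Ideal.absNorm r : ℝ) with hNr
  have hAprime : ∀ p ∈ A, Prime p := fun p hp => (isTamePrime_iff.1 (hA p hp).1).1
  have hpos : ∀ p : Ideal (𝓞 k), Prime p → (0 : ℝ) < Ideal.absNorm p := fun p hp => by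
    have : Ideal.absNorm p ≠ 0 := fun h => hp.ne_zero (Ideal.absNorm_eq_zero_iff.1 h)
    exact_mod_cast Nat.pos_of_ne_zero this
  have hNA0 : 0 < NA := Finset.prod_pos fun p hp => hpos p (hAprime p hp)
  have hle1 : NA ≤ Nr := by rw [hNA, hNr]; exact_mod_cast hA1
  have hle2 : Nr ≤ S * NA := by rw [hNA, hNr, hS]; exact_mod_cast hA2
  have hNr0 : 0 < Nr := hNA0.trans_le hle1
  set 𝓡 := T.image ρ with h𝓡
  have hR : ∀ R ∈ 𝓡, A ⊆ R ∧ ∀ p ∈ R, Prime p := by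
    intro R hR
    obtain ⟨E, hE, rfl⟩ := Finset.mem_image.1 hR
    obtain ⟨h3, -, -, htot⟩ := hT E hE
    exact ⟨fun p hp => (hρ E h3).2 p (hA p hp).1 (htot p (hA p hp).1.1 (hA p hp).2),
      fun p hp => (isTamePrime_iff.1 ((hρ E h3).1 p hp)).1⟩
  set f : Ideal (𝓞 k) → ℝ := fun p => 2 * ((Ideal.absNorm p : ℝ) ^ 2)⁻¹ with hf
  have hf0 : ∀ p, 0 ≤ f p := fun p => by positivity
  have hprodf : ∀ R : Finset (Ideal (𝓞 k)),
      ∏ p ∈ R, f p = 2 ^ R.card / (∏ p ∈ R, (Ideal.absNorm p : ℝ)) ^ 2 := fun R => by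
    rw [hf, Finset.prod_mul_distrib, Finset.prod_const, Finset.prod_inv_distrib, Finset.prod_pow,
      div_eq_mul_inv]
  have hfib : ∀ R ∈ 𝓡, ((T.filter fun E => ρ E = R).card : ℝ) ≤ C * X * ∏ p ∈ R, f p := by
    intro R hRm
    have hN : 0 < ∏ p ∈ R, (Ideal.absNorm p : ℝ) :=
      Finset.prod_pos fun p hp => hpos p ((hR R hRm).2 p hp)
    have hfilter : ∀ E ∈ T.filter fun E => ρ E = R, finrank k E = 3 ∧
        ¬ E.fixingSubgroup.Normal ∧ |(discr E : ℝ)| ≤ X ∧ ρ E = R := by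
      intro E hE
      have hET := (Finset.mem_filter.1 hE).1
      have hER := (Finset.mem_filter.1 hE).2
      have h' := hT E hET
      exact ⟨h'.1, h'.2.1, h'.2.2.1, hER⟩
    have h := hcard X hX R (T.filter fun E => ρ E = R) hfilter
    rw [hprodf, ← mul_div_assoc, le_div_iff₀ (pow_pos hN 2)]
    linarith
  have hT1 : (T.card : ℝ) ≤ C * X * ∑ R ∈ 𝓡, ∏ p ∈ R, f p := by
    rw [Finset.card_eq_sum_card_image ρ T, Nat.cast_sum, Finset.mul_sum]
    exact Finset.sum_le_sum hfib
  have hsum : ∑ R ∈ 𝓡, ∏ p ∈ R, f p ≤ (∏ p ∈ A, f p) * Real.exp (2 * M) := by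
    refine (sum_prod_le_of_subset f hf0 A 𝓡 fun R hRm => (hR R hRm).1).trans ?_
    refine mul_le_mul_of_nonneg_left (Real.exp_le_exp.2 ?_) (Finset.prod_nonneg fun p _ => hf0 p)
    rw [hf, ← Finset.mul_sum]
    refine mul_le_mul_of_nonneg_left (hM _ fun p hp => ?_) zero_le_two
    obtain ⟨R, hRm, hpR⟩ := Finset.mem_biUnion.1 hp
    exact (hR R hRm).2 p hpR
  have hAf : ∏ p ∈ A, f p ≤ D * S ^ 2 / Nr ^ ((2 : ℝ) - ε) := by
    rw [hprodf, Real.rpow_sub hNr0, Real.rpow_two, div_div_eq_mul_div]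
    have h1 : (2 : ℝ) ^ A.card ≤ D * Nr ^ ε :=
      (hpow A hAprime).trans
        (mul_le_mul_of_nonneg_left (Real.rpow_le_rpow hNA0.le hle1 hε.le) hD.le)
    have h2 : Nr ^ 2 ≤ S ^ 2 * NA ^ 2 := by
      rw [← mul_pow]; exact pow_le_pow_left₀ hNr0.le hle2 2
    rw [div_le_div_iff₀ (pow_pos hNA0 2) (pow_pos hNr0 2)]
    calc (2 : ℝ) ^ A.card * Nr ^ 2 ≤ D * Nr ^ ε * (S ^ 2 * NA ^ 2) := by gcongr
      _ = _ := by ring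
  calc (T.card : ℝ) ≤ C * X * (D * S ^ 2 / Nr ^ ((2 : ℝ) - ε) * Real.exp (2 * M)) := by
        refine hT1.trans (mul_le_mul_of_nonneg_left (hsum.trans ?_) (by positivity))
        exact mul_le_mul_of_nonneg_right hAf (Real.exp_pos _).le
    _ = _ := by ring

end countTotallyRamified

open NumberField Module in
/-- Total ramification is invariant under isomorphisms of extensions. -/
theorem exists_map_eq_pow_three_of_algEquiv {K F F' : Type*} [Field K] [Field F] [Field F']
    [Algebra K F] [Algebra K F'] (e : F ≃ₐ[K] F') {p : Ideal (𝓞 K)}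
    (h : ∃ P : Ideal (𝓞 F), P.IsPrime ∧ p.map (algebraMap (𝓞 K) (𝓞 F)) = P ^ 3) :
    ∃ P : Ideal (𝓞 F'), P.IsPrime ∧ p.map (algebraMap (𝓞 K) (𝓞 F')) = P ^ 3 := by
  obtain ⟨P, hP, h⟩ := h
  let f := (RingOfIntegers.mapRingEquiv e.toRingEquiv)
  refine ⟨P.map f, Ideal.map_isPrime_of_equiv f, ?_⟩
  have hf : algebraMap (𝓞 K) (𝓞 F') = (f : 𝓞 F →+* 𝓞 F').comp (algebraMap (𝓞 K) (𝓞 F)) := by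
    ext x
    exact (e.commutes (x : K)).symm
  rw [← Ideal.map_pow, ← h, hf, ← Ideal.map_map]
  rfl

/-- An `S3`-cubic extension is not normal. -/
theorem IsSThreeCubic.not_normal {K : IntermediateField k kbar} (hK : IsSThreeCubic k K) :
    ¬ Normal k K := by
  intro hn
  have : FiniteDimensional k K := Module.finite_of_finrank_pos (by rw [hK.1]; norm_num)
  have hcard : Fintype.card (K →ₐ[k] kbar) = 3 := by rw [AlgHom.card, hK.1]
  obtain ⟨f₁, h₁⟩ := Fintype.exists_ne_of_one_lt_card (by omega) K.val
  obtain ⟨f₂, h₂⟩ : ∃ f₂, f₂ ∉ ({K.val, f₁} : Finset (K →ₐ[k] kbar)) := by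
    by_contra! hall
    have : Fintype.card (K →ₐ[k] kbar) ≤ 2 :=
      (Finset.card_le_card fun x _ => hall x).trans Finset.card_le_two
    omega
  simp only [Finset.mem_insert, Finset.mem_singleton, not_or] at h₂
  obtain ⟨σ, hσ⟩ := hK.2 (Equiv.swap f₁ f₂)
  have hfix (x : K) : σ x = x := by
    have : galPermHom k K σ K.val = K.val := by
      rw [hσ, Equiv.swap_apply_of_ne_of_ne h₁.symm (Ne.symm h₂.1)]
    exact DFunLike.congr_fun this x
  have hswap : galPermHom k K σ f₁ = f₂ := by rw [hσ, Equiv.swap_apply_left]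
  refine h₂.2 (hswap.symm.trans (AlgHom.ext fun x => ?_))
  have hx : f₁ x ∈ K := (AlgHom.fieldRange_of_normal f₁).le ⟨x, rfl⟩
  exact hfix ⟨f₁ x, hx⟩

theorem cast_absDisc (K : IntermediateField k kbar) [FiniteDimensional k K] [NumberField K] :
    (absDisc k K : ℝ) = |(NumberField.discr K : ℝ)| := by
  rw [absDisc, dif_pos ‹FiniteDimensional k K›, Nat.cast_natAbs, Int.cast_abs]

/-- A finite collection of finite extensions of `k` embeds into the subfields of a common finite
Galois extension. -/
theorem exists_isGalois_of_finset (T : Finset (IntermediateField k kbar))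
    (hT : ∀ E ∈ T, FiniteDimensional k E) :
    ∃ L : IntermediateField k kbar, FiniteDimensional k L ∧ IsGalois k L ∧ ∀ E ∈ T, E ≤ L := by
  have : FiniteDimensional k (⨆ E ∈ T, E : IntermediateField k kbar) :=
    IntermediateField.finiteDimensional_iSup_of_finset' hT
  refine ⟨IntermediateField.normalClosure k (⨆ E ∈ T, E : IntermediateField k kbar) kbar,
    normalClosure.is_finiteDimensional _ _ _, ⟨⟩, fun E hE => ?_⟩
  exact (le_iSup₂ (f := fun (E : IntermediateField k kbar) (_ : E ∈ T) => E) E hE).trans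
    (IntermediateField.le_normalClosure _)

theorem exists_finset_card_eq_countClasses (S : Set (IntermediateField k kbar)) :
    ∃ T : Finset (IntermediateField k kbar), ↑T ⊆ S ∧ T.card = countClasses k S := by
  rcases finite_or_infinite (Quotient (Setoid.comap (Subtype.val : S → _) (isoSetoid k)))
    with hfin | hinf
  · have := Fintype.ofFinite (Quotient (Setoid.comap (Subtype.val : S → _) (isoSetoid k)))
    refine ⟨Finset.univ.image fun q :
      Quotient (Setoid.comap (Subtype.val : S → _) (isoSetoid k)) => q.out.1, ?_, ?_⟩
    · intro E hE
      obtain ⟨q, -, rfl⟩ := Finset.mem_image.1 (Finset.mem_coe.1 hE)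
      exact q.out.2
    · rw [Finset.card_image_of_injective _ fun a b h => Quotient.out_injective (Subtype.ext h),
        countClasses, Nat.card_eq_fintype_card, Finset.card_univ]
  · exact ⟨∅, by simp, by rw [countClasses, Nat.card_eq_zero_of_infinite, Finset.card_empty]⟩

/-- **Uniformity estimate for totally ramified `S3`-cubic extensions**
(Datskovsky–Wright; Theorem 3.1).  For every `ε > 0` there is a constant `C`
(depending only on `k` and `ε`) such that for every squarefree integral ideal `r` of
`𝒪_k` and every `X ≥ 1`, the number of `S3`-cubic extensions `K/k` (up to isomorphism)
with `Disc(K) ≤ X` that are totally ramified at every prime dividing `r` is at most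
`C · X / |r|^(2 - ε)`. -/
theorem uniformity_totally_ramified (k : Type*) [Field k] [NumberField k]
    (ε : ℝ) (hε : 0 < ε) :
    ∃ C : ℝ, 0 < C ∧ ∀ r : Ideal (𝓞 k), Squarefree r → ∀ X : ℝ, 1 ≤ X →
      (countClasses k {K : IntermediateField k (AlgebraicClosure k) |
          IsSThreeCubic k K ∧ (absDisc k K : ℝ) ≤ X ∧
          ∀ p : Ideal (𝓞 k), p.IsPrime → p ∣ r → TotallyRamified k K p} : ℝ)
        ≤ C * X / (Ideal.absNorm r : ℝ) ^ ((2 : ℝ) - ε) := by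
  obtain ⟨C, hC, hbound⟩ := exists_card_le_of_totallyRamified k hε
  refine ⟨C, hC, fun r hr X hX => ?_⟩
  obtain ⟨T, hTS, hcard⟩ := exists_finset_card_eq_countClasses k
    {K : IntermediateField k (AlgebraicClosure k) | IsSThreeCubic k K ∧ (absDisc k K : ℝ) ≤ X ∧
      ∀ p : Ideal (𝓞 k), p.IsPrime → p ∣ r → TotallyRamified k K p}
  rw [← hcard]
  have hfin (E) (hE : E ∈ T) : FiniteDimensional k E :=
    Module.finite_of_finrank_pos (by rw [(hTS hE).1.1]; norm_num)
  obtain ⟨L, hLfin, hLgal, hTL⟩ := exists_isGalois_of_finset k T hfin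
  have : NumberField L := NumberField.of_module_finite k L
  let φ (E : IntermediateField k (AlgebraicClosure k)) : IntermediateField k L :=
    if h : E ≤ L then IntermediateField.restrict h else ⊥
  have hφ (E) (hE : E ∈ T) : φ E = IntermediateField.restrict (hTL E hE) := dif_pos (hTL E hE)
  have hinj : Set.InjOn φ T := by
    intro E hE E' hE' h
    rw [hφ E hE, hφ E' hE'] at h
    rw [← IntermediateField.lift_restrict (hTL E hE), h, IntermediateField.lift_restrict]
  rw [← Finset.card_image_of_injOn hinj]
  refine hbound L r hr X (by linarith) _ fun F hF => ?_
  obtain ⟨E, hE, rfl⟩ := Finset.mem_image.1 hF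
  rw [hφ E hE]
  obtain ⟨hS, hdisc, hram⟩ := hTS hE
  have := hfin E hE
  have : NumberField E := NumberField.of_module_finite k E
  let e := IntermediateField.restrictAlgEquiv (hTL E hE)
  refine ⟨e.toLinearEquiv.finrank_eq.symm.trans hS.1, fun hnormal => ?_, ?_, fun p hp hpr =>
    exists_map_eq_pow_three_of_algEquiv e (hram p hp hpr)⟩
  · have := IsGalois.of_fixedField_normal_subgroup
      (IntermediateField.restrict (hTL E hE)).fixingSubgroup
    rw [IsGalois.fixedField_fixingSubgroup] at this
    exact hS.not_normal k (Normal.of_algEquiv e.symm)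
  · rw [← NumberField.discr_eq_discr_of_ringEquiv E e.toRingEquiv, ← cast_absDisc k E]
    exact hdisc
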